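/- arXiv:2512.23651 — 5 statements merged into one kernel-verified Lean document; each statement's English description precedes it below -/
import Mathlib

section
/- There exists a universal constant C > 0 such that for every d ≥ 2, every o-symmetric convex body K in ℝ^d, and every full-rank lattice L in ℝ^d for which the lattice arrangement L + K = ⋃_{z∈L}(z + K) is non-separable (every hyperplane of ℝ^d intersects L + K), the following holds: for every x ∈ ℝ^d and λ > 0, if the interior of x + λK is disjoint from L + K, then λ ≤ C·d·(1 + log d). -/
open Set Metric Pointwise MeasureTheory

noncomputable section

abbrev Euc (d : ℕ) := EuclideanSpace ℝ (Fin d)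

variable {d : ℕ}

/-- A convex body: compact, convex, with nonempty interior. -/
def IsConvexBody (K : Set (Euc d)) : Prop :=
  IsCompact K ∧ Convex ℝ K ∧ (interior K).Nonempty

/-- A hyperplane of `ℝ^d`. -/
def IsHyperplane (H : Set (Euc d)) : Prop :=
  ∃ u : Euc d, u ≠ 0 ∧ ∃ c : ℝ, H = {x : Euc d | (inner ℝ x u : ℝ) = c}

/-- A straight line in `ℝ^d`. -/
def IsLine (L : Set (Euc d)) : Prop :=
  ∃ p v : Euc d, v ≠ 0 ∧ L = {x : Euc d | ∃ t : ℝ, x = p + t • v}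

/-- A `d`-polytope: convex hull of finitely many points, with nonempty interior. -/
def IsPolytope (P : Set (Euc d)) : Prop :=
  ∃ S : Finset (Euc d), P = convexHull ℝ (S : Set (Euc d)) ∧ (interior P).Nonempty

/-- A `d`-simplex: convex hull of `d+1` affinely independent points. -/
def IsSimplex (d : ℕ) (T : Set (Euc d)) : Prop :=
  ∃ v : Fin (d + 1) → Euc d, AffineIndependent ℝ v ∧ T = convexHull ℝ (Set.range v)

/-- The exposed face of `P` in direction `u`. -/
def exposedFaceAt (P : Set (Euc d)) (u : Euc d) : Set (Euc d) :=
  {x ∈ P | ∀ y ∈ P, (inner ℝ y u : ℝ) ≤ (inner ℝ x u : ℝ)}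

/-- `u` is the outer unit normal vector of a facet of `P`. -/
def IsFacetNormal (P : Set (Euc d)) (u : Euc d) : Prop :=
  ‖u‖ = 1 ∧ Module.finrank ℝ (affineSpan ℝ (exposedFaceAt P u)).direction = d - 1

/-- The hyperplane `H` is parallel to some facet of `P`:
some translate of `H` contains the facet. -/
def HypParallelToFacet (P H : Set (Euc d)) : Prop :=
  ∃ u : Euc d, IsFacetNormal P u ∧ ∃ v : Euc d, exposedFaceAt P u ⊆ (fun x => v + x) '' H

/-- The positive homothet `x + τ • P`. -/
def homo (x : Euc d) (τ : ℝ) (P : Set (Euc d)) : Set (Euc d) := {x} + τ • P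

/-- A weakly non-separable family of positive homothets of the polytope `P`. -/
def WNS (P : Set (Euc d)) {n : ℕ} (x : Fin n → Euc d) (τ : Fin n → ℝ) : Prop :=
  ∀ H : Set (Euc d), IsHyperplane H → HypParallelToFacet P H →
    (H ∩ convexHull ℝ (⋃ i, homo (x i) (τ i) P)).Nonempty →
    ∃ i, (H ∩ homo (x i) (τ i) P).Nonempty

/-- A non-separable family of convex bodies. -/
def NS {n : ℕ} (F : Fin n → Set (Euc d)) : Prop :=
  ∀ H : Set (Euc d), IsHyperplane H →
    (H ∩ convexHull ℝ (⋃ i, F i)).Nonempty → ∃ i, (H ∩ F i).Nonempty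

/-- `A` is a `k`-dimensional affine subspace of `ℝ^d` (as a set). -/
def IsAffSub (k : ℕ) (A : Set (Euc d)) : Prop :=
  ∃ S : AffineSubspace ℝ (Euc d), (S : Set (Euc d)) = A ∧ A.Nonempty ∧
    Module.finrank ℝ S.direction = k

/-- The affine subspace `A` is parallel to some facet of `P`:
some translate of `A` is contained in the affine hull of the facet. -/
def SubParallelToFacet (P A : Set (Euc d)) : Prop :=
  ∃ u : Euc d, IsFacetNormal P u ∧ ∃ v : Euc d,
    (fun x => v + x) '' A ⊆ (affineSpan ℝ (exposedFaceAt P u) : Set (Euc d))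

/-- A weakly `k`-impassable family of positive homothets of the polytope `P`. -/
def WIP (k : ℕ) (P : Set (Euc d)) {n : ℕ} (x : Fin n → Euc d) (τ : Fin n → ℝ) : Prop :=
  ∀ A : Set (Euc d), IsAffSub k A → SubParallelToFacet P A →
    (A ∩ convexHull ℝ (⋃ i, homo (x i) (τ i) P)).Nonempty →
    ∃ i, (A ∩ homo (x i) (τ i) P).Nonempty

/-- A full-rank lattice in `ℝ^d`. -/
def IsFullLattice (L : Set (Euc d)) : Prop :=
  ∃ b : Module.Basis (Fin d) ℝ (Euc d),
    L = Set.range fun z : Fin d → ℤ => ∑ i, (z i : ℝ) • b i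

/-- The integer lattice `ℤ^d` as a subset of `ℝ^d`. -/
def intLattice (d : ℕ) : Set (Euc d) := {x : Euc d | ∀ i, ∃ z : ℤ, x i = (z : ℝ)}

/-- The unit cube `[0,1]^d`. -/
def unitCube (d : ℕ) : Set (Euc d) := {x : Euc d | ∀ i, x i ∈ Set.Icc (0 : ℝ) 1}

/-- The axis-parallel hyperplane `{x : x_j = c}`. -/
def axisHyp (d : ℕ) (j : Fin d) (c : ℝ) : Set (Euc d) := {x : Euc d | x j = c}

/-- A weakly non-separable family of translates of the unit cube. -/
def CubeWNS {d n : ℕ} (p : Fin n → Euc d) : Prop :=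
  ∀ (j : Fin d) (c : ℝ),
    (axisHyp d j c ∩ convexHull ℝ (⋃ k, {p k} + unitCube d)).Nonempty →
    ∃ k, (axisHyp d j c ∩ ({p k} + unitCube d)).Nonempty


section WickExp

variable {E : Type*} [NormedAddCommGroup E] [InnerProductSpace ℝ E]

/-- The normalized exponential `exp (⟪t, x⟫ - ‖t‖² / 2)`, the density of the Gaussian measure
shifted by `t`. -/
def wickExp (t x : E) : ℝ := Real.exp (inner ℝ t x - ‖t‖ ^ 2 / 2)

lemma wickExp_eq (t x : E) :
    wickExp t x = Real.exp (-(‖t‖ ^ 2 / 2)) * Real.exp (inner ℝ t x) := by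
  rw [wickExp, ← Real.exp_add]; ring_nf

lemma wickExp_pos (t x : E) : 0 < wickExp t x := Real.exp_pos _

@[fun_prop]
lemma continuous_wickExp (t : E) : Continuous (wickExp t) := by
  unfold wickExp; fun_prop

lemma wickExp_mul (t u x : E) :
    wickExp t x * wickExp u x = Real.exp (inner ℝ t u) * wickExp (t + u) x := by
  simp only [wickExp, ← Real.exp_add, inner_add_left, norm_add_sq_real]
  ring_nf

end WickExp

section GaussianBasics
open ProbabilityTheory Complex

variable {E : Type*} [NormedAddCommGroup E] [InnerProductSpace ℝ E] [FiniteDimensional ℝ E]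
  [MeasurableSpace E] [BorelSpace E]

lemma stdGaussian_map_inner (t : E) :
    (stdGaussian E).map (fun x => inner ℝ t x) = gaussianReal 0 (‖t‖₊ ^ 2) := by
  have h := IsGaussian.map_eq_gaussianReal (μ := stdGaussian E) (innerSL ℝ t)
  rw [integral_strongDual_stdGaussian, variance_dual_stdGaussian] at h
  have h2 : (‖(innerSL ℝ) t‖ ^ 2).toNNReal = ‖t‖₊ ^ 2 := by
    rw [innerSL_apply_norm, Real.toNNReal_pow (norm_nonneg _), norm_toNNReal]
  rw [h2] at h
  exact h

lemma integrable_exp_inner_stdGaussian (t : E) :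
    Integrable (fun x => Real.exp (inner ℝ t x)) (stdGaussian E) := by
  have h := integrable_exp_mul_gaussianReal (μ := 0) (v := ‖t‖₊ ^ 2) 1
  rw [← stdGaussian_map_inner, integrable_map_measure (by fun_prop) (by fun_prop)] at h
  simpa [Function.comp_def] using h

lemma integral_exp_inner_stdGaussian (t : E) :
    ∫ x, Real.exp (inner ℝ t x) ∂stdGaussian E = Real.exp (‖t‖ ^ 2 / 2) := by
  have h := congrFun (mgf_id_gaussianReal (μ := 0) (v := ‖t‖₊ ^ 2)) 1
  rw [← stdGaussian_map_inner, mgf, integral_map (by fun_prop) (by fun_prop)] at h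
  simpa using h

/-- Finite measures on a Euclidean space are determined by their (everywhere finite) moment
generating functions. -/
lemma Measure.ext_of_integral_exp_inner {μ ν : Measure E} [IsFiniteMeasure μ] [IsFiniteMeasure ν]
    (hμ : ∀ t : E, Integrable (fun x => Real.exp (inner ℝ t x)) μ)
    (h : ∀ t : E, ∫ x, Real.exp (inner ℝ t x) ∂μ = ∫ x, Real.exp (inner ℝ t x) ∂ν) :
    μ = ν := by
  refine Measure.ext_of_charFun (funext fun t => ?_)
  have h0 := h 0
  simp only [inner_zero_left, Real.exp_zero, integral_const, smul_eq_mul, mul_one] at h0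
  have hmgf : mgf (fun x => inner ℝ t x) μ = mgf (fun x => inner ℝ t x) ν := by
    ext s
    have := h (s • t)
    simpa [mgf, inner_smul_left] using this
  have hset : integrableExpSet (fun x => inner ℝ t x) μ = Set.univ := by
    ext s
    have := hμ (s • t)
    simpa [integrableExpSet, inner_smul_left] using this
  have hzero : μ = 0 ↔ ν = 0 := by
    rw [← Measure.measure_univ_eq_zero, ← Measure.measure_univ_eq_zero,
      ← measureReal_eq_zero_iff, ← measureReal_eq_zero_iff, h0]
  have := eqOn_complexMGF_of_mgf' hmgf hzero (x := I) (by simp [hset])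
  simp only [charFun_apply, complexMGF] at this ⊢
  simp only [real_inner_comm t]
  convert this using 3 <;> ring_nf

lemma integrable_wickExp (t : E) : Integrable (wickExp t) (stdGaussian E) := by
  have := (integrable_exp_inner_stdGaussian t).const_mul (Real.exp (-(‖t‖ ^ 2 / 2)))
  exact this.congr (ae_of_all _ fun x => (wickExp_eq t x).symm)

lemma integral_wickExp (t : E) : ∫ x, wickExp t x ∂stdGaussian E = 1 := by
  simp_rw [wickExp_eq]
  rw [integral_const_mul, integral_exp_inner_stdGaussian, ← Real.exp_add]
  simp

lemma integral_wickExp_mul_wickExp (t u : E) :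
    ∫ x, wickExp t x * wickExp u x ∂stdGaussian E = Real.exp (inner ℝ t u) := by
  simp_rw [wickExp_mul]
  rw [integral_const_mul, integral_wickExp, mul_one]

lemma memLp_wickExp (t : E) : MemLp (wickExp t) 2 (stdGaussian E) := by
  rw [memLp_two_iff_integrable_sq (by fun_prop)]
  simp_rw [pow_two, wickExp_mul]
  exact (integrable_wickExp _).const_mul _

lemma memLp_inner_stdGaussian (t : E) :
    MemLp (fun x => inner ℝ t x) 2 (stdGaussian E) :=
  IsGaussian.memLp_dual (stdGaussian E) (innerSL ℝ t) 2 (by simp)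

/-- The Cameron–Martin formula for the standard Gaussian measure. -/
lemma stdGaussian_map_add_right (v : E) :
    (stdGaussian E).map (fun x => x + v) =
      (stdGaussian E).withDensity (fun x => ENNReal.ofReal (wickExp v x)) := by
  have hfin : IsFiniteMeasure ((stdGaussian E).withDensity
      (fun x => ENNReal.ofReal (wickExp v x))) :=
    isFiniteMeasure_withDensity_ofReal (integrable_wickExp v).2
  have hprob : IsProbabilityMeasure ((stdGaussian E).map (fun x => x + v)) :=
    Measure.isProbabilityMeasure_map (by fun_prop)
  refine Measure.ext_of_integral_exp_inner (fun t => ?_) (fun t => ?_)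
  · rw [integrable_map_measure (by fun_prop) (by fun_prop)]
    simp only [Function.comp_def, inner_add_right, Real.exp_add]
    exact (integrable_exp_inner_stdGaussian t).mul_const _
  · rw [integral_map (by fun_prop) (by fun_prop),
      integral_withDensity_eq_integral_toReal_smul (by fun_prop) (by simp)]
    simp only [inner_add_right, Real.exp_add, ENNReal.toReal_ofReal (wickExp_pos _ _).le,
      smul_eq_mul]
    rw [integral_mul_const, integral_exp_inner_stdGaussian]
    have : ∀ x, wickExp v x * Real.exp (inner ℝ t x) =
        Real.exp (-(‖v‖ ^ 2 / 2)) * Real.exp (inner ℝ (v + t) x) := by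
      intro x
      rw [wickExp_eq, mul_assoc, ← Real.exp_add (inner ℝ v x), inner_add_left]
    simp_rw [this]
    rw [integral_const_mul, integral_exp_inner_stdGaussian, ← Real.exp_add, ← Real.exp_add,
      norm_add_sq_real, real_inner_comm]
    ring_nf

lemma integral_wickExp_mul (v : E) {f : E → ℝ} (hf : AEStronglyMeasurable f
      ((stdGaussian E).map (fun x => x + v))) :
    ∫ x, wickExp v x * f x ∂stdGaussian E = ∫ x, f (x + v) ∂stdGaussian E := by
  rw [← integral_map (φ := fun x => x + v) (by fun_prop) hf, stdGaussian_map_add_right,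
    integral_withDensity_eq_integral_toReal_smul (by fun_prop) (by simp)]
  simp only [ENNReal.toReal_ofReal (wickExp_pos _ _).le, smul_eq_mul]

lemma integral_wickExp_mul_inner (t u : E) :
    ∫ x, wickExp t x * inner ℝ u x ∂stdGaussian E = inner ℝ t u := by
  rw [integral_wickExp_mul t (by fun_prop)]
  simp only [inner_add_right]
  rw [integral_add ((memLp_inner_stdGaussian u).integrable (by norm_num)) (by simp)]
  have := integral_strongDual_stdGaussian (innerSL ℝ u : StrongDual ℝ E)
  simp only [innerSL_apply_apply] at this
  simp [this, real_inner_comm]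

lemma integral_inner_mul_inner (t u : E) :
    ∫ x, inner ℝ t x * inner ℝ u x ∂stdGaussian E = inner ℝ t u := by
  have h := covarianceBilin_apply (μ := stdGaussian E) IsGaussian.memLp_two_id t u
  rw [covarianceBilin_stdGaussian] at h
  simp only [id_eq, integral_id_stdGaussian, sub_zero] at h
  exact h.symm

lemma stdGaussian_map_neg : (stdGaussian E).map (fun x => -x) = stdGaussian E :=
  stdGaussian_map (LinearIsometryEquiv.neg ℝ)

lemma stdGaussian_prod_map_rotation {s c : ℝ} (h : s ^ 2 + c ^ 2 = 1) :
    ((stdGaussian E).prod (stdGaussian E)).map (fun z : E × E => s • z.1 + c • z.2) =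
      stdGaussian E := by
  refine Measure.ext_of_charFun (funext fun t => ?_)
  have h1 : charFun (((stdGaussian E).prod (stdGaussian E)).map
      (fun z : E × E => s • z.1 + c • z.2)) t =
      charFun (stdGaussian E) (s • t) * charFun (stdGaussian E) (c • t) := by
    simp only [charFun_apply]
    rw [integral_map (by fun_prop) (by fun_prop), ← integral_prod_mul]
    congr 1; ext z
    rw [← Complex.exp_add]
    simp only [inner_add_left, inner_smul_left, inner_smul_right]
    push_cast; simp; ring_nf
  rw [h1]
  simp only [charFun_stdGaussian, ← Complex.exp_add, norm_smul]
  congr 1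
  norm_cast
  rw [mul_pow, mul_pow, Real.norm_eq_abs, Real.norm_eq_abs, sq_abs, sq_abs]
  linear_combination (-‖t‖ ^ 2 / 2) * h

lemma integral_wickExp_rotation {s c : ℝ} (h : s ^ 2 + c ^ 2 = 1) (t x : E) :
    ∫ y, wickExp t (s • x + c • y) ∂stdGaussian E = wickExp (s • t) x := by
  have : ∀ y, wickExp t (s • x + c • y) =
      Real.exp (s * inner ℝ t x - ‖t‖ ^ 2 / 2) * Real.exp (inner ℝ (c • t) y) := by
    intro y
    rw [wickExp, ← Real.exp_add, inner_add_right, inner_smul_right, inner_smul_right,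
      inner_smul_left]
    simp; ring_nf
  simp_rw [this]
  rw [integral_const_mul, integral_exp_inner_stdGaussian, ← Real.exp_add, wickExp, norm_smul,
    norm_smul, inner_smul_left, mul_pow, mul_pow, Real.norm_eq_abs, Real.norm_eq_abs, sq_abs,
    sq_abs]
  congr 1
  simp only [conj_trivial]
  linear_combination (‖t‖ ^ 2 / 2) * h

/-- Translating a symmetric set by `v` decreases its Gaussian measure by a factor of at most
`exp (-‖v‖² / 2)`. -/
lemma exp_mul_stdGaussian_le_translate {A : Set E} (hA : MeasurableSet A)
    (hsymm : ∀ x, x ∈ A → -x ∈ A) (v : E) :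
    Real.exp (-(‖v‖ ^ 2 / 2)) * (stdGaussian E).real A ≤
      (stdGaussian E).real {x | x - v ∈ A} := by
  have hsymm' : ∀ x, -x ∈ A ↔ x ∈ A := fun x => ⟨fun h => by simpa using hsymm _ h, hsymm x⟩
  have key : ∀ w : E, (stdGaussian E).real {x | x + w ∈ A} =
      ∫ x, A.indicator (wickExp w) x ∂stdGaussian E := by
    intro w
    have := integral_wickExp_mul w (f := A.indicator 1)
      ((measurable_one.indicator hA).aestronglyMeasurable)
    have h2 : ∀ x, A.indicator (1 : E → ℝ) (x + w) = {x | x + w ∈ A}.indicator 1 x :=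
      fun x => rfl
    simp_rw [h2] at this
    rw [integral_indicator_one (by measurability)] at this
    rw [← this]
    congr 1; ext x
    by_cases hx : x ∈ A <;> simp [hx]
  have hneg : (stdGaussian E).real {x | x + v ∈ A} = (stdGaussian E).real {x | x + -v ∈ A} := by
    conv_lhs => rw [← stdGaussian_map_neg]
    rw [map_measureReal_apply (by fun_prop) (by measurability)]
    congr 1; ext x
    simp only [mem_preimage, mem_ofPred_eq]
    rw [← hsymm', neg_add, neg_neg]
  have hInt : ∀ w : E, Integrable (A.indicator (wickExp w)) (stdGaussian E) := fun w =>
    (integrable_wickExp w).indicator hA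
  have hsum : 2 * (Real.exp (-(‖v‖ ^ 2 / 2)) * (stdGaussian E).real A) ≤
      (stdGaussian E).real {x | x + v ∈ A} + (stdGaussian E).real {x | x + -v ∈ A} := by
    rw [key v, key (-v), ← integral_add (hInt _) (hInt _), ← integral_indicator_one hA,
      ← integral_const_mul, ← integral_const_mul]
    refine integral_mono ?_ ((hInt _).add (hInt _)) fun x => ?_
    · exact (((integrable_const (1 : ℝ)).indicator hA).const_mul _).const_mul _
    · by_cases hx : x ∈ A
      · simp only [hx, indicator_of_mem, Pi.one_apply, mul_one, wickExp_eq, norm_neg,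
          inner_neg_left]
        have := Real.cosh_eq (inner ℝ v x)
        have h1 := Real.one_le_cosh (inner ℝ v x)
        have h3 := Real.exp_pos (-(‖v‖ ^ 2 / 2))
        nlinarith
      · simp [hx]
  simp only [sub_eq_add_neg]
  linarith

end GaussianBasics

section Density
open ProbabilityTheory

variable {E : Type*} [NormedAddCommGroup E] [InnerProductSpace ℝ E] [FiniteDimensional ℝ E]
  [MeasurableSpace E] [BorelSpace E]

/-- A square-integrable function orthogonal to all exponentials vanishes. -/
lemma ae_eq_zero_of_integral_wickExp_mul_eq_zero {g : E → ℝ} (hg : MemLp g 2 (stdGaussian E))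
    (h : ∀ t, ∫ x, wickExp t x * g x ∂stdGaussian E = 0) : g =ᵐ[stdGaussian E] 0 := by
  have hgi : Integrable g (stdGaussian E) := hg.integrable (by norm_num)
  have hInt : ∀ t, Integrable (fun x => Real.exp (inner ℝ t x) * g x) (stdGaussian E) := by
    intro t
    have h1 := ((memLp_wickExp t).integrable_mul hg).const_mul (Real.exp (‖t‖ ^ 2 / 2))
    refine h1.congr (ae_of_all _ fun x => ?_)
    simp only [Pi.mul_apply, wickExp_eq, ← mul_assoc, ← Real.exp_add]
    simp
  have hInt' : ∀ t, ∫ x, Real.exp (inner ℝ t x) * g x ∂stdGaussian E = 0 := by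
    intro t
    have h1 := congrArg (fun r => Real.exp (‖t‖ ^ 2 / 2) * r) (h t)
    simp only [← integral_const_mul, mul_zero, wickExp_eq, ← mul_assoc, ← Real.exp_add] at h1
    simpa using h1
  have hf1 : IsFiniteMeasure ((stdGaussian E).withDensity (fun x => ENNReal.ofReal (g x))) :=
    isFiniteMeasure_withDensity_ofReal hgi.2
  have hf2 : IsFiniteMeasure ((stdGaussian E).withDensity (fun x => ENNReal.ofReal (-g x))) :=
    isFiniteMeasure_withDensity_ofReal hgi.neg.2
  have hm1 : AEMeasurable (fun x => ENNReal.ofReal (g x)) (stdGaussian E) :=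
    hg.1.aemeasurable.ennreal_ofReal
  have hm2 : AEMeasurable (fun x => ENNReal.ofReal (-g x)) (stdGaussian E) :=
    hg.1.aemeasurable.neg.ennreal_ofReal
  have hmax : ∀ t, Integrable (fun x => Real.exp (inner ℝ t x) * max (g x) 0)
      (stdGaussian E) := by
    intro t
    refine (hInt t).pos_part.congr (ae_of_all _ fun x => ?_)
    simp only [mul_max_of_nonneg _ _ (Real.exp_pos _).le, mul_zero]
  have hmax' : ∀ t, Integrable (fun x => Real.exp (inner ℝ t x) * max (-g x) 0)
      (stdGaussian E) := by
    intro t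
    refine (hInt t).neg_part.congr (ae_of_all _ fun x => ?_)
    simp only [mul_max_of_nonneg _ _ (Real.exp_pos _).le, mul_zero, mul_neg]
  have heq : (stdGaussian E).withDensity (fun x => ENNReal.ofReal (g x)) =
      (stdGaussian E).withDensity (fun x => ENNReal.ofReal (-g x)) := by
    refine Measure.ext_of_integral_exp_inner (fun t => ?_) (fun t => ?_)
    · rw [integrable_withDensity_iff_integrable_smul₀' hm1 (by simp)]
      refine (hmax t).congr (ae_of_all _ fun x => ?_)
      simp only [ENNReal.toReal_ofReal', smul_eq_mul, mul_comm]
    · rw [integral_withDensity_eq_integral_toReal_smul₀ hm1 (by simp),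
        integral_withDensity_eq_integral_toReal_smul₀ hm2 (by simp)]
      rw [← sub_eq_zero, ← integral_sub]
      · rw [← hInt' t]
        congr 1; ext x
        simp only [ENNReal.toReal_ofReal', smul_eq_mul]
        rcases le_total (g x) 0 with h0 | h0
        · simp [h0]; ring
        · simp [h0]; ring
      · refine (hmax t).congr (ae_of_all _ fun x => ?_)
        simp only [ENNReal.toReal_ofReal', smul_eq_mul, mul_comm]
      · refine (hmax' t).congr (ae_of_all _ fun x => ?_)
        simp only [ENNReal.toReal_ofReal', smul_eq_mul, mul_comm]
  have hfin : ∫⁻ x, ENNReal.ofReal (g x) ∂stdGaussian E ≠ ⊤ := by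
    rw [← setLIntegral_univ, ← withDensity_apply _ .univ]
    exact measure_ne_top _ _
  rw [withDensity_eq_iff hm1 hm2 hfin] at heq
  filter_upwards [heq] with x hx
  have := congrArg ENNReal.toReal hx
  rw [ENNReal.toReal_ofReal', ENNReal.toReal_ofReal'] at this
  rcases le_total (g x) 0 with h0 | h0
  · simp [h0] at this; simp; linarith
  · simp [h0] at this; simp; linarith

lemma exists_wickExp_approx {f : E → ℝ} (hf : MemLp f 2 (stdGaussian E)) {ε : ℝ} (hε : 0 < ε) :
    ∃ (s : Finset E) (c : E → ℝ), (∀ t ∉ s, c t = 0) ∧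
      ∫ x, (f x - ∑ t ∈ s, c t * wickExp t x) ^ 2 ∂stdGaussian E ≤ ε := by
  set V : Submodule ℝ (Lp ℝ 2 (stdGaussian E)) :=
    Submodule.span ℝ (Set.range fun t : E => (memLp_wickExp t).toLp (wickExp t)) with hV
  have hdense : V.topologicalClosure = ⊤ := by
    rw [Submodule.topologicalClosure_eq_top_iff, Submodule.eq_bot_iff]
    intro g hgV
    rw [Submodule.mem_orthogonal] at hgV
    have h0 := ae_eq_zero_of_integral_wickExp_mul_eq_zero (Lp.memLp g) (fun t => ?_)
    · exact Lp.eq_zero_iff_ae_eq_zero.2 h0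
    · have h1 := hgV _ (Submodule.subset_span (Set.mem_range_self t))
      rw [L2.inner_def] at h1
      rw [← h1]
      refine integral_congr_ae ?_
      filter_upwards [(memLp_wickExp t).coeFn_toLp] with x hx
      rw [hx]; simp [mul_comm]
  have hmem : hf.toLp f ∈ closure (V : Set (Lp ℝ 2 (stdGaussian E))) := by
    rw [← Submodule.topologicalClosure_coe, hdense]; trivial
  obtain ⟨v, hvV, hv⟩ := Metric.mem_closure_iff.1 hmem (Real.sqrt ε) (Real.sqrt_pos.2 hε)
  obtain ⟨c, hc⟩ := (Finsupp.mem_span_range_iff_exists_finsupp).1 hvV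
  refine ⟨c.support, c, fun t ht => by simpa using ht, ?_⟩
  have hvae : v =ᵐ[stdGaussian E] fun x => ∑ t ∈ c.support, c t * wickExp t x := by
    rw [← hc, Finsupp.sum]
    have h1 := Lp.coeFn_finsetSum c.support
      (fun t => c t • (memLp_wickExp t).toLp (wickExp t))
    have h2 : ∀ᵐ x ∂stdGaussian E, ∀ t ∈ c.support,
        (c t • (memLp_wickExp t).toLp (wickExp t) : Lp ℝ 2 (stdGaussian E)) x =
          c t * wickExp t x := by
      rw [Filter.eventually_all_finset]
      intro t _
      filter_upwards [Lp.coeFn_smul (c t) ((memLp_wickExp t).toLp (wickExp t)),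
        (memLp_wickExp t).coeFn_toLp] with x hx hx2
      rw [hx, Pi.smul_apply, hx2, smul_eq_mul]
    filter_upwards [h1, h2] with x hx hx2
    rw [hx, Finset.sum_apply]
    exact Finset.sum_congr rfl fun t ht => hx2 t ht
  rw [dist_eq_norm] at hv
  have hsq : ‖hf.toLp f - v‖ ^ 2 ≤ ε := by
    have := (Real.lt_sqrt (norm_nonneg _)).1 hv
    exact this.le
  refine le_trans (le_of_eq ?_) hsq
  rw [← real_inner_self_eq_norm_sq, L2.inner_def]
  refine integral_congr_ae ?_
  filter_upwards [hvae, hf.coeFn_toLp, Lp.coeFn_sub (hf.toLp f) v] with x h1 h2 h3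
  rw [h3, Pi.sub_apply, h1, h2]
  simp [pow_two]

end Density

section DerivativeQuadrature

open Finset in
lemma card_shift_pairs (m : ℕ) (k : ℤ) (hk : |k| ≤ m) :
    (∑ a ∈ range m, ∑ b ∈ range m, if k + m + a - b = 0 then (1 : ℂ) else 0)
      = ((-k).toNat : ℂ) := by
  have inner : ∀ a ∈ range m, (∑ b ∈ range m, if k + m + a - b = 0 then (1 : ℂ) else 0) =
      if a < (-k).toNat then 1 else 0 := by
    intro a _
    rw [abs_le] at hk
    have : ∀ b : ℕ, (k + m + a - b = 0) ↔ b = (k + m + a).toNat := by intro b; omega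
    simp_rw [this]
    rw [sum_ite_eq']
    congr 1
    rw [Finset.mem_range, eq_iff_iff]
    omega
  rw [sum_congr rfl inner, ← sum_filter, sum_const, nsmul_eq_mul, mul_one]
  congr 1
  rw [abs_le] at hk
  have : (range m).filter (fun a => a < (-k).toNat) = range (-k).toNat := by
    ext a; simp only [mem_filter, Finset.mem_range]; omega
  rw [this, card_range]

lemma sum_pow_root_zpow {M : ℕ} {ζ : ℂ} (hζ : IsPrimitiveRoot ζ M) (k : ℤ) :
    ∑ j ∈ Finset.range M, (ζ ^ j) ^ k = if (M : ℤ) ∣ k then (M : ℂ) else 0 := by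
  have h1 : ∀ j : ℕ, (ζ ^ j) ^ k = (ζ ^ k) ^ j := by
    intro j
    rw [← zpow_natCast ζ j, ← zpow_mul, mul_comm, zpow_mul, zpow_natCast]
  simp_rw [h1]
  split_ifs with h
  · rw [(hζ.zpow_eq_one_iff_dvd k).2 h]; simp
  · have hne : ζ ^ k ≠ 1 := fun h' => h ((hζ.zpow_eq_one_iff_dvd k).1 h')
    rw [geom_sum_eq hne, ← h1, hζ.pow_eq_one]; simp

/-- Convolution with the Fejér kernel modulated by a sine differentiates trigonometric
polynomials at the origin. -/
lemma sum_fejer_zpow {m : ℕ} (hm : 1 ≤ m) {ζ : ℂ} (hζ : IsPrimitiveRoot ζ (4 * m)) (k : ℤ)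
    (hk : |k| ≤ m) :
    ∑ j ∈ Finset.range (4 * m), (ζ ^ j) ^ k * (((ζ ^ j) ^ (m : ℤ) - (ζ ^ j) ^ (-m : ℤ)) *
      ∑ a ∈ Finset.range m, ∑ b ∈ Finset.range m, (ζ ^ j) ^ ((a : ℤ) - b)) = -(4 * m * k) := by
  have hζ0 : ζ ≠ 0 := hζ.ne_zero (by omega)
  have expand : ∀ j : ℕ, (ζ ^ j) ^ k * (((ζ ^ j) ^ (m : ℤ) - (ζ ^ j) ^ (-m : ℤ)) *
      ∑ a ∈ Finset.range m, ∑ b ∈ Finset.range m, (ζ ^ j) ^ ((a : ℤ) - b)) =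
      ∑ a ∈ Finset.range m, ∑ b ∈ Finset.range m,
        ((ζ ^ j) ^ (k + m + a - b) - (ζ ^ j) ^ (k - m + a - b)) := by
    intro j
    have hz : ζ ^ j ≠ 0 := pow_ne_zero _ hζ0
    rw [← mul_assoc, Finset.mul_sum]
    refine Finset.sum_congr rfl fun a _ => ?_
    rw [Finset.mul_sum]
    refine Finset.sum_congr rfl fun b _ => ?_
    rw [mul_sub, sub_mul, ← zpow_add₀ hz, ← zpow_add₀ hz, ← zpow_add₀ hz, ← zpow_add₀ hz]
    ring_nf
  simp_rw [expand]
  rw [Finset.sum_comm]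
  have h2 : ∀ a ∈ Finset.range m, ∑ j ∈ Finset.range (4 * m), ∑ b ∈ Finset.range m,
      ((ζ ^ j) ^ (k + m + a - b) - (ζ ^ j) ^ (k - m + a - b)) =
      ∑ b ∈ Finset.range m, (4 * m : ℂ) * ((if k + m + a - b = 0 then 1 else 0) -
        (if -k + m + b - a = 0 then 1 else 0)) := by
    intro a ha
    rw [Finset.sum_comm]
    refine Finset.sum_congr rfl fun b hb => ?_
    rw [Finset.sum_sub_distrib, sum_pow_root_zpow hζ, sum_pow_root_zpow hζ]
    rw [Finset.mem_range] at ha hb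
    rw [abs_le] at hk
    have e1 : ((4 * m : ℕ) : ℤ) ∣ k + m + a - b ↔ k + m + a - b = 0 := by
      constructor
      · rintro ⟨q, hq⟩
        push_cast at hq
        have : q = 0 := by
          by_contra hq0
          rcases lt_or_gt_of_ne hq0 with h | h
          · nlinarith
          · nlinarith
        rw [hq, this]; simp
      · intro h; rw [h]; exact dvd_zero _
    have e2 : ((4 * m : ℕ) : ℤ) ∣ k - m + a - b ↔ -k + m + b - a = 0 := by
      constructor
      · rintro ⟨q, hq⟩
        push_cast at hq
        have : q = 0 := by
          by_contra hq0
          rcases lt_or_gt_of_ne hq0 with h | h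
          · nlinarith
          · nlinarith
        rw [this] at hq; linarith
      · intro h
        have : k - m + a - b = 0 := by linarith
        rw [this]; exact dvd_zero _
    simp only [e1, e2]
    push_cast
    split_ifs <;> simp
  rw [Finset.sum_congr rfl h2]
  simp_rw [← Finset.mul_sum, Finset.sum_sub_distrib]
  have h3 := card_shift_pairs m k hk
  have h4 := card_shift_pairs m (-k) (by rwa [abs_neg])
  rw [Finset.sum_comm] at h4
  rw [h3, h4]
  have : ((-k).toNat : ℂ) - ((- -k).toNat : ℂ) = -k := by
    have : (((-k).toNat : ℤ) - ((- -k).toNat : ℤ)) = -k := by omega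
    exact_mod_cast this
  rw [this]; ring

lemma sum_choose_alternating (n : ℕ) :
    ∑ l ∈ Finset.range (n + 1), (n.choose l : ℝ) * (-1) ^ (n - l) * (2 * l - n) =
      if n = 1 then 2 else 0 := by
  have hfun : (fun t : ℝ => (Real.exp t - Real.exp (-t)) ^ n) = fun t =>
      ∑ l ∈ Finset.range (n + 1), (n.choose l : ℝ) * (-1) ^ (n - l) *
        Real.exp ((2 * l - n) * t) := by
    ext t
    rw [sub_eq_add_neg, add_pow]
    refine Finset.sum_congr rfl fun l hl => ?_
    have hl' : l ≤ n := by simpa [Nat.lt_succ_iff] using hl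
    rw [neg_pow (Real.exp (-t)), ← Real.exp_nat_mul, ← Real.exp_nat_mul]
    have : Real.exp ((2 * l - n) * t) =
        Real.exp (l * t) * Real.exp ((n - l : ℕ) * -t) := by
      rw [← Real.exp_add]; congr 1; push_cast [hl']; ring
    rw [this]; ring
  have hd1 : HasDerivAt (fun t : ℝ => (Real.exp t - Real.exp (-t)) ^ n)
      (n * (Real.exp 0 - Real.exp (-0)) ^ (n - 1) * (Real.exp 0 - Real.exp (-0) * -1)) 0 := by
    have h := ((Real.hasDerivAt_exp 0).sub ((hasDerivAt_neg (0 : ℝ)).exp)).pow n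
    exact h
  have hd2 : HasDerivAt (fun t : ℝ => ∑ l ∈ Finset.range (n + 1),
      (n.choose l : ℝ) * (-1) ^ (n - l) * Real.exp ((2 * l - n) * t))
      (∑ l ∈ Finset.range (n + 1), (n.choose l : ℝ) * (-1) ^ (n - l) *
        (Real.exp ((2 * l - n) * 0) * ((2 * l - n) * 1))) 0 := by
    refine HasDerivAt.fun_sum fun l _ => ?_
    exact (((hasDerivAt_id (0 : ℝ)).const_mul ((2 * l - n : ℝ))).exp).const_mul _
  rw [hfun] at hd1
  have := hd2.unique hd1
  simp only [mul_zero, Real.exp_zero, one_mul, mul_one, neg_zero, sub_self] at this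
  rw [this]
  rcases n with _ | _ | n
  · simp
  · norm_num
  · simp

/-- A signed discrete measure on `[-1/2, 1/2]` of total mass `O(m)` which integrates every
polynomial of degree at most `m` to its derivative at the origin. -/
lemma exists_derivative_quadrature (m : ℕ) (hm : 1 ≤ m) :
    ∃ (M : ℕ) (s w : Fin M → ℝ), (∀ i, |s i| ≤ 1 / 2) ∧ ∑ i, |w i| ≤ 4 * m ∧
      ∀ n ≤ m, ∑ i, w i * s i ^ n = if n = 1 then 1 else 0 := by
  have hM : 4 * m ≠ 0 := by omega
  have hmR : (0 : ℝ) < m := by exact_mod_cast hm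
  set θ : ℕ → ℝ := fun j => 2 * Real.pi * j / (4 * m) with hθ
  set ζ : ℂ := Complex.exp (2 * Real.pi * Complex.I / (4 * m : ℕ)) with hζdef
  have hζ : IsPrimitiveRoot ζ (4 * m) := Complex.isPrimitiveRoot_exp _ hM
  have hζ0 : ζ ≠ 0 := Complex.exp_ne_zero _
  have hz : ∀ j, ζ ^ j = Complex.exp (θ j * Complex.I) := by
    intro j
    rw [hζdef, ← Complex.exp_nat_mul]; congr 1; simp only [hθ]; push_cast; ring
  set D : ℕ → ℂ := fun j => ∑ a ∈ Finset.range m, (ζ ^ j) ^ a with hD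
  have hconj : ∀ j, (starRingEnd ℂ) (ζ ^ j) = (ζ ^ j)⁻¹ := by
    intro j
    rw [hz, ← Complex.exp_conj, ← Complex.exp_neg]; congr 1; simp
  have hDsq : ∀ j, ((Complex.normSq (D j) : ℝ) : ℂ) =
      ∑ a ∈ Finset.range m, ∑ b ∈ Finset.range m, (ζ ^ j) ^ ((a : ℤ) - b) := by
    intro j
    have hne : ζ ^ j ≠ 0 := pow_ne_zero _ hζ0
    rw [← Complex.mul_conj, hD]
    simp only [map_sum, map_pow, hconj]
    rw [Finset.sum_mul_sum]
    refine Finset.sum_congr rfl fun a _ => Finset.sum_congr rfl fun b _ => ?_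
    rw [zpow_sub₀ hne, zpow_natCast, zpow_natCast, inv_pow, div_eq_mul_inv]
  have hsum : ∑ j ∈ Finset.range (4 * m), Complex.normSq (D j) = 4 * m * m := by
    have : ((∑ j ∈ Finset.range (4 * m), Complex.normSq (D j) : ℝ) : ℂ) = 4 * m * m := by
      push_cast
      simp_rw [hDsq]
      rw [Finset.sum_comm]
      have : ∀ a ∈ Finset.range m, ∑ j ∈ Finset.range (4 * m), ∑ b ∈ Finset.range m,
          (ζ ^ j) ^ ((a : ℤ) - b) = 4 * m := by
        intro a ha
        rw [Finset.sum_comm]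
        simp_rw [sum_pow_root_zpow hζ]
        rw [Finset.sum_eq_single a]
        · simp
        · intro b hb hba
          rw [Finset.mem_range] at ha hb
          rw [if_neg]
          intro hdvd
          have := Int.eq_zero_of_abs_lt_dvd hdvd (by rw [abs_lt]; push_cast; omega)
          omega
        · intro h; exact absurd ha h
      rw [Finset.sum_congr rfl this]
      simp; ring
    exact_mod_cast this
  have hsin : ∀ j, (ζ ^ j) ^ (m : ℤ) - (ζ ^ j) ^ (-m : ℤ) =
      2 * Complex.I * (Real.sin (m * θ j) : ℝ) := by
    intro j
    rw [hz, ← Complex.exp_int_mul, ← Complex.exp_int_mul, Complex.ofReal_sin, Complex.sin]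
    push_cast
    rw [show -(m : ℂ) * ((θ j : ℂ) * Complex.I) = -((m : ℂ) * θ j) * Complex.I by ring,
      show (m : ℂ) * ((θ j : ℂ) * Complex.I) = ((m : ℂ) * θ j) * Complex.I by ring]
    ring_nf
    rw [Complex.I_sq]; ring
  refine ⟨4 * m, fun i => Real.sin (θ i) / 2,
    fun i => Real.sin (m * θ i) * Complex.normSq (D i) / m, fun i => ?_, ?_, fun n hn => ?_⟩
  · rw [abs_div, abs_two]
    have := Real.abs_sin_le_one (θ i)
    linarith
  · rw [Fin.sum_univ_eq_sum_range
      (fun i => |Real.sin (m * θ i) * Complex.normSq (D i) / m|) (4 * m)]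
    calc ∑ i ∈ Finset.range (4 * m), |Real.sin (m * θ i) * Complex.normSq (D i) / m|
        ≤ ∑ i ∈ Finset.range (4 * m), Complex.normSq (D i) / m := by
          refine Finset.sum_le_sum fun i _ => ?_
          rw [abs_div, abs_mul, abs_of_nonneg (Complex.normSq_nonneg _), abs_of_pos hmR]
          gcongr
          have := Real.abs_sin_le_one (m * θ i)
          have h2 := Complex.normSq_nonneg (D i)
          nlinarith
      _ = 4 * m := by
          rw [← Finset.sum_div, hsum]; field_simp
  · rw [Fin.sum_univ_eq_sum_range
      (fun i => Real.sin (m * θ i) * Complex.normSq (D i) / m * (Real.sin (θ i) / 2) ^ n) (4 * m)]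
    have hmC : (m : ℂ) ≠ 0 := by exact_mod_cast hmR.ne'
    have hsinpow : ∀ j, ((Real.sin (θ j) : ℝ) : ℂ) ^ n * (2 * Complex.I) ^ n =
        ∑ l ∈ Finset.range (n + 1), (n.choose l : ℂ) * (-1) ^ (n - l) *
          (ζ ^ j) ^ (2 * (l : ℤ) - n) := by
      intro j
      have hne : ζ ^ j ≠ 0 := pow_ne_zero _ hζ0
      have h1 : ((Real.sin (θ j) : ℝ) : ℂ) * (2 * Complex.I) = ζ ^ j + -(ζ ^ j)⁻¹ := by
        rw [hz, ← Complex.exp_neg, Complex.ofReal_sin, Complex.sin]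
        ring_nf
        rw [Complex.I_sq]; ring_nf
      rw [← mul_pow, h1, add_pow]
      refine Finset.sum_congr rfl fun l hl => ?_
      have hl' : l ≤ n := by simpa [Nat.lt_succ_iff] using hl
      rw [neg_pow, show 2 * (l : ℤ) - n = l + -((n - l : ℕ) : ℤ) by push_cast [hl']; ring,
        zpow_add₀ hne, zpow_neg, zpow_natCast, zpow_natCast, inv_pow]
      ring
    have key : ((∑ i ∈ Finset.range (4 * m), Real.sin (m * θ i) * Complex.normSq (D i) / m *
        (Real.sin (θ i) / 2) ^ n : ℝ) : ℂ) * (2 * Complex.I * m * (2 : ℂ) ^ n *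
          (2 * Complex.I) ^ n) = -(4 * m * (if n = 1 then 2 else 0)) := by
      have hc := congrArg (fun r : ℝ => (r : ℂ)) (sum_choose_alternating n)
      have : ∑ l ∈ Finset.range (n + 1), (n.choose l : ℂ) * (-1) ^ (n - l) *
          (-(4 * m * ((2 * (l : ℤ) - n : ℤ) : ℂ))) = -(4 * m * (if n = 1 then 2 else 0)) := by
        push_cast at hc
        have h5 : (if n = 1 then (2 : ℂ) else 0) = ((if n = 1 then (2 : ℝ) else 0 : ℝ) : ℂ) := by
          split_ifs <;> simp
        rw [h5, ← hc, Finset.mul_sum, ← Finset.sum_neg_distrib]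
        refine Finset.sum_congr rfl fun l _ => ?_
        push_cast; ring
      rw [← this]
      have h6 : ∀ l ∈ Finset.range (n + 1), (n.choose l : ℂ) * (-1) ^ (n - l) *
          (-(4 * m * ((2 * (l : ℤ) - n : ℤ) : ℂ))) =
          ∑ j ∈ Finset.range (4 * m), (n.choose l : ℂ) * (-1) ^ (n - l) *
            ((ζ ^ j) ^ (2 * (l : ℤ) - n) * (((ζ ^ j) ^ (m : ℤ) - (ζ ^ j) ^ (-m : ℤ)) *
            ∑ a ∈ Finset.range m, ∑ b ∈ Finset.range m, (ζ ^ j) ^ ((a : ℤ) - b))) := by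
        intro l hl
        have hl' : l ≤ n := by simpa [Nat.lt_succ_iff] using hl
        rw [← Finset.mul_sum, sum_fejer_zpow hm hζ]
        rw [abs_le]; omega
      rw [Finset.sum_congr rfl h6, Finset.sum_comm]
      push_cast
      rw [Finset.sum_mul]
      refine Finset.sum_congr rfl fun j _ => ?_
      have h7 : ∑ l ∈ Finset.range (n + 1), (n.choose l : ℂ) * (-1) ^ (n - l) *
          ((ζ ^ j) ^ (2 * (l : ℤ) - n) * (((ζ ^ j) ^ (m : ℤ) - (ζ ^ j) ^ (-m : ℤ)) *
            ∑ a ∈ Finset.range m, ∑ b ∈ Finset.range m, (ζ ^ j) ^ ((a : ℤ) - b))) =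
          (((Real.sin (θ j) : ℝ) : ℂ) ^ n * (2 * Complex.I) ^ n) *
            ((2 * Complex.I * (Real.sin (m * θ j) : ℝ)) * ((Complex.normSq (D j) : ℝ) : ℂ)) := by
        rw [hsinpow, hsin, hDsq, Finset.sum_mul]
        refine Finset.sum_congr rfl fun l _ => ?_
        ring
      rw [h7]
      push_cast
      rw [div_pow]
      field_simp
    have hI : Complex.I ≠ 0 := Complex.I_ne_zero
    rcases eq_or_ne n 1 with h1 | h1
    · subst h1
      simp only [if_true] at key ⊢
      have : ((∑ i ∈ Finset.range (4 * m), Real.sin (m * θ i) * Complex.normSq (D i) / m *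
        (Real.sin (θ i) / 2) ^ 1 : ℝ) : ℂ) = 1 := by
        have h8 : (2 * Complex.I * m * (2 : ℂ) ^ 1 * (2 * Complex.I) ^ 1) = -(4 * m * 2) := by
          ring_nf; rw [Complex.I_sq]; ring
        rw [h8] at key
        have h9 : -(4 * (m : ℂ) * 2) ≠ 0 := by simp [hmC]
        exact mul_right_cancel₀ h9 (by rw [key, one_mul])
      exact_mod_cast this
    · simp only [if_neg h1, mul_zero, neg_zero] at key ⊢
      have h9 : (2 * Complex.I * m * (2 : ℂ) ^ n * (2 * Complex.I) ^ n) ≠ 0 := by simp [hmC]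
      have := (mul_eq_zero.1 key).resolve_right h9
      exact_mod_cast this

end DerivativeQuadrature

section KernelBound
open ProbabilityTheory

lemma integral_sq_sum_mul {α ι : Type*} [MeasurableSpace α] {μ : Measure α} (S : Finset ι)
    (c : ι → ℝ) {f : ι → α → ℝ} (hf : ∀ t, MemLp (f t) 2 μ) :
    ∫ x, (∑ t ∈ S, c t * f t x) ^ 2 ∂μ =
      ∑ t ∈ S, ∑ u ∈ S, c t * c u * ∫ x, f t x * f u x ∂μ := by
  have h : ∀ t u, Integrable (fun x => c t * c u * (f t x * f u x)) μ :=
    fun t u => ((hf t).integrable_mul (hf u)).const_mul _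
  have h1 : ∀ x, (∑ t ∈ S, c t * f t x) ^ 2 =
      ∑ t ∈ S, ∑ u ∈ S, c t * c u * (f t x * f u x) := by
    intro x
    rw [pow_two, Finset.sum_mul_sum]
    refine Finset.sum_congr rfl fun t _ => Finset.sum_congr rfl fun u _ => by ring
  simp_rw [h1]
  rw [integral_finsetSum _ fun t _ => integrable_finsetSum _ fun u _ => h t u]
  refine Finset.sum_congr rfl fun t _ => ?_
  rw [integral_finsetSum _ fun u _ => h t u]
  simp_rw [integral_const_mul]

variable {E : Type*} [NormedAddCommGroup E] [InnerProductSpace ℝ E]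

/-- Powers of a Gram kernel are positive semidefinite. -/
lemma sum_mul_inner_pow_nonneg (S : Finset E) [FiniteDimensional ℝ E] (n : ℕ) (c : E → ℝ) :
    0 ≤ ∑ t ∈ S, ∑ u ∈ S, c t * c u * (inner ℝ t u) ^ n := by
  induction n generalizing c with
  | zero =>
    simp only [pow_zero, mul_one, ← Finset.sum_mul_sum]
    exact mul_self_nonneg _
  | succ n ih =>
    let b := stdOrthonormalBasis ℝ E
    have h : ∑ t ∈ S, ∑ u ∈ S, c t * c u * (inner ℝ t u) ^ (n + 1) =
        ∑ i, ∑ t ∈ S, ∑ u ∈ S,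
          (c t * inner ℝ t (b i)) * (c u * inner ℝ u (b i)) * (inner ℝ t u) ^ n := by
      symm
      rw [Finset.sum_comm]
      refine Finset.sum_congr rfl fun t _ => ?_
      rw [Finset.sum_comm]
      refine Finset.sum_congr rfl fun u _ => ?_
      rw [pow_succ, ← b.sum_inner_mul_inner t u, Finset.mul_sum, Finset.mul_sum]
      refine Finset.sum_congr rfl fun i _ => ?_
      rw [real_inner_comm u]
      ring
    rw [h]
    exact Finset.sum_nonneg fun i _ => ih _


lemma hasSum_quadrature_kernel {M : ℕ} (s w : Fin M → ℝ) (r : ℝ) :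
    HasSum (fun n : ℕ => (∑ i, w i * s i ^ n) ^ 2 * (r ^ n / n.factorial))
      (∑ i, ∑ j, w i * w j * Real.exp (s i * s j * r)) := by
  have h : ∀ i j, HasSum (fun n : ℕ => w i * w j * ((s i * s j * r) ^ n / n.factorial))
      (w i * w j * Real.exp (s i * s j * r)) := fun i j => by
    have := NormedSpace.expSeries_div_hasSum_exp (𝔸 := ℝ) (s i * s j * r)
    rw [← Real.exp_eq_exp_ℝ] at this
    exact this.mul_left _
  have h2 := hasSum_sum (s := Finset.univ) fun i _ =>
    hasSum_sum (s := Finset.univ) fun j _ => h i j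
  convert! h2 using 2 with n
  rw [pow_two, Finset.sum_mul_sum, Finset.sum_mul]
  refine Finset.sum_congr rfl fun i _ => ?_
  rw [Finset.sum_mul]
  refine Finset.sum_congr rfl fun j _ => ?_
  rw [mul_pow, mul_pow]
  ring

/-- If the moments of a quadrature rule agree with those of differentiation at `0` up to `δ`, the
associated kernel is dominated by `δ²` times the exponential kernel. -/
lemma sum_quadrature_kernel_le {M : ℕ} {s w : Fin M → ℝ} {δ : ℝ}
    (h1 : ∑ i, w i * s i = 1) (hδ : ∀ n, n ≠ 1 → |∑ i, w i * s i ^ n| ≤ δ)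
    [FiniteDimensional ℝ E] (S : Finset E) (c : E → ℝ) :
    ∑ t ∈ S, ∑ u ∈ S, c t * c u *
        (∑ i, ∑ j, w i * w j * Real.exp (s i * s j * inner ℝ t u) - inner ℝ t u) ≤
      δ ^ 2 * ∑ t ∈ S, ∑ u ∈ S, c t * c u * Real.exp (inner ℝ t u) := by
  rw [← sub_nonneg, Finset.mul_sum, ← Finset.sum_sub_distrib]
  simp_rw [Finset.mul_sum, ← Finset.sum_sub_distrib]
  set a : ℕ → ℝ := fun n => δ ^ 2 - if n = 1 then 0 else (∑ i, w i * s i ^ n) ^ 2 with ha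
  have ha0 : ∀ n, 0 ≤ a n := by
    intro n
    simp only [ha]
    split_ifs with hn
    · simpa using sq_nonneg δ
    · have := hδ n hn
      rw [sub_nonneg]
      exact sq_le_sq.2 (this.trans (le_abs_self δ))
  have key : ∀ r : ℝ, HasSum (fun n : ℕ => a n * (r ^ n / n.factorial))
      (δ ^ 2 * Real.exp r - (∑ i, ∑ j, w i * w j * Real.exp (s i * s j * r) - r)) := by
    intro r
    have e1 := NormedSpace.expSeries_div_hasSum_exp (𝔸 := ℝ) r
    rw [← Real.exp_eq_exp_ℝ] at e1
    have e2 := hasSum_quadrature_kernel s w r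
    have e3 : HasSum (fun n : ℕ => if n = 1 then r else 0) r := hasSum_ite_eq 1 r
    convert! (e1.mul_left (δ ^ 2)).sub (e2.sub e3) using 2 with n
    simp only [ha]
    split_ifs with hn
    · simp [hn, h1]
    · ring
  have key2 := hasSum_sum (s := S) fun t _ => hasSum_sum (s := S) fun u _ =>
    (key (inner ℝ t u)).mul_left (c t * c u)
  have hnn := key2.nonneg fun n => by
    have := mul_nonneg (div_nonneg (ha0 n) (Nat.cast_nonneg n.factorial))
      (sum_mul_inner_pow_nonneg S n c)
    convert this using 1
    rw [Finset.mul_sum]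
    refine Finset.sum_congr rfl fun t _ => ?_
    rw [Finset.mul_sum]
    refine Finset.sum_congr rfl fun u _ => ?_
    ring
  refine hnn.trans (le_of_eq ?_)
  refine Finset.sum_congr rfl fun t _ => Finset.sum_congr rfl fun u _ => ?_
  ring

variable [FiniteDimensional ℝ E] [MeasurableSpace E] [BorelSpace E]

lemma integral_quadrature_sq_le {M : ℕ} {s w : Fin M → ℝ} {δ : ℝ}
    (h1 : ∑ i, w i * s i = 1) (hδ : ∀ n, n ≠ 1 → |∑ i, w i * s i ^ n| ≤ δ)
    (S : Finset E) (c : E → ℝ) :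
    ∫ x, (∑ t ∈ S, c t * (∑ i, w i * wickExp (s i • t) x - inner ℝ t x)) ^ 2 ∂stdGaussian E ≤
      δ ^ 2 * ∫ x, (∑ t ∈ S, c t * wickExp t x) ^ 2 ∂stdGaussian E := by
  have hq : ∀ t : E, MemLp (fun x => ∑ i, w i * wickExp (s i • t) x) 2 (stdGaussian E) :=
    fun t => memLp_finsetSum _ fun i _ => (memLp_wickExp _).const_mul _
  have hi := memLp_inner_stdGaussian (E := E)
  rw [integral_sq_sum_mul S c memLp_wickExp,
    integral_sq_sum_mul S c (f := fun t x => ∑ i, w i * wickExp (s i • t) x - inner ℝ t x)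
      fun t => (hq t).sub (hi t)]
  simp_rw [integral_wickExp_mul_wickExp]
  refine le_trans (le_of_eq ?_) (sum_quadrature_kernel_le h1 hδ S c)
  refine Finset.sum_congr rfl fun t _ => Finset.sum_congr rfl fun u _ => ?_
  congr 1
  have hcross : ∀ t u : E, ∫ x, (∑ i, w i * wickExp (s i • t) x) * inner ℝ u x ∂stdGaussian E
      = inner ℝ t u := by
    intro t u
    simp_rw [Finset.sum_mul, mul_assoc]
    have hInt : ∀ i, Integrable (fun x => w i * (wickExp (s i • t) x * inner ℝ u x))
        (stdGaussian E) := fun i => ((memLp_wickExp (s i • t)).integrable_mul (hi u)).const_mul (w i)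
    rw [integral_finsetSum _ fun i _ => hInt i]
    simp_rw [integral_const_mul, integral_wickExp_mul_inner, inner_smul_left]
    simp only [conj_trivial, ← mul_assoc, ← Finset.sum_mul, h1, one_mul]
  have hmain : ∫ x, (∑ i, w i * wickExp (s i • t) x) * (∑ i, w i * wickExp (s i • u) x)
      ∂stdGaussian E = ∑ i, ∑ j, w i * w j * Real.exp (s i * s j * inner ℝ t u) := by
    have : ∀ i j x, w i * wickExp (s i • t) x * (w j * wickExp (s j • u) x) =
      w i * w j * (wickExp (s i • t) x * wickExp (s j • u) x) := fun i j x => by ring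
    simp_rw [Finset.sum_mul_sum, this]
    have hij : ∀ i j, Integrable (fun x => w i * w j *
        (wickExp (s i • t) x * wickExp (s j • u) x)) (stdGaussian E) :=
      fun i j => ((memLp_wickExp _).integrable_mul (memLp_wickExp _)).const_mul _
    rw [integral_finsetSum _ fun i _ => integrable_finsetSum _ fun j _ => hij i j]
    refine Finset.sum_congr rfl fun i _ => ?_
    rw [integral_finsetSum _ fun j _ => hij i j]
    refine Finset.sum_congr rfl fun j _ => ?_
    rw [integral_const_mul, integral_wickExp_mul_wickExp, inner_smul_left, inner_smul_right]
    simp [mul_assoc]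
  have hexp : ∀ x : E, (∑ i, w i * wickExp (s i • t) x - inner ℝ t x) *
      (∑ i, w i * wickExp (s i • u) x - inner ℝ u x) =
      (∑ i, w i * wickExp (s i • t) x) * (∑ i, w i * wickExp (s i • u) x) -
      (∑ i, w i * wickExp (s i • t) x) * inner ℝ u x -
      ((∑ i, w i * wickExp (s i • u) x) * inner ℝ t x - inner ℝ t x * inner ℝ u x) := by
    intro x; ring
  simp_rw [hexp]
  rw [integral_sub, integral_sub, integral_sub, hmain, hcross, hcross,
    integral_inner_mul_inner, real_inner_comm u t]
  · ring
  · exact (hq u).integrable_mul (hi t)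
  · exact (hi t).integrable_mul (hi u)
  · exact (hq t).integrable_mul (hq u)
  · exact (hq t).integrable_mul (hi u)
  · exact ((hq t).integrable_mul (hq u)).sub ((hq t).integrable_mul (hi u))
  · exact ((hq u).integrable_mul (hi t)).sub ((hi t).integrable_mul (hi u))

end KernelBound

section SeminormIntegral

variable {E : Type*} [NormedAddCommGroup E] [NormedSpace ℝ E]

lemma Seminorm.integrable_comp {α : Type*} [MeasurableSpace α] {μ : Measure α}
    {p : Seminorm ℝ E} (hp : Continuous p) {f : α → E} (hf : Integrable f μ) :
    Integrable (fun x => p (f x)) μ := by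
  obtain ⟨C, hC, h⟩ := p.bound_of_continuous_normedSpace hp
  refine (hf.norm.const_mul C).mono' (hp.comp_aestronglyMeasurable hf.1) (ae_of_all _ fun x => ?_)
  rw [Real.norm_of_nonneg (apply_nonneg p _)]
  exact h _

lemma Seminorm.map_integral_le {α : Type*} [MeasurableSpace α] {μ : Measure α}
    [IsProbabilityMeasure μ] [CompleteSpace E]
    {p : Seminorm ℝ E} (hp : Continuous p) {f : α → E} (hf : Integrable f μ) :
    p (∫ x, f x ∂μ) ≤ ∫ x, p (f x) ∂μ :=
  p.convexOn.map_integral_le hp.continuousOn isClosed_univ (by simp) hf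
    (Seminorm.integrable_comp hp hf)

end SeminormIntegral

section Quadrature
open ProbabilityTheory

lemma memLp_norm_sq_integral_eq {E α : Type*} [NormedAddCommGroup E]
    [InnerProductSpace ℝ E] [FiniteDimensional ℝ E] [MeasurableSpace α] {μ : Measure α} {f : α → E}
    (hf : MemLp f 2 μ) :
    ∫ x, ‖f x‖ ^ 2 ∂μ = ∑ k, ∫ x, (inner ℝ (stdOrthonormalBasis ℝ E k) (f x)) ^ 2 ∂μ := by
  rw [← integral_finsetSum]
  · refine integral_congr_ae (ae_of_all _ fun x => ?_)
    simp only [← (stdOrthonormalBasis ℝ E).sum_sq_norm_inner_right (f x), Real.norm_eq_abs, sq_abs]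
  · exact fun k _ => ((hf.const_inner _).integrable_sq)

variable {E : Type*} [NormedAddCommGroup E] [InnerProductSpace ℝ E] [FiniteDimensional ℝ E]
  [MeasurableSpace E] [BorelSpace E]

lemma memLp_sum_smul (S : Finset E) (b : E → E) {f : E → E → ℝ}
    (hf : ∀ t, MemLp (f t) 2 (stdGaussian E)) :
    MemLp (fun x => ∑ t ∈ S, f t x • b t) 2 (stdGaussian E) :=
  memLp_finsetSum _ fun t _ => by
    simpa [Pi.smul_def'] using (memLp_const (b t)).smul (p := 2) (q := ⊤) (r := 2) (hf t)

/-- The vector-valued form of `integral_quadrature_sq_le`. -/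
lemma integral_norm_quadrature_sq_le {M : ℕ} {s w : Fin M → ℝ} {δ : ℝ}
    (h1 : ∑ i, w i * s i = 1) (hδ : ∀ n, n ≠ 1 → |∑ i, w i * s i ^ n| ≤ δ)
    (S : Finset E) (b : E → E) :
    ∫ x, ‖∑ t ∈ S, (∑ i, w i * wickExp (s i • t) x - inner ℝ t x) • b t‖ ^ 2 ∂stdGaussian E ≤
      δ ^ 2 * ∫ x, ‖∑ t ∈ S, wickExp t x • b t‖ ^ 2 ∂stdGaussian E := by
  have hq : ∀ t : E, MemLp (fun x => ∑ i, w i * wickExp (s i • t) x) 2 (stdGaussian E) :=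
    fun t => memLp_finsetSum _ fun i _ => (memLp_wickExp _).const_mul _
  rw [memLp_norm_sq_integral_eq (memLp_sum_smul S b memLp_wickExp),
    memLp_norm_sq_integral_eq (memLp_sum_smul S b
      (f := fun t x => ∑ i, w i * wickExp (s i • t) x - inner ℝ t x)
      fun t => (hq t).sub (memLp_inner_stdGaussian t)), Finset.mul_sum]
  refine Finset.sum_le_sum fun k _ => ?_
  have := integral_quadrature_sq_le h1 hδ S fun t => inner ℝ (stdOrthonormalBasis ℝ E k) (b t)
  simp only [inner_sum, inner_smul_right]
  simpa only [mul_comm (inner ℝ (stdOrthonormalBasis ℝ E k) _)] using this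

/-- Dilating the exponents of an exponential polynomial by `|s| ≤ 1` contracts the mean of any
seminorm. -/
lemma integral_seminorm_wickExp_smul_le {p : Seminorm ℝ E} (hp : Continuous p) {s : ℝ}
    (hs : |s| ≤ 1) (S : Finset E) (b : E → E) :
    ∫ x, p (∑ t ∈ S, wickExp (s • t) x • b t) ∂stdGaussian E ≤
      ∫ x, p (∑ t ∈ S, wickExp t x • b t) ∂stdGaussian E := by
  set Φ : E → E := fun x => ∑ t ∈ S, wickExp t x • b t with hΦ
  have hΦc : Continuous Φ := by fun_prop
  have hΦi : Integrable Φ (stdGaussian E) :=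
    (memLp_sum_smul S b memLp_wickExp).integrable (by norm_num)
  set c := √(1 - s ^ 2) with hc
  have hsc : s ^ 2 + c ^ 2 = 1 := by
    rw [hc, Real.sq_sqrt]
    · ring
    · have := (sq_le_one_iff_abs_le_one s).2 hs
      linarith
  set R : E × E → E := fun z => s • z.1 + c • z.2 with hR
  have hmap := stdGaussian_prod_map_rotation (E := E) hsc
  have hRm : Measurable R := by fun_prop
  have hΦR : Integrable (fun z => Φ (R z)) ((stdGaussian E).prod (stdGaussian E)) := by
    have : Integrable Φ (((stdGaussian E).prod (stdGaussian E)).map R) := by rwa [hmap]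
    exact (integrable_map_measure hΦc.aestronglyMeasurable hRm.aemeasurable).1 this
  have hwick : ∀ t x, Integrable (fun y => wickExp t (s • x + c • y)) (stdGaussian E) := by
    intro t x
    by_contra hni
    have := integral_wickExp_rotation hsc t x
    rw [integral_undef hni] at this
    exact (wickExp_pos (s • t) x).ne this
  have hfib : ∀ x, Integrable (fun y => Φ (s • x + c • y)) (stdGaussian E) := fun x =>
    integrable_finsetSum _ fun t _ => (hwick t x).smul_const (b t)
  have hmean : ∀ x, ∑ t ∈ S, wickExp (s • t) x • b t =
      ∫ y, Φ (s • x + c • y) ∂stdGaussian E := by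
    intro x
    simp only [hΦ]
    rw [integral_finsetSum _ fun t _ => (hwick t x).smul_const (b t)]
    refine Finset.sum_congr rfl fun t _ => ?_
    rw [integral_smul_const, integral_wickExp_rotation hsc]
  have hpR := Seminorm.integrable_comp hp hΦR
  calc ∫ x, p (∑ t ∈ S, wickExp (s • t) x • b t) ∂stdGaussian E
      ≤ ∫ x, ∫ y, p (Φ (s • x + c • y)) ∂stdGaussian E ∂stdGaussian E := by
        refine integral_mono_of_nonneg (ae_of_all _ fun x => apply_nonneg p _)
          hpR.integral_prod_left (ae_of_all _ fun x => ?_)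
        simp only [hmean]
        exact Seminorm.map_integral_le hp (hfib x)
    _ = ∫ z, p (Φ (R z)) ∂((stdGaussian E).prod (stdGaussian E)) := (integral_prod _ hpR).symm
    _ = ∫ x, p (Φ x) ∂stdGaussian E := by
        conv_rhs => rw [← hmap]
        exact (integral_map hRm.aemeasurable (hp.comp hΦc).aestronglyMeasurable).symm

/-- The first absolute moment of a standard Gaussian variable. -/
def gaussianAbsMoment : ℝ := ∫ x, |x| ∂gaussianReal 0 1

lemma integral_abs_inner_stdGaussian {e : E} (he : ‖e‖ = 1) :
    ∫ x, |inner ℝ e x| ∂stdGaussian E = gaussianAbsMoment := by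
  have h := stdGaussian_map_inner e
  have h1 : ‖e‖₊ = 1 := by ext; simpa using he
  rw [h1, one_pow] at h
  rw [gaussianAbsMoment, ← h, integral_map (by fun_prop) (by fun_prop)]

lemma gaussianAbsMoment_pos : 0 < gaussianAbsMoment := by
  have hi : Integrable (fun x : ℝ => |x|) (gaussianReal 0 1) :=
    ((memLp_id_gaussianReal 1).integrable le_rfl).norm
  rw [gaussianAbsMoment, integral_pos_iff_support_of_nonneg (fun x => abs_nonneg x) hi]
  have : NullSingletonClass (gaussianReal 0 1) := nullSingletonClass_gaussianReal (by simp)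
  have h1 : Function.support (fun x : ℝ => |x|) = {0}ᶜ := by ext; simp
  rw [h1, measure_compl (measurableSet_singleton 0) (measure_ne_top _ _),
    measure_singleton]
  simp

/-- A seminorm of Gaussian mean one is bounded by a multiple of the Euclidean norm. -/
lemma seminorm_le_of_integral_eq_one {p : Seminorm ℝ E} (hp : Continuous p)
    (h : ∫ x, p x ∂stdGaussian E = 1) (v : E) : p v ≤ gaussianAbsMoment⁻¹ * ‖v‖ := by
  rcases eq_or_ne v 0 with rfl | hv
  · simp
  have hv' : ‖v‖ ≠ 0 := norm_ne_zero_iff.2 hv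
  set e : E := ‖v‖⁻¹ • v with he
  have he1 : ‖e‖ = 1 := by simp [he, norm_smul, hv']
  have hpv : p v = ‖v‖ * p e := by
    rw [he, map_smul_eq_mul]; simp [hv']
  set R := (ℝ ∙ e).reflection with hR
  have hRapply : ∀ x, (inner ℝ e x : ℝ) • e = (1 / 2 : ℝ) • x + (1 / 2 : ℝ) • R x := by
    intro x
    rw [hR, Submodule.reflection_apply, Submodule.starProjection_unit_singleton ℝ he1]
    module
  have hid : Integrable (fun x : E => x) (stdGaussian E) :=
    (IsGaussian.memLp_id (stdGaussian E) 1 (by simp)).integrable le_rfl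
  have hRint : ∫ x, p (R x) ∂stdGaussian E = 1 := by
    rw [← h]
    conv_rhs => rw [← stdGaussian_map R]
    rw [integral_map (by fun_prop) hp.aestronglyMeasurable]
  have hpi := Seminorm.integrable_comp hp hid
  have hpRi : Integrable (fun x => p (R x)) (stdGaussian E) :=
    Seminorm.integrable_comp hp (R.toContinuousLinearEquiv.toContinuousLinearMap.integrable_comp hid)
  have key : gaussianAbsMoment * p e ≤ 1 := by
    calc gaussianAbsMoment * p e = ∫ x, p ((inner ℝ e x : ℝ) • e) ∂stdGaussian E := by
          simp_rw [map_smul_eq_mul, Real.norm_eq_abs]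
          rw [integral_mul_const, integral_abs_inner_stdGaussian he1]
      _ ≤ ∫ x, (1 / 2 * p x + 1 / 2 * p (R x)) ∂stdGaussian E := by
          refine integral_mono_of_nonneg (ae_of_all _ fun x => apply_nonneg p _)
            ((hpi.const_mul _).add (hpRi.const_mul _)) (ae_of_all _ fun x => ?_)
          simp only [hRapply]
          refine (map_add_le_add p _ _).trans (le_of_eq ?_)
          rw [map_smul_eq_mul, map_smul_eq_mul]; norm_num
      _ = 1 := by
          rw [integral_add (hpi.const_mul _) (hpRi.const_mul _), integral_const_mul,
            integral_const_mul, h, hRint]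
          norm_num
  have hc := gaussianAbsMoment_pos
  rw [hpv, mul_comm]
  gcongr
  rwa [← one_div, le_div_iff₀' hc]

lemma norm_le_of_trace_le {p : Seminorm ℝ E}
    (h : ∀ S : E →ₗ[ℝ] E, LinearMap.trace ℝ E S ≤
      Module.finrank ℝ E * ∫ x, p (S x) ∂stdGaussian E) (v : E) :
    ‖v‖ ≤ Module.finrank ℝ E * p v := by
  rcases eq_or_ne v 0 with rfl | hv
  · simp
  have hv' : ‖v‖ ≠ 0 := norm_ne_zero_iff.2 hv
  set e : E := ‖v‖⁻¹ • v with he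
  have he1 : ‖e‖ = 1 := by simp [he, norm_smul, hv']
  have h1 := h ((innerₛₗ ℝ e).smulRight v)
  rw [LinearMap.trace_smulRight] at h1
  simp only [LinearMap.smulRight_apply, map_smul_eq_mul, innerₛₗ_apply_apply,
    Real.norm_eq_abs] at h1
  rw [integral_mul_const, integral_abs_inner_stdGaussian he1] at h1
  have h2 : inner ℝ e v = ‖v‖ := by
    rw [he, inner_smul_left, real_inner_self_eq_norm_sq]; simp; field_simp
  rw [h2] at h1
  refine h1.trans ?_
  gcongr
  refine (mul_le_mul_of_nonneg_right ?_ (apply_nonneg p v)).trans (one_mul _).le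
  rw [← integral_abs_inner_stdGaussian he1]
  have h3 : ∀ x : E, |inner ℝ e x| ≤ 1 / 2 + 1 / 2 * (inner ℝ e x * inner ℝ e x) := by
    intro x
    have := sq_nonneg (|inner ℝ e x| - 1)
    nlinarith [abs_mul_abs_self (inner ℝ e x)]
  have hm := memLp_inner_stdGaussian e
  have hmm : Integrable (fun x : E => inner ℝ e x * inner ℝ e x) (stdGaussian E) :=
    hm.integrable_mul hm
  refine (integral_mono (hm.integrable (by norm_num)).abs
    ((integrable_const _).add (hmm.const_mul _)) h3).trans (le_of_eq ?_)
  rw [integral_add' (integrable_const _) (hmm.const_mul _), integral_const_mul,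
    integral_inner_mul_inner, real_inner_self_eq_norm_sq, he1]
  simp; norm_num

end Quadrature

section KConvexity
open ProbabilityTheory

lemma integral_norm_le_of_integral_sq_le {E α : Type*} [NormedAddCommGroup E]
    [MeasurableSpace α] {μ : Measure α} [IsProbabilityMeasure μ] {f : α → E} (hf : MemLp f 2 μ)
    {a : ℝ} (ha : 0 ≤ a) (h : ∫ x, ‖f x‖ ^ 2 ∂μ ≤ a ^ 2) : ∫ x, ‖f x‖ ∂μ ≤ a := by
  have h1 : 0 ≤ Var[fun x => ‖f x‖; μ] := variance_nonneg _ _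
  rw [variance_eq_sub hf.norm] at h1
  simp only [Pi.pow_apply] at h1
  exact le_of_sq_le_sq (by linarith) ha

lemma integrable_inner_of_memLp {E α : Type*} [NormedAddCommGroup E] [InnerProductSpace ℝ E]
    [MeasurableSpace α] {μ : Measure α} {f g : α → E} (hf : MemLp f 2 μ) (hg : MemLp g 2 μ) :
    Integrable (fun x => inner ℝ (f x) (g x)) μ :=
  (hf.norm.integrable_mul hg.norm).mono' (hf.1.inner hg.1)
    (ae_of_all _ fun _ => norm_inner_le_norm _ _)

variable {E : Type*} [NormedAddCommGroup E] [InnerProductSpace ℝ E] [FiniteDimensional ℝ E]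
  [MeasurableSpace E] [BorelSpace E]

lemma exists_wickExp_vector_approx {φ : E → E} (hφ : MemLp φ 2 (stdGaussian E)) {ε : ℝ}
    (hε : 0 < ε) : ∃ (S : Finset E) (b : E → E),
      ∫ x, ‖φ x - ∑ t ∈ S, wickExp t x • b t‖ ^ 2 ∂stdGaussian E ≤ ε := by
  classical
  set e := stdOrthonormalBasis ℝ E with he
  set N : ℝ := Module.finrank ℝ E + 1 with hN
  have hN0 : 0 < N := by positivity
  choose s c hc happ using fun k => exists_wickExp_approx (hφ.const_inner (e k)) (div_pos hε hN0)
  refine ⟨Finset.univ.biUnion s, fun t => ∑ k, c k t • e k, ?_⟩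
  rw [memLp_norm_sq_integral_eq (f := fun x => φ x - ∑ t ∈ Finset.univ.biUnion s,
      wickExp t x • ∑ k, c k t • e k) (hφ.sub (memLp_sum_smul _ _ memLp_wickExp))]
  have hk : ∀ k x, inner ℝ (e k) (φ x - ∑ t ∈ Finset.univ.biUnion s,
      wickExp t x • ∑ k, c k t • e k) =
      inner ℝ (e k) (φ x) - ∑ t ∈ s k, c k t * wickExp t x := by
    intro k x
    rw [inner_sub_right, inner_sum]
    congr 1
    rw [Finset.sum_subset (Finset.subset_biUnion_of_mem s (Finset.mem_univ k))
      (f := fun t => c k t * wickExp t x) (fun t _ ht => by simp [hc k t ht])]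
    refine Finset.sum_congr rfl fun t _ => ?_
    rw [inner_smul_right, e.orthonormal.inner_right_fintype]
    ring
  simp_rw [← he, hk]
  refine (Finset.sum_le_sum fun k _ => happ k).trans ?_
  rw [Finset.sum_const, Finset.card_univ, Fintype.card_fin, nsmul_eq_mul, mul_div_assoc',
    div_le_iff₀ hN0, hN]
  nlinarith

lemma integral_norm_sq_stdGaussian :
    ∫ x : E, ‖x‖ ^ 2 ∂stdGaussian E = Module.finrank ℝ E := by
  rw [memLp_norm_sq_integral_eq (f := fun x : E => x) IsGaussian.memLp_two_id]
  simp_rw [pow_two, integral_inner_mul_inner, real_inner_self_eq_norm_sq]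
  simp

/-- Approximate form of the K-convexity estimate, for exponential polynomials. -/
lemma sum_inner_le_of_quadrature {p : Seminorm ℝ E} (hp : Continuous p)
    (h1 : ∫ x, p x ∂stdGaussian E = 1)
    (htr : ∀ S : E →ₗ[ℝ] E, LinearMap.trace ℝ E S ≤
      Module.finrank ℝ E * ∫ x, p (S x) ∂stdGaussian E)
    {m : ℕ} (hm : 1 ≤ m) (S : Finset E) (b : E → E) {A B : ℝ} (hB : 0 ≤ B)
    (hA : ∫ x, p (∑ t ∈ S, wickExp t x • b t) ∂stdGaussian E ≤ A)
    (hBS : ∫ x, ‖∑ t ∈ S, wickExp t x • b t‖ ^ 2 ∂stdGaussian E ≤ B ^ 2) :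
    ∫ x, inner ℝ (∑ t ∈ S, wickExp t x • b t) x ∂stdGaussian E ≤
      Module.finrank ℝ E * (4 * m * A + gaussianAbsMoment⁻¹ * (4 * m * (1 / 2) ^ m * B)) := by
  obtain ⟨M, s, w, hs, hw, hmom⟩ := exists_derivative_quadrature m hm
  set δ : ℝ := 4 * m * (1 / 2) ^ m with hδdef
  have hδ0 : 0 ≤ δ := by positivity
  have hm1 : ∑ i, w i * s i = 1 := by simpa using hmom 1 hm
  have hδ : ∀ n, n ≠ 1 → |∑ i, w i * s i ^ n| ≤ δ := by
    intro n hn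
    rcases le_or_gt n m with hnm | hnm
    · rw [hmom n hnm, if_neg hn]; simpa using hδ0
    · calc |∑ i, w i * s i ^ n| ≤ ∑ i, |w i * s i ^ n| := Finset.abs_sum_le_sum_abs _ _
        _ ≤ ∑ i, |w i| * (1 / 2) ^ m := by
          refine Finset.sum_le_sum fun i _ => ?_
          rw [abs_mul, abs_pow]
          gcongr
          calc |s i| ^ n ≤ (1 / 2) ^ n := by gcongr; exact hs i
            _ ≤ (1 / 2) ^ m := pow_le_pow_of_le_one (by norm_num) (by norm_num) hnm.le
        _ ≤ δ := by rw [← Finset.sum_mul]; exact mul_le_mul_of_nonneg_right hw (by positivity)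
  have hA0 : 0 ≤ A := (integral_nonneg fun x => apply_nonneg p _).trans hA
  have hlhs : ∫ x, inner ℝ (∑ t ∈ S, wickExp t x • b t) x ∂stdGaussian E =
      LinearMap.trace ℝ E (∑ t ∈ S, (innerₛₗ ℝ t).smulRight (b t)) := by
    simp_rw [map_sum, LinearMap.trace_smulRight, sum_inner, inner_smul_left]
    have hInt : ∀ t, Integrable (fun x => (starRingEnd ℝ) (wickExp t x) * inner ℝ (b t) x)
        (stdGaussian E) := fun t => (memLp_wickExp t).integrable_mul (memLp_inner_stdGaussian (b t))
    rw [integral_finsetSum _ fun t _ => hInt t]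
    simp [integral_wickExp_mul_inner]
  rw [hlhs]
  refine (htr _).trans ?_
  gcongr
  set Q : E → E := fun x => ∑ t ∈ S, (∑ i, w i * wickExp (s i • t) x - inner ℝ t x) • b t with hQ
  set Φ : Fin M → E → E := fun i x => ∑ t ∈ S, wickExp (s i • t) x • b t with hΦ
  have hq : ∀ t : E, MemLp (fun x => ∑ i, w i * wickExp (s i • t) x) 2 (stdGaussian E) :=
    fun t => memLp_finsetSum _ fun i _ => (memLp_wickExp _).const_mul _
  have hQm : MemLp Q 2 (stdGaussian E) := memLp_sum_smul S b
    (f := fun t x => ∑ i, w i * wickExp (s i • t) x - inner ℝ t x)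
    fun t => (hq t).sub (memLp_inner_stdGaussian t)
  have hΦm : ∀ i, MemLp (Φ i) 2 (stdGaussian E) := fun i => memLp_sum_smul S b
    (f := fun t x => wickExp (s i • t) x) fun t => memLp_wickExp _
  have hQi : ∫ x, ‖Q x‖ ∂stdGaussian E ≤ δ * B := by
    refine integral_norm_le_of_integral_sq_le hQm (by positivity) ?_
    refine (integral_norm_quadrature_sq_le hm1 hδ S b).trans ?_
    rw [mul_pow δ B]
    exact mul_le_mul_of_nonneg_left hBS (sq_nonneg _)
  have hdecomp : ∀ x, (∑ t ∈ S, (innerₛₗ ℝ t).smulRight (b t)) x = ∑ i, w i • Φ i x - Q x := by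
    intro x
    simp only [hQ, hΦ, sub_smul, Finset.sum_sub_distrib, Finset.sum_smul, Finset.smul_sum,
      LinearMap.sum_apply, LinearMap.smulRight_apply, innerₛₗ_apply_apply, smul_smul]
    rw [Finset.sum_comm]
    simp
  have hptw : ∀ x, p ((∑ t ∈ S, (innerₛₗ ℝ t).smulRight (b t)) x) ≤
      ∑ i, |w i| * p (Φ i x) + gaussianAbsMoment⁻¹ * ‖Q x‖ := by
    intro x
    rw [hdecomp]
    refine (map_sub_le_add p _ _).trans (add_le_add ?_ (seminorm_le_of_integral_eq_one hp h1 _))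
    refine (Finset.le_sum_of_subadditive p (map_zero p).le (map_add_le_add p) _ _).trans (le_of_eq ?_)
    simp [map_smul_eq_mul]
  have hpΦ : ∀ i, Integrable (fun x => |w i| * p (Φ i x)) (stdGaussian E) := fun i =>
    (Seminorm.integrable_comp hp ((hΦm i).integrable (by norm_num))).const_mul _
  have hQn : Integrable (fun x => gaussianAbsMoment⁻¹ * ‖Q x‖) (stdGaussian E) :=
    (hQm.integrable (by norm_num)).norm.const_mul _
  have hc := gaussianAbsMoment_pos
  calc _ ≤ ∫ x, (∑ i, |w i| * p (Φ i x) + gaussianAbsMoment⁻¹ * ‖Q x‖) ∂stdGaussian E :=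
        integral_mono_of_nonneg (ae_of_all _ fun x => apply_nonneg p _)
          ((integrable_finsetSum _ fun i _ => hpΦ i).add hQn) (ae_of_all _ hptw)
    _ = ∑ i, |w i| * ∫ x, p (Φ i x) ∂stdGaussian E +
          gaussianAbsMoment⁻¹ * ∫ x, ‖Q x‖ ∂stdGaussian E := by
        rw [integral_add (integrable_finsetSum _ fun i _ => hpΦ i) hQn,
          integral_finsetSum _ fun i _ => hpΦ i]
        simp_rw [integral_const_mul]
    _ ≤ ∑ i, |w i| * A + gaussianAbsMoment⁻¹ * (δ * B) := by
        gcongr with i _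
        exact (integral_seminorm_wickExp_smul_le hp ((hs i).trans (by norm_num)) S b).trans hA
    _ ≤ _ := by
        rw [← Finset.sum_mul]
        gcongr

/-- K-convexity in Lewis position: a field of unit vectors has Gaussian mean correlation with the
identity of order `d (1 + log d)`. -/
lemma integral_inner_le_of_trace_le {p : Seminorm ℝ E} (hp : Continuous p)
    (h1 : ∫ x, p x ∂stdGaussian E = 1)
    (htr : ∀ S : E →ₗ[ℝ] E, LinearMap.trace ℝ E S ≤
      Module.finrank ℝ E * ∫ x, p (S x) ∂stdGaussian E)
    {m : ℕ} (hm : 1 ≤ m)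
    (hmd : gaussianAbsMoment⁻¹ * (4 * m * (1 / 2) ^ m * Module.finrank ℝ E) ≤ 1)
    {φ : E → E} (hφ : Measurable φ) (hφp : ∀ x, p (φ x) ≤ 1) :
    ∫ x, inner ℝ (φ x) x ∂stdGaussian E ≤ Module.finrank ℝ E * (4 * m + 1) := by
  set D : ℝ := ((Module.finrank ℝ E : ℕ) : ℝ) with hD
  have hD0 : 0 ≤ D := by positivity
  have hc := gaussianAbsMoment_pos
  have hφn : ∀ x, ‖φ x‖ ≤ D := fun x => (norm_le_of_trace_le htr _).trans
    (mul_le_of_le_one_right hD0 (hφp x))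
  have hφm : MemLp φ 2 (stdGaussian E) :=
    MemLp.of_bound hφ.aestronglyMeasurable D (ae_of_all _ hφn)
  set κ := gaussianAbsMoment⁻¹ with hκ
  set g : ℝ → ℝ := fun ε => D * (4 * m * (1 + κ * ε) + κ * (4 * m * (1 / 2) ^ m * (D + ε))) +
    (ε + ε * D) / 2 with hg
  have key : ∀ ε > 0, ∫ x, inner ℝ (φ x) x ∂stdGaussian E ≤ g ε := by
    intro ε hε
    obtain ⟨S, b, hSb⟩ := exists_wickExp_vector_approx hφm (pow_pos hε 2)
    set ψ : E → E := fun x => ∑ t ∈ S, wickExp t x • b t with hψ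
    have hψm : MemLp ψ 2 (stdGaussian E) := memLp_sum_smul S b memLp_wickExp
    have hsub : MemLp (fun x => φ x - ψ x) 2 (stdGaussian E) := hφm.sub hψm
    have hsub1 := integral_norm_le_of_integral_sq_le hsub hε.le hSb
    have hsubi : Integrable (fun x => ‖φ x - ψ x‖) (stdGaussian E) :=
      (hsub.integrable (by norm_num)).norm
    have hid : MemLp (fun x : E => x) 2 (stdGaussian E) := IsGaussian.memLp_two_id
    have hA : ∫ x, p (ψ x) ∂stdGaussian E ≤ 1 + κ * ε := by
      calc ∫ x, p (ψ x) ∂stdGaussian E ≤ ∫ x, (1 + κ * ‖φ x - ψ x‖) ∂stdGaussian E := by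
            refine integral_mono_of_nonneg (ae_of_all _ fun x => apply_nonneg p _)
              ((integrable_const _).add (hsubi.const_mul _)) (ae_of_all _ fun x => ?_)
            have e1 : p (ψ x) ≤ p (φ x) + p (φ x - ψ x) := by
              have := map_sub_le_add p (φ x) (φ x - ψ x)
              simpa using this
            exact e1.trans (add_le_add (hφp x) (seminorm_le_of_integral_eq_one hp h1 _))
        _ = 1 + κ * ∫ x, ‖φ x - ψ x‖ ∂stdGaussian E := by
            rw [integral_add (integrable_const _) (hsubi.const_mul _), integral_const_mul]
            simp
        _ ≤ _ := by gcongr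
    have hB : ∫ x, ‖ψ x‖ ^ 2 ∂stdGaussian E ≤ (D + ε) ^ 2 := by
      have hsq : Integrable (fun x => ‖φ x - ψ x‖ ^ 2) (stdGaussian E) := hsub.norm.integrable_sq
      calc ∫ x, ‖ψ x‖ ^ 2 ∂stdGaussian E
          ≤ ∫ x, (D ^ 2 + 2 * D * ‖φ x - ψ x‖ + ‖φ x - ψ x‖ ^ 2) ∂stdGaussian E := by
            refine integral_mono_of_nonneg (ae_of_all _ fun x => by positivity)
              (((integrable_const _).add (hsubi.const_mul _)).add hsq) (ae_of_all _ fun x => ?_)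
            have e1 : ‖ψ x‖ ≤ D + ‖φ x - ψ x‖ := by
              have := norm_sub_le (φ x) (φ x - ψ x)
              rw [sub_sub_cancel] at this
              linarith [hφn x]
            have := pow_le_pow_left₀ (norm_nonneg _) e1 2
            simp only
            linarith
        _ = D ^ 2 + 2 * D * ∫ x, ‖φ x - ψ x‖ ∂stdGaussian E +
              ∫ x, ‖φ x - ψ x‖ ^ 2 ∂stdGaussian E := by
            rw [integral_add (f := fun x => D ^ 2 + 2 * D * ‖φ x - ψ x‖)
                ((integrable_const _).add (hsubi.const_mul _)) hsq,
              integral_add (integrable_const _) (hsubi.const_mul _), integral_const_mul]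
            simp
        _ ≤ D ^ 2 + 2 * D * ε + ε ^ 2 := by gcongr
        _ = _ := by ring
    have hmain := sum_inner_le_of_quadrature hp h1 htr hm S b (by positivity) hA hB
    have hrest : ∫ x, inner ℝ (φ x - ψ x) x ∂stdGaussian E ≤ (ε + ε * D) / 2 := by
      have hsq : Integrable (fun x => ‖φ x - ψ x‖ ^ 2) (stdGaussian E) := hsub.norm.integrable_sq
      have hsq2 : Integrable (fun x : E => ‖x‖ ^ 2) (stdGaussian E) := hid.norm.integrable_sq
      calc ∫ x, inner ℝ (φ x - ψ x) x ∂stdGaussian E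
          ≤ ∫ x, (1 / (2 * ε) * ‖φ x - ψ x‖ ^ 2 + ε / 2 * ‖x‖ ^ 2) ∂stdGaussian E := by
            refine integral_mono (integrable_inner_of_memLp hsub hid)
              ((hsq.const_mul _).add (hsq2.const_mul _)) fun x => ?_
            refine (real_inner_le_norm _ _).trans ?_
            have : 0 ≤ 1 / (2 * ε) * (‖φ x - ψ x‖ - ε * ‖x‖) ^ 2 := by positivity
            have e : 1 / (2 * ε) * (‖φ x - ψ x‖ - ε * ‖x‖) ^ 2 =
                1 / (2 * ε) * ‖φ x - ψ x‖ ^ 2 + ε / 2 * ‖x‖ ^ 2 - ‖φ x - ψ x‖ * ‖x‖ := by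
              field_simp; ring
            linarith
        _ = 1 / (2 * ε) * ∫ x, ‖φ x - ψ x‖ ^ 2 ∂stdGaussian E + ε / 2 * D := by
            rw [integral_add (hsq.const_mul _) (hsq2.const_mul _), integral_const_mul,
              integral_const_mul, integral_norm_sq_stdGaussian]
        _ ≤ 1 / (2 * ε) * ε ^ 2 + ε / 2 * D := by gcongr
        _ = _ := by field_simp
    have hsplit : ∫ x, inner ℝ (φ x) x ∂stdGaussian E = ∫ x, inner ℝ (ψ x) x ∂stdGaussian E +
        ∫ x, inner ℝ (φ x - ψ x) x ∂stdGaussian E := by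
      rw [← integral_add (integrable_inner_of_memLp hψm hid) (integrable_inner_of_memLp hsub hid)]
      simp_rw [← inner_add_left, add_sub_cancel]
    rw [hsplit]
    exact add_le_add hmain hrest
  have hlim : Filter.Tendsto g (nhdsWithin 0 (Ioi 0)) (nhds (g 0)) :=
    (Continuous.tendsto (by fun_prop) 0).mono_left nhdsWithin_le_nhds
  refine (ge_of_tendsto hlim (eventually_mem_nhdsWithin.mono key)).trans ?_
  simp only [hg, mul_zero, add_zero, mul_one, zero_mul, zero_div]
  gcongr

end KConvexity

section Lewis
open ProbabilityTheory

/-- The derivative of the determinant at the identity is the trace. -/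
lemma LinearMap.hasDerivAt_det_one_add_smul {V : Type*} [AddCommGroup V] [Module ℝ V]
    [FiniteDimensional ℝ V] (S : V →ₗ[ℝ] V) :
    HasDerivAt (fun r : ℝ => LinearMap.det (1 + r • S)) (LinearMap.trace ℝ V S) 0 := by
  classical
  set b := Module.finBasis ℝ V
  set M := LinearMap.toMatrix b b S with hM
  set q := (Matrix.det (1 + (Polynomial.X : Polynomial ℝ) • M.map Polynomial.C)).divX.divX
  have h : (fun r : ℝ => LinearMap.det (1 + r • S)) =
      fun r => 1 + LinearMap.trace ℝ V S * r + q.eval r * r ^ 2 := by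
    ext r
    rw [← LinearMap.det_toMatrix b, LinearMap.trace_eq_matrix_trace ℝ b, map_add, map_smul,
      LinearMap.toMatrix_one, Matrix.det_one_add_smul]
  rw [h]
  have h1 : HasDerivAt (fun r : ℝ => 1 + LinearMap.trace ℝ V S * r)
      (LinearMap.trace ℝ V S) 0 := by
    simpa using ((hasDerivAt_id (0 : ℝ)).const_mul (LinearMap.trace ℝ V S)).const_add 1
  have h2 := (q.hasDerivAt 0).mul (hasDerivAt_pow 2 (0 : ℝ))
  convert! h1.add h2 using 1
  simp

lemma nonneg_of_hasDerivAt_of_forall_pos {g : ℝ → ℝ} {g' : ℝ} (hg : HasDerivAt g g' 0)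
    (h0 : g 0 = 0) (h : ∀ t > 0, 0 ≤ g t) : 0 ≤ g' := by
  have h1 := hg.tendsto_slope_zero.mono_left
    (nhdsWithin_mono 0 (fun t ht => ne_of_gt ht : Ioi (0 : ℝ) ⊆ {0}ᶜ))
  refine ge_of_tendsto h1 (eventually_mem_nhdsWithin.mono fun t ht => ?_)
  have ht' : 0 < t := ht
  simp only [zero_add, h0, sub_zero, smul_eq_mul]
  exact mul_nonneg (inv_nonneg.2 ht'.le) (h t ht')

variable {E : Type*} [NormedAddCommGroup E] [InnerProductSpace ℝ E] [FiniteDimensional ℝ E]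
  [MeasurableSpace E] [BorelSpace E]

lemma integral_abs_inner_stdGaussian_eq (u : E) :
    ∫ x, |inner ℝ u x| ∂stdGaussian E = gaussianAbsMoment * ‖u‖ := by
  rcases eq_or_ne u 0 with rfl | hu
  · simp
  have hu' : ‖u‖ ≠ 0 := norm_ne_zero_iff.2 hu
  have h := integral_abs_inner_stdGaussian (e := ‖u‖⁻¹ • u) (by simp [norm_smul, hu'])
  simp only [inner_smul_left, abs_mul, conj_trivial, abs_inv, abs_norm, integral_const_mul] at h
  rw [← h]
  field_simp

lemma integrable_id_stdGaussian : Integrable (fun x : E => x) (stdGaussian E) :=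
  (IsGaussian.memLp_id (stdGaussian E) 1 (by simp)).integrable le_rfl

lemma norm_le_integral_norm_apply (A : E →L[ℝ] E) :
    gaussianAbsMoment * ‖A‖ ≤ ∫ x, ‖A x‖ ∂stdGaussian E := by
  have hc := gaussianAbsMoment_pos
  have hA := A.integrable_comp (integrable_id_stdGaussian (E := E))
  rw [← LinearIsometryEquiv.norm_map ContinuousLinearMap.adjoint A, ← le_div_iff₀' hc]
  refine ContinuousLinearMap.opNorm_le_bound _
    (div_nonneg (integral_nonneg fun x => norm_nonneg _) hc.le) fun v => ?_
  rw [div_mul_eq_mul_div, le_div_iff₀' hc, ← integral_abs_inner_stdGaussian_eq,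
    ← integral_mul_const]
  refine integral_mono_of_nonneg (ae_of_all _ fun x => abs_nonneg _) (hA.norm.mul_const _)
    (ae_of_all _ fun x => ?_)
  simp only [ContinuousLinearMap.adjoint_inner_left, mul_comm ‖A x‖]
  exact abs_real_inner_le_norm _ _

/-- Every norm has a linear image in Lewis position for the Gaussian mean norm. -/
lemma exists_lewis_position {p : Seminorm ℝ E} (hp : Continuous p) {c : ℝ} (hc : 0 < c)
    (hpc : ∀ x, c * ‖x‖ ≤ p x) (hd : 0 < Module.finrank ℝ E) :
    ∃ A : E ≃L[ℝ] E, ∫ x, p (A x) ∂stdGaussian E = 1 ∧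
      ∀ S : E →ₗ[ℝ] E, LinearMap.trace ℝ E S ≤
        Module.finrank ℝ E * ∫ x, p (A (S x)) ∂stdGaussian E := by
  set f : (E →L[ℝ] E) → ℝ := fun A => ∫ x, p (A x) ∂stdGaussian E with hf
  have hid := integrable_id_stdGaussian (E := E)
  have hInt : ∀ A : E →L[ℝ] E, Integrable (fun x => p (A x)) (stdGaussian E) := fun A =>
    Seminorm.integrable_comp hp (A.integrable_comp hid)
  have hf0 : ∀ A, 0 ≤ f A := fun A => integral_nonneg fun x => apply_nonneg p _
  have hfadd : ∀ A B, f (A + B) ≤ f A + f B := by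
    intro A B
    simp only [hf]
    rw [← integral_add (hInt A) (hInt B)]
    exact integral_mono (hInt _) ((hInt A).add (hInt B)) fun x => map_add_le_add p _ _
  have hfsmul : ∀ (r : ℝ) A, f (r • A) = |r| * f A := by
    intro r A
    simp only [hf, smul_apply, map_smul_eq_mul, Real.norm_eq_abs,
      integral_const_mul]
  obtain ⟨C, hC, hCp⟩ := p.bound_of_continuous_normedSpace hp
  have hfle : ∀ A, f A ≤ (C * ∫ x : E, ‖x‖ ∂stdGaussian E) * ‖A‖ := by
    intro A
    have : ∀ x, p (A x) ≤ C * ‖A‖ * ‖x‖ := fun x => (hCp _).trans (by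
      rw [mul_assoc]; gcongr; exact A.le_opNorm x)
    refine (integral_mono (hInt A) (hid.norm.const_mul _) this).trans (le_of_eq ?_)
    rw [integral_const_mul]; ring
  let q : Seminorm ℝ (E →L[ℝ] E) := Seminorm.of f hfadd hfsmul
  have hfcont : Continuous f :=
    Seminorm.continuous_of_continuousAt_zero (p := q) <| by
      have h0 : q 0 = 0 := map_zero q
      rw [ContinuousAt, h0]
      refine squeeze_zero hf0 hfle ?_
      have := (continuous_norm (E := E →L[ℝ] E)).const_mul (C * ∫ x : E, ‖x‖ ∂stdGaussian E)
      simpa using this.tendsto 0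
  set T : Set (E →L[ℝ] E) := {A | f A ≤ 1} with hT
  have hTbdd : T ⊆ closedBall 0 ((c * gaussianAbsMoment)⁻¹) := by
    intro A hA
    have hg := gaussianAbsMoment_pos
    rw [mem_closedBall_zero_iff, ← one_div, le_div_iff₀' (by positivity), mul_assoc]
    refine (mul_le_mul_of_nonneg_left (norm_le_integral_norm_apply A) hc.le).trans
      (le_trans ?_ hA)
    rw [← integral_const_mul]
    exact integral_mono ((A.integrable_comp hid).norm.const_mul _) (hInt A) fun x => hpc _
  have hTc : IsCompact T :=
    (isCompact_closedBall _ _).of_isClosed_subset (isClosed_le hfcont continuous_const) hTbdd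
  obtain ⟨A, hAT, hAmax⟩ := hTc.exists_isMaxOn (f := fun A => |A.det|)
    ⟨0, by simp [hT, hf]⟩ (ContinuousLinearMap.continuous_det.abs.continuousOn)
  have hmax : ∀ (B : E →L[ℝ] E) (r : ℝ), 0 < r → f B ≤ r →
      |B.det| ≤ |A.det| * r ^ Module.finrank ℝ E := by
    intro B r hr hB
    have hmem : r⁻¹ • B ∈ T := by
      simp only [hT, Set.mem_ofPred_eq, hfsmul, abs_inv, abs_of_pos hr]
      rwa [inv_mul_le_iff₀ hr, mul_one]
    have := hAmax hmem
    simp only [Set.mem_ofPred_eq, ContinuousLinearMap.det, ContinuousLinearMap.toLinearMap_smul,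
      LinearMap.det_smul, abs_mul, abs_pow, abs_inv, abs_of_pos hr] at this
    rwa [inv_pow, inv_mul_le_iff₀ (by positivity), mul_comm] at this
  have hdet : A.det ≠ 0 := by
    intro h0
    have := hmax 1 (f 1 + 1) (by linarith [hf0 1]) (by linarith)
    rw [h0] at this
    rw [ContinuousLinearMap.det, ContinuousLinearMap.one_def, ContinuousLinearMap.coe_id,
      LinearMap.det_id] at this
    norm_num at this
  have htr : ∀ S : E →L[ℝ] E, LinearMap.trace ℝ E S ≤ Module.finrank ℝ E * f (A * S) := by
    intro S
    have hdet1 : ∀ t > 0, LinearMap.det (1 + t • (S : E →ₗ[ℝ] E)) ≤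
        (1 + t * f (A * S)) ^ Module.finrank ℝ E := by
      intro t ht
      have h1 : f (A * (1 + t • S)) ≤ 1 + t * f (A * S) := by
        rw [mul_add, mul_one, mul_smul_comm]
        refine (hfadd _ _).trans (add_le_add hAT ?_)
        rw [hfsmul, abs_of_pos ht]
      have h2 := hmax _ _ (by have := hf0 (A * S); positivity) h1
      have h3 : (A * (1 + t • S)).det = A.det * LinearMap.det (1 + t • (S : E →ₗ[ℝ] E)) := by
        rw [ContinuousLinearMap.det, ContinuousLinearMap.det, ← map_mul]; rfl
      rw [h3, abs_mul] at h2
      exact (le_abs_self _).trans (le_of_mul_le_mul_left h2 (abs_pos.2 hdet))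
    have hder := ((((hasDerivAt_id (0 : ℝ)).mul_const (f (A * S))).const_add 1).pow
      (Module.finrank ℝ E)).sub (LinearMap.hasDerivAt_det_one_add_smul (S : E →ₗ[ℝ] E))
    have := nonneg_of_hasDerivAt_of_forall_pos hder (by simp) fun t ht => by
      simpa using hdet1 t ht
    simpa using this
  have hA1 : f A = 1 := by
    refine le_antisymm hAT ?_
    have := htr 1
    have hd' : (0 : ℝ) < Module.finrank ℝ E := by exact_mod_cast hd
    rw [mul_one, ContinuousLinearMap.one_def, ContinuousLinearMap.coe_id, LinearMap.trace_id] at this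
    exact le_of_mul_le_mul_left (by simpa using this) hd'
  refine ⟨A.toContinuousLinearEquivOfDetNeZero hdet, ?_, fun S => ?_⟩
  · simpa using hA1
  · simpa [hf] using htr (LinearMap.toContinuousLinearMap S)

end Lewis

section Position
open ProbabilityTheory

lemma exists_quadrature_degree : ∃ C : ℝ, 0 < C ∧ ∀ d : ℕ, 1 ≤ d → ∃ m : ℕ, 1 ≤ m ∧
    gaussianAbsMoment⁻¹ * (4 * m * (1 / 2) ^ m * d) ≤ 1 ∧
    (d : ℝ) * (4 * m + 1) ≤ C * d * (1 + Real.log d) := by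
  have hg := gaussianAbsMoment_pos
  obtain ⟨k₀, hk₀⟩ := pow_unbounded_of_one_lt (8 * gaussianAbsMoment⁻¹) (one_lt_two (α := ℝ))
  refine ⟨8 * k₀ + 40, by positivity, fun d hd => ?_⟩
  have hd' : (1 : ℝ) ≤ d := by exact_mod_cast hd
  set k := Nat.clog 2 d + k₀ + 1 with hk
  have hlog : 0 ≤ Real.log d := Real.log_nonneg hd'
  refine ⟨2 * k, by omega, ?_, ?_⟩
  · have h1 : (d : ℝ) ≤ 2 ^ Nat.clog 2 d := by exact_mod_cast Nat.le_pow_clog one_lt_two d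
    have h2 : (k : ℝ) ≤ 2 ^ k := by exact_mod_cast (Nat.lt_two_pow_self (n := k)).le
    have h3 : (1 / 2 : ℝ) ^ (2 * k) = (2 ^ k)⁻¹ * (2 ^ k)⁻¹ := by
      rw [pow_mul', one_div, inv_pow, pow_two]
    have h4 : 8 * gaussianAbsMoment⁻¹ * d ≤ 2 ^ k := by
      calc 8 * gaussianAbsMoment⁻¹ * d ≤ 2 ^ k₀ * 2 ^ Nat.clog 2 d := by gcongr
        _ ≤ 2 ^ k := by
          rw [← pow_add]
          exact pow_le_pow_right₀ (by norm_num) (by omega)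
    have h5 : (0 : ℝ) < 2 ^ k := by positivity
    rw [h3]
    push_cast
    calc gaussianAbsMoment⁻¹ * (4 * (2 * k) * ((2 ^ k)⁻¹ * (2 ^ k)⁻¹) * d)
        = (k * (2 ^ k)⁻¹) * ((8 * gaussianAbsMoment⁻¹ * d) * (2 ^ k)⁻¹) := by ring
      _ ≤ 1 * 1 := by
        gcongr
        · rw [← div_eq_mul_inv]; exact (div_le_one h5).2 h2
        · rw [← div_eq_mul_inv]; exact (div_le_one h5).2 h4
      _ = 1 := one_mul 1
  · have hclog : (Nat.clog 2 d : ℝ) ≤ 2 * Real.log d + 1 := by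
      rcases Nat.eq_zero_or_pos (Nat.clog 2 d) with h0 | hpos
      · rw [h0]; push_cast; linarith
      have h1 : 2 ^ (Nat.clog 2 d - 1) < d := Nat.pow_pred_clog_lt_self one_lt_two (by
        by_contra h
        have : d ≤ 1 := by omega
        rw [Nat.clog_of_right_le_one this] at hpos
        omega)
      have h2 : ((2 : ℝ) ^ (Nat.clog 2 d - 1)) < d := by exact_mod_cast h1
      have h3 := Real.log_lt_log (by positivity) h2
      rw [Real.log_pow, Nat.cast_sub hpos] at h3
      have h4 := Real.log_two_gt_d9
      have h5 : (1 : ℝ) ≤ Nat.clog 2 d := by exact_mod_cast hpos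
      push_cast at h3
      nlinarith
    rw [mul_comm (8 * (k₀ : ℝ) + 40), mul_assoc]
    gcongr
    have : (k : ℝ) = Nat.clog 2 d + k₀ + 1 := by rw [hk]; push_cast; ring
    push_cast
    have hk0 : (0 : ℝ) ≤ k₀ := by positivity
    nlinarith [mul_nonneg hk0 hlog]

variable {E : Type*} [NormedAddCommGroup E] [InnerProductSpace ℝ E] [FiniteDimensional ℝ E]
  [MeasurableSpace E] [BorelSpace E]

lemma exists_measurable_argmax (U : Finset E) (hU : U.Nonempty) :
    ∃ φ : E → E, Measurable φ ∧ ∀ x, φ x ∈ U ∧ ∀ u ∈ U, inner ℝ u x ≤ inner ℝ (φ x) x := by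
  classical
  induction hU using Finset.Nonempty.cons_induction with
  | singleton a => exact ⟨fun _ => a, measurable_const, by simp⟩
  | cons a s ha hs ih =>
    obtain ⟨φ, hφ, h⟩ := ih
    have hmeas : MeasurableSet {x | inner ℝ (φ x) x ≤ inner ℝ a x} :=
      measurableSet_le (by fun_prop) (by fun_prop)
    refine ⟨{x | inner ℝ (φ x) x ≤ inner ℝ a x}.piecewise (fun _ => a) φ,
      Measurable.piecewise hmeas measurable_const hφ, fun x => ?_⟩
    by_cases hx : inner ℝ (φ x) x ≤ inner ℝ a x
    · rw [Set.piecewise_eq_of_mem _ _ _ (by exact hx)]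
      refine ⟨by simp, fun u hu => ?_⟩
      rcases Finset.mem_cons.1 hu with rfl | hu
      · exact le_rfl
      · exact ((h x).2 u hu).trans hx
    · rw [Set.piecewise_eq_of_notMem _ _ _ (by exact hx)]
      refine ⟨Finset.mem_cons_of_mem (h x).1, fun u hu => ?_⟩
      rcases Finset.mem_cons.1 hu with rfl | hu
      · exact (not_le.1 hx).le
      · exact (h x).2 u hu

lemma measureReal_exists_inner_ge_le {p : Seminorm ℝ E} {B : ℝ} (hB : 0 < B)
    (h : ∀ φ : E → E, Measurable φ → (∀ x, p (φ x) ≤ 1) →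
      ∫ x, inner ℝ (φ x) x ∂stdGaussian E ≤ B)
    (U : Finset E) (hU : U.Nonempty) (hsymm : ∀ u ∈ U, -u ∈ U) (hUp : ∀ u ∈ U, p u ≤ 1) :
    (stdGaussian E).real {x | ∃ u ∈ U, 8 * B ≤ inner ℝ u x} ≤ 1 / 8 := by
  obtain ⟨φ, hφ, hmax⟩ := exists_measurable_argmax U hU
  have hInt := h φ hφ fun x => hUp _ (hmax x).1
  have hnn : ∀ x, 0 ≤ inner ℝ (φ x) x := fun x => by
    have := (hmax x).2 _ (hsymm _ (hmax x).1)
    rw [inner_neg_left] at this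
    linarith
  obtain ⟨R, hR⟩ := (U : Set E).toFinite.isBounded.exists_norm_le
  have hφm : MemLp φ 2 (stdGaussian E) :=
    MemLp.of_bound hφ.aestronglyMeasurable R (ae_of_all _ fun x => hR _ (hmax x).1)
  have hi := integrable_inner_of_memLp hφm (g := fun x => x) IsGaussian.memLp_two_id
  have hmk := mul_meas_ge_le_integral_of_nonneg (ae_of_all _ hnn) hi (8 * B)
  have hset : {x | ∃ u ∈ U, 8 * B ≤ inner ℝ u x} = {x | 8 * B ≤ inner ℝ (φ x) x} := by
    ext x
    exact ⟨fun ⟨u, hu, hux⟩ => hux.trans ((hmax x).2 u hu), fun hx => ⟨φ x, (hmax x).1, hx⟩⟩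
  rw [hset]
  have h2 := hmk.trans hInt
  rw [mul_assoc, mul_comm, mul_assoc] at h2
  have := le_of_mul_le_mul_left (h2.trans_eq (mul_one B).symm) hB
  linarith

lemma measureReal_seminorm_ge_le {p : Seminorm ℝ E} (hp : Continuous p)
    (h1 : ∫ x, p x ∂stdGaussian E = 1) :
    (stdGaussian E).real {x | 8 ≤ p x} ≤ 1 / 8 := by
  have hmk := mul_meas_ge_le_integral_of_nonneg (ae_of_all _ fun x => apply_nonneg p x)
    (Seminorm.integrable_comp hp integrable_id_stdGaussian) 8
  rw [h1] at hmk
  linarith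

end Position

section Torus
open ProbabilityTheory UnitAddTorus

/-- Normalized Haar measure on the torus `(ℝ / ℤ)^ι`. -/
abbrev torusHaar (ι : Type*) [Fintype ι] : Measure (UnitAddTorus ι) :=
  Measure.pi fun _ => AddCircle.haarAddCircle

variable {ι : Type*} [Fintype ι]

lemma integral_fourier_haarAddCircle {n : ℤ} (hn : n ≠ 0) :
    ∫ x : UnitAddCircle, fourier n x ∂AddCircle.haarAddCircle = 0 :=
  integral_eq_zero_of_add_right_eq_neg (fourier_add_half_inv_index hn one_pos)

lemma integral_mFourier {n : ι → ℤ} (hn : n ≠ 0) : ∫ x, mFourier n x ∂torusHaar ι = 0 := by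
  obtain ⟨i, hi⟩ := Function.ne_iff.1 hn
  simp only [mFourier, ContinuousMap.coe_mk]
  rw [integral_fintype_prod_eq_prod (fun i x => fourier (n i) x)]
  exact Finset.prod_eq_zero (Finset.mem_univ i) (integral_fourier_haarAddCircle hi)

lemma norm_mFourier_apply (n : ι → ℤ) (x : UnitAddTorus ι) : ‖mFourier n x‖ = 1 := by
  simp only [mFourier, fourier_apply, ContinuousMap.coe_mk, norm_prod, Circle.norm_coe,
    Finset.prod_const_one]

lemma ContinuousMap.integrable_of_compactSpace {X F : Type*} [TopologicalSpace X] [CompactSpace X]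
    [MeasurableSpace X] [BorelSpace X] [NormedAddCommGroup F]
    [SecondCountableTopologyEither X F] (ρ : Measure X) [IsFiniteMeasure ρ] (f : C(X, F)) :
    Integrable f ρ :=
  Integrable.of_bound f.continuous.aestronglyMeasurable ‖f‖ (ae_of_all _ f.norm_coe_le_norm)

lemma ContinuousMap.continuous_integral {X F : Type*} [TopologicalSpace X] [CompactSpace X]
    [MeasurableSpace X] [BorelSpace X] [NormedAddCommGroup F] [NormedSpace ℝ F]
    [SecondCountableTopologyEither X F] (ρ : Measure X) [IsProbabilityMeasure ρ] :
    Continuous fun f : C(X, F) => ∫ x, f x ∂ρ := by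
  refine (LipschitzWith.of_dist_le_mul (K := 1) fun f g => ?_).continuous
  rw [dist_eq_norm, ← integral_sub (f.integrable_of_compactSpace ρ) (g.integrable_of_compactSpace ρ),
    dist_eq_norm]
  refine (norm_integral_le_of_norm_le_const (C := ‖f - g‖)
    (ae_of_all _ fun x => (f - g).norm_coe_le_norm x)).trans ?_
  simp

/-- A probability measure on the torus with summably small Fourier coefficients is close to the
Haar measure. -/
lemma norm_integral_sub_integral_torusHaar_le (ρ : Measure (UnitAddTorus ι))
    [IsProbabilityMeasure ρ] {δ : ℝ}
    (h : ∀ F : Finset (ι → ℤ), 0 ∉ F → ∑ m ∈ F, ‖∫ x, mFourier m x ∂ρ‖ ≤ δ)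
    (f : C(UnitAddTorus ι, ℂ)) :
    ‖∫ x, f x ∂ρ - ∫ x, f x ∂torusHaar ι‖ ≤ δ * ∫ x, ‖f x‖ ∂torusHaar ι := by
  classical
  set μ := torusHaar ι
  have hnorm : Continuous fun f : C(UnitAddTorus ι, ℂ) => ∫ x, ‖f x‖ ∂μ :=
    (ContinuousMap.continuous_integral (F := ℝ) μ).comp
      (ContinuousMap.continuous_postcomp (⟨norm, continuous_norm⟩ : C(ℂ, ℝ)))
  have hclosed : IsClosed {f : C(UnitAddTorus ι, ℂ) |
      ‖∫ x, f x ∂ρ - ∫ x, f x ∂μ‖ ≤ δ * ∫ x, ‖f x‖ ∂μ} :=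
    isClosed_le ((ContinuousMap.continuous_integral ρ).sub
      (ContinuousMap.continuous_integral μ)).norm (continuous_const.mul hnorm)
  have hf : f ∈ closure (Submodule.span ℂ (range (mFourier (d := ι))) :
      Set C(UnitAddTorus ι, ℂ)) := by
    have := (span_mFourier_closure_eq_top (d := ι)).ge (Submodule.mem_top (x := f))
    exact this
  refine closure_minimal ?_ hclosed hf
  intro g hg
  obtain ⟨c, rfl⟩ := Finsupp.mem_span_range_iff_exists_finsupp.1 hg
  set g : C(UnitAddTorus ι, ℂ) := c.sum fun m a => a • mFourier m with hgdef
  have hgx : ∀ x, g x = ∑ m ∈ c.support, c m * mFourier m x := fun x => by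
    simp [hgdef, Finsupp.sum, ContinuousMap.sum_apply]
  have hInt : ∀ (ν : Measure (UnitAddTorus ι)) [IsProbabilityMeasure ν],
      ∫ x, g x ∂ν = ∑ m ∈ c.support, c m * ∫ x, mFourier m x ∂ν := fun ν _ => by
    simp_rw [hgx]
    rw [integral_finsetSum]
    · simp_rw [integral_const_mul]
    · exact fun m _ => ((mFourier m).integrable_of_compactSpace ν).const_mul _
  have hcoef : ∀ m, ‖c m‖ ≤ ∫ x, ‖g x‖ ∂μ := fun m => by
    have h1 : ∫ x, mFourier (-m) x * g x ∂μ = c m := by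
      have : ∀ x, mFourier (-m) x * g x = ∑ k ∈ c.support, c k * mFourier (k - m) x := fun x => by
        rw [hgx, Finset.mul_sum]
        refine Finset.sum_congr rfl fun k _ => ?_
        rw [sub_eq_add_neg, mFourier_add]
        ring
      simp_rw [this]
      rw [integral_finsetSum _
        fun k _ => ((mFourier (k - m)).integrable_of_compactSpace μ).const_mul _]
      simp_rw [integral_const_mul]
      rw [Finset.sum_eq_single m]
      · simp [mFourier_zero]
      · intro k _ hk
        rw [integral_mFourier (sub_ne_zero.2 hk), mul_zero]
      · intro hm
        simp [Finsupp.notMem_support_iff.1 hm]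
    rw [← h1]
    refine (norm_integral_le_integral_norm _).trans_eq ?_
    simp [norm_mFourier_apply]
  have hdiff : ∫ x, g x ∂ρ - ∫ x, g x ∂μ =
      ∑ m ∈ c.support.erase 0, c m * ∫ x, mFourier m x ∂ρ := by
    rw [hInt, hInt, ← Finset.sum_sub_distrib]
    have : ∀ m ∈ c.support, c m * ∫ x, mFourier m x ∂ρ - c m * ∫ x, mFourier m x ∂μ =
        if m = 0 then 0 else c m * ∫ x, mFourier m x ∂ρ := fun m _ => by
      split_ifs with hm
      · simp [hm, mFourier_zero]
      · rw [integral_mFourier hm]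
        simp
    rw [Finset.sum_congr rfl this, ← Finset.filter_ne', Finset.sum_filter]
    exact Finset.sum_congr rfl fun m _ => by simp [ite_not]
  change ‖∫ x, g x ∂ρ - ∫ x, g x ∂μ‖ ≤ δ * ∫ x, ‖g x‖ ∂μ
  rw [hdiff]
  calc _ ≤ ∑ m ∈ c.support.erase 0, ‖c m‖ * ‖∫ x, mFourier m x ∂ρ‖ :=
        (norm_sum_le _ _).trans_eq (by simp)
    _ ≤ ∑ m ∈ c.support.erase 0, (∫ x, ‖g x‖ ∂μ) * ‖∫ x, mFourier m x ∂ρ‖ := by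
        gcongr with m _
        exact hcoef m
    _ = (∑ m ∈ c.support.erase 0, ‖∫ x, mFourier m x ∂ρ‖) * ∫ x, ‖g x‖ ∂μ := by
        rw [← Finset.mul_sum, mul_comm]
    _ ≤ _ := by
        gcongr
        exact h _ (Finset.notMem_erase _ _)

end Torus

section Transference
open ProbabilityTheory UnitAddTorus
variable {E : Type*} [NormedAddCommGroup E] [InnerProductSpace ℝ E] {ι : Type*}

/-- The quotient map onto the torus of a lattice with basis `v`. -/
def torusProj (v : Module.Basis ι ℝ E) (x : E) : UnitAddTorus ι := fun i => (v.coord i x : ℝ)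

lemma continuous_torusProj [FiniteDimensional ℝ E] (v : Module.Basis ι ℝ E) :
    Continuous (torusProj v) :=
  continuous_pi fun i => (AddCircle.continuous_mk' 1).comp
    (LinearMap.continuous_of_finiteDimensional (v.coord i))

variable [Fintype ι]

lemma isOpenMap_torusProj (v : Module.Basis ι ℝ E) : IsOpenMap (torusProj v) := by
  have h : torusProj v =
      (Pi.map fun (_ : ι) (a : ℝ) => (a : UnitAddCircle)) ∘ v.equivFunL := by
    ext x i
    simp [torusProj]
  rw [h]
  exact (IsOpenMap.piMap (fun _ => QuotientAddGroup.isOpenMap_coe) (by simp)).comp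
    v.equivFunL.toHomeomorph.isOpenMap

lemma exists_eq_sub_of_torusProj_eq (v : Module.Basis ι ℝ E) {x y : E}
    (h : torusProj v x = torusProj v y) : ∃ z : ι → ℤ, x = y - ∑ i, (z i : ℝ) • v i := by
  have h1 : ∀ i, ∃ n : ℤ, v.coord i y - v.coord i x = n := fun i => by
    have := congrFun h i
    simp only [torusProj] at this
    rw [QuotientAddGroup.eq, AddSubgroup.mem_zmultiples_iff] at this
    obtain ⟨n, hn⟩ := this
    exact ⟨n, by rw [zsmul_eq_mul, mul_one] at hn; rw [hn]; ring⟩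
  choose z hz using h1
  refine ⟨z, ?_⟩
  simp_rw [← hz, sub_smul, Finset.sum_sub_distrib, Module.Basis.coord_apply, v.sum_repr]
  abel

variable [FiniteDimensional ℝ E]

/-- The vector of the dual lattice with integer coordinates `m`. -/
def dualVector (v : Module.Basis ι ℝ E) (m : ι → ℤ) : E :=
  (InnerProductSpace.toDual ℝ E).symm
    (LinearMap.toContinuousLinearMap (∑ i, (m i : ℝ) • v.coord i))

lemma inner_dualVector (v : Module.Basis ι ℝ E) (m : ι → ℤ) (x : E) :
    inner ℝ (dualVector v m) x = ∑ i, (m i : ℝ) * v.coord i x := by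
  rw [dualVector, InnerProductSpace.toDual_symm_apply]
  simp

lemma dualVector_sub (v : Module.Basis ι ℝ E) (m k : ι → ℤ) :
    dualVector v (m - k) = dualVector v m - dualVector v k := by
  refine ext_inner_right ℝ fun x => ?_
  simp only [inner_sub_left, inner_dualVector, ← Finset.sum_sub_distrib]
  exact Finset.sum_congr rfl fun i _ => by push_cast [Pi.sub_apply]; ring

lemma dualVector_zero (v : Module.Basis ι ℝ E) : dualVector v 0 = 0 := by
  simpa using dualVector_sub v 0 0

lemma mFourier_torusProj (v : Module.Basis ι ℝ E) (m : ι → ℤ) (x : E) :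
    mFourier m (torusProj v x) =
      Complex.exp (((2 * Real.pi * inner ℝ (dualVector v m) x : ℝ) : ℂ) * Complex.I) := by
  simp only [mFourier, ContinuousMap.coe_mk, torusProj, fourier_coe_apply, ← Complex.exp_sum,
    inner_dualVector]
  congr 1
  push_cast
  rw [Finset.mul_sum, Finset.sum_mul]
  exact Finset.sum_congr rfl fun i _ => by ring

variable [MeasurableSpace E] [BorelSpace E]

lemma norm_integral_mFourier_torusProj (v : Module.Basis ι ℝ E) (m : ι → ℤ) (y : E) (σ : ℝ) :
    ‖∫ x, mFourier m (torusProj v (y + σ • x)) ∂stdGaussian E‖ =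
      Real.exp (-(‖(2 * Real.pi * σ) • dualVector v m‖ ^ 2 / 2)) := by
  have h : ∀ x, mFourier m (torusProj v (y + σ • x)) =
      mFourier m (torusProj v y) *
        Complex.exp (inner ℝ x ((2 * Real.pi * σ) • dualVector v m) * Complex.I) := fun x => by
    rw [mFourier_torusProj, mFourier_torusProj, ← Complex.exp_add, inner_add_right,
      inner_smul_right, inner_smul_right, real_inner_comm x]
    congr 1
    push_cast
    ring
  simp_rw [h]
  rw [integral_const_mul, ← charFun_apply, charFun_stdGaussian, norm_mul, norm_mFourier_apply,
    one_mul, Complex.norm_exp]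
  congr 1
  rw [← Complex.ofReal_pow]
  norm_cast
  ring

/-- Disjoint translates of a symmetric set bound Gaussian sums over the dual lattice. -/
lemma sum_exp_dualVector_le (v : Module.Basis ι ℝ E) (U : Finset E) (hsymm : ∀ u ∈ U, -u ∈ U)
    {b : ℝ} (hb : 0 < b)
    (hUb : (stdGaussian E).real {x | ∃ u ∈ U, b ≤ inner ℝ u x} ≤ 1 / 8)
    (hw : ∀ m : ι → ℤ, m ≠ 0 → ∃ u ∈ U, 1 / 4 ≤ inner ℝ u (dualVector v m))
    {c : ℝ} (hc : 8 * b ≤ c) (F : Finset (ι → ℤ)) (hF : 0 ∉ F) :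
    ∑ m ∈ F, Real.exp (-(‖c • dualVector v m‖ ^ 2 / 2)) ≤ 1 / 7 := by
  classical
  set A : Set E := {x | ∃ u ∈ U, b ≤ inner ℝ u x}ᶜ with hA
  have hmem : ∀ x, x ∈ A ↔ ∀ u ∈ U, inner ℝ u x < b := fun x => by simp [hA]
  have hAm : MeasurableSet A := by
    have : {x : E | ∃ u ∈ U, b ≤ inner ℝ u x} = ⋃ u ∈ U, {x : E | b ≤ inner ℝ u x} := by
      ext x; simp
    rw [hA, this]
    exact (Finset.measurableSet_biUnion _ fun u _ =>
      measurableSet_le measurable_const (by fun_prop)).compl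
  have hAs : ∀ x, x ∈ A → -x ∈ A := fun x hx => (hmem _).2 fun u hu => by
    have := (hmem x).1 hx _ (hsymm u hu)
    rwa [inner_neg_left, ← inner_neg_right] at this
  have hA78 : 7 / 8 ≤ (stdGaussian E).real A := by
    rw [hA, probReal_compl_eq_one_sub₀ (by simpa [hA] using hAm.compl.nullMeasurableSet)]
    linarith
  have hdisj : ((insert 0 F : Finset (ι → ℤ)) : Set (ι → ℤ)).PairwiseDisjoint
      fun m => {x | x - c • dualVector v m ∈ A} := by
    intro m _ k _ hmk
    refine Set.disjoint_left.2 fun x hxm hxk => ?_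
    obtain ⟨u, hu, h⟩ := hw (m - k) (sub_ne_zero.2 hmk)
    have h1 := (hmem _).1 hxm _ (hsymm u hu)
    have h2 := (hmem _).1 hxk u hu
    rw [dualVector_sub, inner_sub_right] at h
    rw [inner_neg_left, inner_sub_right, inner_smul_right] at h1
    rw [inner_sub_right, inner_smul_right] at h2
    nlinarith
  have hm : ∀ m ∈ insert 0 F, MeasurableSet {x | x - c • dualVector v m ∈ A} := fun m _ =>
    (measurable_id.sub_const _) hAm
  have hle : ∑ m ∈ insert 0 F, Real.exp (-(‖c • dualVector v m‖ ^ 2 / 2)) *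
      (stdGaussian E).real A ≤ 1 := by
    refine (Finset.sum_le_sum fun m _ => exp_mul_stdGaussian_le_translate hAm hAs _).trans ?_
    rw [← measureReal_biUnion_finset hdisj hm]
    exact measureReal_le_one
  rw [← Finset.sum_mul, Finset.sum_insert hF, dualVector_zero] at hle
  have hS : 0 ≤ ∑ m ∈ F, Real.exp (-(‖c • dualVector v m‖ ^ 2 / 2)) :=
    Finset.sum_nonneg fun _ _ => (Real.exp_pos _).le
  simp only [smul_zero, norm_zero, ne_eq, OfNat.ofNat_ne_zero, not_false_eq_true, zero_pow,
    zero_div, neg_zero, Real.exp_zero] at hle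
  nlinarith

lemma abs_integral_torusProj_sub_le (v : Module.Basis ι ℝ E) {δ σ : ℝ}
    (h : ∀ F : Finset (ι → ℤ), 0 ∉ F →
      ∑ m ∈ F, Real.exp (-(‖(2 * Real.pi * σ) • dualVector v m‖ ^ 2 / 2)) ≤ δ)
    (f : C(UnitAddTorus ι, ℝ)) (hf : ∀ t, 0 ≤ f t) (y : E) :
    |∫ x, f (torusProj v (y + σ • x)) ∂stdGaussian E - ∫ t, f t ∂torusHaar ι| ≤
      δ * ∫ t, f t ∂torusHaar ι := by
  have hφ : Continuous fun x => torusProj v (y + σ • x) :=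
    (continuous_torusProj v).comp (by fun_prop)
  set ρ := (stdGaussian E).map fun x => torusProj v (y + σ • x) with hρ
  have : IsProbabilityMeasure ρ := Measure.isProbabilityMeasure_map hφ.aemeasurable
  have hmap : ∀ g : C(UnitAddTorus ι, ℂ),
      ∫ t, g t ∂ρ = ∫ x, g (torusProj v (y + σ • x)) ∂stdGaussian E := fun g =>
    integral_map hφ.aemeasurable g.continuous.aestronglyMeasurable
  have key := norm_integral_sub_integral_torusHaar_le ρ (δ := δ) (fun F hF => by
    simp_rw [hmap, norm_integral_mFourier_torusProj]
    exact h F hF) ((⟨Complex.ofReal, Complex.continuous_ofReal⟩ : C(ℝ, ℂ)).comp f)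
  rw [hmap] at key
  simp only [ContinuousMap.comp_apply, ContinuousMap.coe_mk, integral_complex_ofReal,
    ← Complex.ofReal_sub, Complex.norm_real, Real.norm_eq_abs, abs_of_nonneg (hf _)] at key
  exact key

lemma integral_prod_le_of_eq_zero {X : Type*} [MeasurableSpace X] {ν : Measure X}
    [IsProbabilityMeasure ν] {h : X × X → ℝ} (hInt : Integrable h (ν.prod ν))
    (h0 : ∀ z, 0 ≤ h z) {T : Set X} (hT : MeasurableSet T) {ε a : ℝ} (hε : ν.real T ≤ ε)
    (ha : 0 ≤ a) (h1 : ∀ z, ∫ w, h (z, w) ∂ν ≤ a) (h2 : ∀ z, ∫ w, h (w, z) ∂ν ≤ a)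
    (hout : ∀ z : X × X, z.1 ∉ T → z.2 ∉ T → h z = 0) :
    ∫ z, h z ∂(ν.prod ν) ≤ 2 * (ε * a) := by
  have hpt : ∀ z, h z ≤ (T ×ˢ univ).indicator h z + (univ ×ˢ T).indicator h z := fun z => by
    have hn : ∀ S : Set (X × X), 0 ≤ S.indicator h z := fun S =>
      indicator_nonneg (fun z _ => h0 z) z
    by_cases h1 : z.1 ∈ T
    · rw [indicator_of_mem (s := T ×ˢ univ) (by simp [h1])]
      exact le_add_of_nonneg_right (hn _)
    by_cases h2 : z.2 ∈ T
    · rw [indicator_of_mem (s := univ ×ˢ T) (by simp [h2])]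
      exact le_add_of_nonneg_left (hn _)
    rw [hout z h1 h2]
    exact add_nonneg (hn _) (hn _)
  have hbound : ∀ g : X → X → ℝ, (∀ z, ∫ w, g z w ∂ν ≤ a) → (∀ z w, 0 ≤ g z w) →
      ∫ z, ∫ w, T.indicator (fun z => g z w) z ∂ν ∂ν ≤ ε * a := fun g hg hg0 => by
    have hle : ∀ z, ∫ w, T.indicator (fun z => g z w) z ∂ν ≤ T.indicator (fun _ => a) z :=
      fun z => by
        by_cases hz : z ∈ T
        · simpa [hz] using hg z
        · simp [hz]
    refine (integral_mono_of_nonneg (ae_of_all _ fun z => integral_nonneg fun w =>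
      indicator_nonneg (fun z _ => hg0 z w) z) ((integrable_const a).indicator hT)
      (ae_of_all _ hle)).trans ?_
    rw [integral_indicator_const _ hT, smul_eq_mul]
    gcongr
  have hi1 := hInt.indicator (hT.prod MeasurableSet.univ)
  have hi2 := hInt.indicator (MeasurableSet.univ.prod hT)
  have hb1 : ∫ z, (T ×ˢ univ).indicator h z ∂(ν.prod ν) ≤ ε * a := by
    rw [integral_prod _ hi1]
    refine le_of_eq_of_le ?_ (hbound (fun z w => h (z, w)) h1 fun _ _ => h0 _)
    refine integral_congr_ae (ae_of_all _ fun z => integral_congr_ae (ae_of_all _ fun w => ?_))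
    by_cases hz : z ∈ T <;> simp [hz]
  have hb2 : ∫ z, (univ ×ˢ T).indicator h z ∂(ν.prod ν) ≤ ε * a := by
    rw [integral_prod_symm _ hi2]
    refine le_of_eq_of_le ?_ (hbound (fun z w => h (w, z)) h2 fun _ _ => h0 _)
    refine integral_congr_ae (ae_of_all _ fun z => integral_congr_ae (ae_of_all _ fun w => ?_))
    by_cases hz : z ∈ T <;> simp [hz]
  have := integral_mono hInt (hi1.add hi2) hpt
  rw [integral_add' hi1 hi2] at this
  linarith

/-- If `p` is small and all dual lattice vectors are large in terms of the Gaussian measure, then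
the lattice translates of `{p < 1}` meet every large ball of `p`. -/
lemma exists_near_lattice (v : Module.Basis ι ℝ E) {p : Seminorm ℝ E} (hp : Continuous p)
    (hp8 : (stdGaussian E).real {x | 8 ≤ p x} ≤ 1 / 8)
    (U : Finset E) (hsymm : ∀ u ∈ U, -u ∈ U) {b : ℝ} (hb : 0 < b)
    (hUb : (stdGaussian E).real {x | ∃ u ∈ U, b ≤ inner ℝ u x} ≤ 1 / 8)
    (hw : ∀ m : ι → ℤ, m ≠ 0 → ∃ u ∈ U, 1 / 4 ≤ inner ℝ u (dualVector v m))
    (x : E) {σ lam : ℝ} (hσ : 8 * b ≤ 2 * Real.pi * σ) (hlam : 16 * σ ≤ lam) :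
    ∃ (y : E) (z : ι → ℤ), p (y - x) < lam ∧ p (y - ∑ i, (z i : ℝ) • v i) < 1 := by
  by_contra! hno
  have hσ0 : 0 < σ := by
    have := Real.pi_pos
    by_contra! h
    nlinarith
  set W : Set (UnitAddTorus ι) := torusProj v '' {y | p y < 1} with hW
  have hWo : IsOpen W := isOpenMap_torusProj v _ (isOpen_lt hp continuous_const)
  have hW0 : torusProj v 0 ∈ W := ⟨0, by simp, rfl⟩
  obtain ⟨r, hr, hrW⟩ := Metric.isOpen_iff.1 hWo _ hW0
  let f : C(UnitAddTorus ι, ℝ) := ⟨fun t => max 0 (r - dist t (torusProj v 0)), by fun_prop⟩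
  have hf0 : ∀ t, 0 ≤ f t := fun t => le_max_left _ _
  have hfW : ∀ t, t ∉ W → f t = 0 := fun t ht => by
    refine max_eq_left (sub_nonpos.2 ?_)
    by_contra! h
    exact ht (hrW h)
  set u := ∫ t, f t ∂torusHaar ι with hu
  have hu0 : 0 < u := by
    refine f.continuous.integral_pos_of_hasCompactSupport_nonneg_nonzero
      (HasCompactSupport.of_compactSpace _) hf0 (x := torusProj v 0) ?_
    change max 0 (r - dist _ _) ≠ 0
    rw [dist_self, sub_zero, max_eq_right hr.le]
    exact hr.ne'
  have hclose : ∀ s, 8 * b ≤ 2 * Real.pi * s → ∀ y,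
      |∫ x, f (torusProj v (y + s • x)) ∂stdGaussian E - u| ≤ 1 / 7 * u := fun s hs y =>
    abs_integral_torusProj_sub_le v (sum_exp_dualVector_le v U hsymm hb hUb hw hs) f hf0 y
  have hzero : ∀ y, p (y - x) < lam → f (torusProj v y) = 0 := fun y hy => by
    refine hfW _ ?_
    rintro ⟨a, ha, hay⟩
    obtain ⟨z, hz⟩ := exists_eq_sub_of_torusProj_eq v hay
    have := hno y z hy
    rw [← hz] at this
    exact absurd ha (not_lt.2 this)
  set T : Set E := {z | 8 ≤ p z} with hT
  have hTm : MeasurableSet T := (isClosed_le continuous_const hp).measurableSet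
  set h : E × E → ℝ := fun z => f (torusProj v (x + σ • z.1 + σ • z.2)) with hh
  have hhc : Continuous h := f.continuous.comp ((continuous_torusProj v).comp (by fun_prop))
  have hInt : Integrable h ((stdGaussian E).prod (stdGaussian E)) :=
    Integrable.of_bound hhc.aestronglyMeasurable ‖f‖ (ae_of_all _ fun z => f.norm_coe_le_norm _)
  have hlow : 6 / 7 * u ≤ ∫ z, h z ∂((stdGaussian E).prod (stdGaussian E)) := by
    have h2 : (√2)⁻¹ ^ 2 + (√2)⁻¹ ^ 2 = (1 : ℝ) := by
      rw [inv_pow, Real.sq_sqrt (by norm_num)]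
      norm_num
    have hrot : ∫ z, h z ∂((stdGaussian E).prod (stdGaussian E)) =
        ∫ y, f (torusProj v (x + (√2 * σ) • y)) ∂stdGaussian E := by
      conv_rhs => rw [← stdGaussian_prod_map_rotation (E := E) h2]
      have hc : Continuous fun y => f (torusProj v (x + (√2 * σ) • y)) :=
        f.continuous.comp ((continuous_torusProj v).comp (by fun_prop))
      rw [integral_map (φ := fun z : E × E => (√2)⁻¹ • z.1 + (√2)⁻¹ • z.2) (by fun_prop)
        hc.aestronglyMeasurable]
      refine integral_congr_ae (ae_of_all _ fun z => ?_)
      have : √2 * σ * (√2)⁻¹ = σ := by field_simp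
      simp only [hh, smul_add, smul_smul, this, add_assoc]
    have hs : 8 * b ≤ 2 * Real.pi * (√2 * σ) := by
      refine hσ.trans ?_
      have : 1 ≤ √2 := Real.one_le_sqrt.2 (by norm_num)
      gcongr
      nlinarith
    have := abs_le.1 (hclose _ hs x)
    rw [hrot]
    linarith
  have hup : ∀ y, ∫ w, f (torusProj v (y + σ • w)) ∂stdGaussian E ≤ 8 / 7 * u := fun y => by
    have := abs_le.1 (hclose _ hσ y)
    linarith
  have hup2 : ∀ z, ∫ w, h (w, z) ∂stdGaussian E ≤ 8 / 7 * u := fun z => by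
    refine le_of_eq_of_le ?_ (hup (x + σ • z))
    simp only [hh, add_right_comm]
  have hout : ∀ z : E × E, z.1 ∉ T → z.2 ∉ T → h z = 0 := fun z h1 h2 => hzero _ (by
    simp only [hT, Set.mem_ofPred_eq, not_le] at h1 h2
    have e : x + σ • z.1 + σ • z.2 - x = σ • (z.1 + z.2) := by rw [smul_add]; abel
    rw [e, map_smul_eq_mul, Real.norm_eq_abs, abs_of_pos hσ0]
    have := map_add_le_add p z.1 z.2
    nlinarith)
  have := integral_prod_le_of_eq_zero hInt (fun z => hf0 _) hTm hp8 (by positivity)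
    (fun z => hup (x + σ • z)) hup2 hout
  linarith

end Transference

section Assembly
open ProbabilityTheory

lemma isCompact_seminorm_closedUnitBall {E : Type*} [NormedAddCommGroup E] [NormedSpace ℝ E]
    [FiniteDimensional ℝ E] {p : Seminorm ℝ E} (hp : Continuous p) {c : ℝ} (hc : 0 < c)
    (hpc : ∀ x, c * ‖x‖ ≤ p x) : IsCompact {x | p x ≤ 1} := by
  have : ProperSpace E := FiniteDimensional.proper ℝ E
  refine (isCompact_closedBall (0 : E) c⁻¹).of_isClosed_subset
    (isClosed_le hp continuous_const) fun x hx => ?_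
  rw [mem_closedBall_zero_iff, ← one_div, le_div_iff₀' hc]
  exact (hpc x).trans hx

/-- A finite symmetric `1/2`-net of the unit ball of a norm supports every linear functional up to
a factor of two. -/
lemma exists_finset_half_support {E : Type*} [NormedAddCommGroup E] [InnerProductSpace ℝ E]
    {p : Seminorm ℝ E} (hp : Continuous p) (hK : IsCompact {x | p x ≤ 1}) :
    ∃ U : Finset E, U.Nonempty ∧ (∀ u ∈ U, -u ∈ U) ∧ (∀ u ∈ U, p u ≤ 1) ∧
      ∀ k w : E, p k ≤ 1 → ∃ u ∈ U, inner ℝ k w / 2 ≤ inner ℝ u w := by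
  classical
  obtain ⟨t, ht, hcov⟩ := hK.elim_nhds_subcover (fun u => {y | p (y - u) < 1 / 2}) fun u _ =>
    (isOpen_lt (by fun_prop) continuous_const).mem_nhds (by simp)
  have h0 : (0 : E) ∈ {x | p x ≤ 1} := by simp
  refine ⟨t ∪ t.image Neg.neg, ?_, ?_, ?_, fun k w hk => ?_⟩
  · obtain ⟨u, hu, -⟩ := mem_iUnion₂.1 (hcov h0)
    exact ⟨u, Finset.mem_union_left _ hu⟩
  · intro u hu
    rcases Finset.mem_union.1 hu with h | h
    · exact Finset.mem_union_right _ (Finset.mem_image_of_mem _ h)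
    · obtain ⟨u', hu', rfl⟩ := Finset.mem_image.1 h
      rw [neg_neg]
      exact Finset.mem_union_left _ hu'
  · intro u hu
    rcases Finset.mem_union.1 hu with h | h
    · exact ht u h
    · obtain ⟨u', hu', rfl⟩ := Finset.mem_image.1 h
      rw [map_neg_eq_map]
      exact ht u' hu'
  · obtain ⟨k₀, hk₀, hmax⟩ := hK.exists_isMaxOn ⟨0, h0⟩
      (f := fun y => (inner ℝ y w : ℝ)) (by fun_prop)
    obtain ⟨u, hu, hku⟩ := mem_iUnion₂.1 (hcov hk₀)
    refine ⟨u, Finset.mem_union_left _ hu, ?_⟩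
    have h1 : inner ℝ ((2 : ℝ) • (k₀ - u)) w ≤ (inner ℝ k₀ w : ℝ) := hmax (by
      have : p (k₀ - u) < 1 / 2 := hku
      simp only [Set.mem_ofPred_eq, map_smul_eq_mul, Real.norm_ofNat]
      linarith)
    have h2 : inner ℝ k w ≤ (inner ℝ k₀ w : ℝ) := hmax hk
    rw [inner_smul_left, inner_sub_left] at h1
    simp only [conj_trivial] at h1
    linarith

lemma inner_dualVector_map {E ι : Type*} [NormedAddCommGroup E] [InnerProductSpace ℝ E]
    [FiniteDimensional ℝ E] [Fintype ι] (v : Module.Basis ι ℝ E) (A : E ≃L[ℝ] E) (m : ι → ℤ)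
    (x : E) :
    inner ℝ x (dualVector (v.map A.symm.toLinearEquiv) m) = inner ℝ (A x) (dualVector v m) := by
  rw [real_inner_comm, inner_dualVector, real_inner_comm, inner_dualVector]
  simp

/-- Covering bound for lattices in terms of the lattice width of a norm. -/
lemma exists_transference_constant : ∃ C : ℝ, 0 < C ∧ ∀ d : ℕ, 1 ≤ d →
    ∀ p : Seminorm ℝ (EuclideanSpace ℝ (Fin d)), Continuous p →
    ∀ c : ℝ, 0 < c → (∀ x, c * ‖x‖ ≤ p x) →
    ∀ v : Module.Basis (Fin d) ℝ (EuclideanSpace ℝ (Fin d)),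
    (∀ m : Fin d → ℤ, m ≠ 0 → ∃ k, p k ≤ 1 ∧ 1 / 2 ≤ inner ℝ k (dualVector v m)) →
    ∀ x lam, C * d * (1 + Real.log d) ≤ lam →
    ∃ (y : EuclideanSpace ℝ (Fin d)) (z : Fin d → ℤ),
      p (y - x) < lam ∧ p (y - ∑ i, (z i : ℝ) • v i) < 1 := by
  obtain ⟨C, hC, hdeg⟩ := exists_quadrature_degree
  refine ⟨1024 * C, by positivity, fun d hd p hp c hc hpc v hv x lam hlam => ?_⟩
  obtain ⟨m, hm, hmd, hmB⟩ := hdeg d hd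
  have hd' : (1 : ℝ) ≤ d := by exact_mod_cast hd
  have hlog := Real.log_nonneg hd'
  set B := C * d * (1 + Real.log d) with hB
  have hBpos : 0 < B := by positivity
  have hfin : Module.finrank ℝ (EuclideanSpace ℝ (Fin d)) = d := finrank_euclideanSpace_fin
  obtain ⟨A, hA1, hAtr⟩ := exists_lewis_position hp hc hpc (by rw [hfin]; exact hd)
  set q : Seminorm ℝ (EuclideanSpace ℝ (Fin d)) := p.comp A.toLinearEquiv.toLinearMap with hq
  have hqA : ∀ x, q x = p (A x) := fun x => rfl
  have hqc : Continuous q := hp.comp A.continuous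
  have hK : IsCompact {x | q x ≤ 1} :=
    A.toHomeomorph.isCompact_preimage.2 (isCompact_seminorm_closedUnitBall hp hc hpc)
  obtain ⟨U, hUne, hUsymm, hUq, hUw⟩ := exists_finset_half_support hqc hK
  have hInt : ∀ φ : EuclideanSpace ℝ (Fin d) → EuclideanSpace ℝ (Fin d), Measurable φ →
      (∀ x, q (φ x) ≤ 1) → ∫ x, inner ℝ (φ x) x ∂stdGaussian _ ≤ B := fun φ hφ hφq => by
    have := integral_inner_le_of_trace_le hqc hA1 hAtr hm (by rw [hfin]; exact hmd) hφ hφq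
    rw [hfin] at this
    exact this.trans hmB
  obtain ⟨y, z, hyx, hyz⟩ := exists_near_lattice (v.map A.symm.toLinearEquiv) hqc
    (measureReal_seminorm_ge_le hqc hA1) U hUsymm (b := 8 * B) (by positivity)
    (measureReal_exists_inner_ge_le hBpos hInt U hUne hUsymm hUq)
    (fun m hm => by
      obtain ⟨k, hk, hkm⟩ := hv m hm
      obtain ⟨u, hu, huk⟩ := hUw (A.symm k) (dualVector (v.map A.symm.toLinearEquiv) m)
        (by rw [hqA, A.apply_symm_apply]; exact hk)
      refine ⟨u, hu, le_trans ?_ huk⟩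
      rw [inner_dualVector_map, A.apply_symm_apply]
      linarith)
    (A.symm x) (σ := 64 * B) (lam := lam) (by nlinarith [Real.pi_gt_three])
    (by rw [hB]; linarith)
  refine ⟨A y, z, ?_, ?_⟩
  · rwa [hqA, map_sub, A.apply_symm_apply] at hyx
  · rw [hqA, map_sub, map_sum] at hyz
    simpa using hyz

lemma exists_half_le_inner_dualVector {E ι : Type*} [NormedAddCommGroup E]
    [InnerProductSpace ℝ E] [FiniteDimensional ℝ E] [Fintype ι] (v : Module.Basis ι ℝ E)
    {K : Set E} (hKs : K = -K)
    (hns : ∀ u : E, u ≠ 0 → ∀ c : ℝ, ({x : E | inner ℝ x u = c} ∩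
      ((range fun z : ι → ℤ => ∑ i, (z i : ℝ) • v i) + K)).Nonempty)
    {m : ι → ℤ} (hm : m ≠ 0) : ∃ k ∈ K, 1 / 2 ≤ inner ℝ k (dualVector v m) := by
  classical
  have hw : dualVector v m ≠ 0 := by
    obtain ⟨i, hi⟩ := Function.ne_iff.1 hm
    intro h
    have := inner_dualVector v m (v i)
    rw [h, inner_zero_left] at this
    refine hi ((Int.cast_eq_zero (α := ℝ)).1 ?_)
    simpa [Finsupp.single_apply] using this.symm
  obtain ⟨_, hx, _, ⟨z, rfl⟩, k, hk, rfl⟩ := hns _ hw (1 / 2)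
  have hN : inner ℝ (∑ i, (z i : ℝ) • v i) (dualVector v m) =
      ((∑ i, m i * z i : ℤ) : ℝ) := by
    rw [real_inner_comm, inner_dualVector]
    push_cast
    refine Finset.sum_congr rfl fun i _ => ?_
    congr 1
    simp [Finsupp.single_apply]
  have hx' : inner ℝ (∑ i, (z i : ℝ) • v i) (dualVector v m) + inner ℝ k (dualVector v m) =
      (1 / 2 : ℝ) := by
    rw [← inner_add_left]
    exact hx
  rw [hN] at hx'
  rcases le_or_gt (∑ i, m i * z i) 0 with h | h
  · refine ⟨k, hk, ?_⟩
    have : ((∑ i, m i * z i : ℤ) : ℝ) ≤ 0 := by exact_mod_cast h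
    linarith
  · refine ⟨-k, by rw [hKs]; simpa using hk, ?_⟩
    have : (1 : ℝ) ≤ ((∑ i, m i * z i : ℤ) : ℝ) := by exact_mod_cast h
    rw [inner_neg_left]
    linarith

lemma mem_nhds_zero_of_symmetric {E : Type*} [NormedAddCommGroup E] [NormedSpace ℝ E] {K : Set E}
    (hK : Convex ℝ K) (hKi : (interior K).Nonempty) (hKs : K = -K) : K ∈ nhds 0 := by
  obtain ⟨a, ha⟩ := hKi
  have hna : -a ∈ interior K := by
    have h : interior (-K) = -interior K := ((Homeomorph.neg E).preimage_interior K).symm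
    rw [hKs, h]
    simpa using ha
  rw [← mem_interior_iff_mem_nhds]
  have := hK.interior ha hna (a := 1 / 2) (b := 1 / 2) (by norm_num) (by norm_num) (by norm_num)
  simpa using this

end Assembly

/-- upper bound for the tightness of non-separable lattice
arrangements of o-symmetric convex bodies. -/
theorem stmt_2 :
    ∃ C : ℝ, 0 < C ∧ ∀ d : ℕ, 2 ≤ d →
      ∀ K : Set (Euc d), IsConvexBody K → K = -K →
      ∀ L : Set (Euc d), IsFullLattice L →
      (∀ H : Set (Euc d), IsHyperplane H → (H ∩ (L + K)).Nonempty) →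
      ∀ (x : Euc d) (lam : ℝ), 0 < lam →
        interior (homo x lam K) ∩ (L + K) = ∅ →
        lam ≤ C * d * (1 + Real.log d) := by
  obtain ⟨C, hC, h⟩ := exists_transference_constant
  refine ⟨C, hC, fun d hd K hK hKs L hL hns x lam hlam hdisj => ?_⟩
  obtain ⟨hKc, hKconv, hKi⟩ := hK
  obtain ⟨b, rfl⟩ := hL
  by_contra! hlt
  have hK0 := mem_nhds_zero_of_symmetric hKconv hKi hKs
  have habs : Absorbent ℝ K := absorbent_nhds_zero hK0
  have hbal : Balanced ℝ K := (balanced_iff_neg_mem hKconv).2 fun y hy => by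
    rw [hKs]
    simpa using hy
  let p : Seminorm ℝ (Euc d) := gaugeSeminorm hbal hKconv habs
  have hp : ∀ y, p y = gauge K y := fun y => rfl
  obtain ⟨R, hR⟩ := hKc.isBounded.subset_closedBall 0
  have hR' : K ⊆ closedBall 0 (max R 1) := hR.trans (closedBall_subset_closedBall (le_max_left _ _))
  have hR0 : 0 < max R 1 := lt_max_of_lt_right one_pos
  obtain ⟨y, z, hyx, hyz⟩ := h d (by omega) p (continuous_gauge hKconv hK0) (max R 1)⁻¹
    (inv_pos.2 hR0)
    (fun y => by
      rw [hp, inv_mul_eq_div]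
      exact le_gauge_of_subset_closedBall habs hR0.le hR') b
    (fun m hm => by
      obtain ⟨k, hk, hkm⟩ := exists_half_le_inner_dualVector b hKs
        (fun u hu c => hns _ ⟨u, hu, c, rfl⟩) hm
      exact ⟨k, gauge_le_one_of_mem hk, hkm⟩) x lam hlt.le
  refine eq_empty_iff_forall_notMem.1 hdisj y ⟨?_, ?_⟩
  · have hopen : IsOpen {y | p (y - x) < lam} :=
      isOpen_lt ((continuous_gauge hKconv hK0).comp (continuous_id.sub continuous_const))
        continuous_const
    refine interior_maximal (fun y hy => ?_) hopen hyx
    refine ⟨x, rfl, y - x, ?_, add_sub_cancel _ _⟩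
    rw [Set.mem_smul_set_iff_inv_smul_mem₀ hlam.ne']
    refine interior_subset ((gauge_lt_one_iff_mem_interior hKconv hK0).1 ?_)
    rw [← hp, map_smul_eq_mul, Real.norm_of_nonneg (inv_nonneg.2 hlam.le), inv_mul_lt_iff₀ hlam,
      mul_one]
    exact hy
  · refine ⟨_, ⟨z, rfl⟩, y - ∑ i, (z i : ℝ) • b i, ?_, add_sub_cancel _ _⟩
    exact interior_subset ((gauge_lt_one_iff_mem_interior hKconv hK0).1 hyz)

end
end

section
/- Let d ≥ 2 and let K = (1/2)·conv{±e₁, ±e₂, …, ±e_d} ⊂ ℝ^d be the cross-polytope scaled by one half, where e₁, …, e_d is the standard orthonormal basis. Then: (a) the lattice arrangement ℤ^d + K = ⋃_{z∈ℤ^d}(z + K) is non-separable, i.e., every hyperplane of ℝ^d intersects ℤ^d + K; and (b) with x = (1/2, 1/2, …, 1/2), the interior of x + (d−1)K is disjoint from ℤ^d + K. In particular, the tightness of this non-separable lattice arrangement is at least d − 1. -/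
open Set Metric Pointwise MeasureTheory

noncomputable section

variable {d : ℕ}

/-- The cross-polytope scaled by one half. -/
def crossPolyHalf (d : ℕ) : Set (Euc d) :=
  (1 / 2 : ℝ) • convexHull ℝ
    ((Set.range fun i : Fin d => EuclideanSpace.single i (1 : ℝ)) ∪
     (Set.range fun i : Fin d => -EuclideanSpace.single i (1 : ℝ)))

/-- Every point of the half cross-polytope has `ℓ¹`-norm at most `1 / 2`. -/
lemma sum_abs_le_of_mem_crossPolyHalf {n : ℕ} {k : Euc n} (hk : k ∈ crossPolyHalf n) :
    ∑ i, |k i| ≤ 1 / 2 := by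
  obtain ⟨w, hw, rfl⟩ := hk
  have hconv : Convex ℝ {w : Euc n | ∑ i, |w i| ≤ 1} := by
    intro a ha b hb s t hs ht hst
    simp only [mem_ofPred_eq] at ha hb ⊢
    calc ∑ i, |(s • a + t • b) i| ≤ ∑ i, (s * |a i| + t * |b i|) := by
          refine Finset.sum_le_sum fun i _ => ?_
          refine (abs_add_le _ _).trans (le_of_eq ?_)
          simp [abs_mul, abs_of_nonneg hs, abs_of_nonneg ht]
      _ = s * ∑ i, |a i| + t * ∑ i, |b i| := by
          rw [Finset.sum_add_distrib, Finset.mul_sum, Finset.mul_sum]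
      _ ≤ 1 := by nlinarith
  have hle : ∑ i, |w i| ≤ 1 := by
    refine convexHull_min ?_ hconv hw
    rintro _ (⟨j, rfl⟩ | ⟨j, rfl⟩) <;> simp [apply_ite abs]
  calc ∑ i, |((1 / 2 : ℝ) • w) i| = 1 / 2 * ∑ i, |w i| := by
        rw [Finset.mul_sum]
        simp [abs_mul]
    _ ≤ 1 / 2 := by linarith

/-- The half cross-polytope contains the segments `[-eᵢ / 2, eᵢ / 2]`. -/
lemma single_mem_crossPolyHalf {n : ℕ} (i : Fin n) {t : ℝ} (ht : |t| ≤ 1 / 2) :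
    EuclideanSpace.single i t ∈ crossPolyHalf n := by
  obtain ⟨h₁, h₂⟩ := abs_le.1 ht
  refine ⟨EuclideanSpace.single i (2 * t), ?_, ?_⟩
  · have hmem := (convex_convexHull ℝ
        ((Set.range fun i : Fin n => EuclideanSpace.single i (1 : ℝ)) ∪
          (Set.range fun i : Fin n => -EuclideanSpace.single i (1 : ℝ))))
      (subset_convexHull ℝ _ (Or.inl ⟨i, rfl⟩)) (subset_convexHull ℝ _ (Or.inr ⟨i, rfl⟩))
      (by linarith : (0 : ℝ) ≤ 1 / 2 + t) (by linarith : (0 : ℝ) ≤ 1 / 2 - t) (by ring)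
    convert hmem using 1
    ext j
    by_cases hj : j = i <;> simp [hj]
    ring
  · ext j
    by_cases hj : j = i <;> simp [hj]

/-- The coordinate axes are covered by the integer translates of the half cross-polytope. -/
lemma single_mem_intLattice_add_crossPolyHalf {n : ℕ} (i : Fin n) (r : ℝ) :
    EuclideanSpace.single i r ∈ intLattice n + crossPolyHalf n := by
  refine ⟨EuclideanSpace.single i (round r : ℝ), fun j => ?_, EuclideanSpace.single i (r - round r),
    single_mem_crossPolyHalf i (abs_sub_round r), ?_⟩
  · by_cases hj : j = i
    · exact ⟨round r, by simp [hj]⟩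
    · exact ⟨0, by simp [hj]⟩
  · ext j
    by_cases hj : j = i <;> simp [hj]

lemma half_le_abs_intCast_sub_half (z : ℤ) : (1 / 2 : ℝ) ≤ |(z : ℝ) - 1 / 2| := by
  rcases le_or_gt z 0 with hz | hz
  · have : (z : ℝ) ≤ 0 := by exact_mod_cast hz
    exact le_abs.2 (Or.inr (by linarith))
  · have : (1 : ℝ) ≤ z := by exact_mod_cast hz
    exact le_abs.2 (Or.inl (by linarith))

/-- Points of the arrangement are at `ℓ¹`-distance at least `(n - 1) / 2` from
`(1/2, …, 1/2)`. -/
lemma le_sum_abs_sub_half_of_mem {n : ℕ} {y : Euc n}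
    (hy : y ∈ intLattice n + crossPolyHalf n) :
    ((n : ℝ) - 1) / 2 ≤ ∑ i, |y i - 1 / 2| := by
  obtain ⟨z, hz, k, hk, rfl⟩ := hy
  have hsum := sum_abs_le_of_mem_crossPolyHalf hk
  have hle : ∑ i : Fin n, ((1 / 2 : ℝ) - |k i|) ≤ ∑ i, |(z + k) i - 1 / 2| := by
    refine Finset.sum_le_sum fun i _ => ?_
    obtain ⟨m, hm⟩ := hz i
    have h₁ := half_le_abs_intCast_sub_half m
    have h₂ := abs_sub_abs_le_abs_sub ((m : ℝ) - 1 / 2) (-k i)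
    rw [abs_neg] at h₂
    have h₃ : (z + k) i - 1 / 2 = (m : ℝ) - 1 / 2 - -k i := by
      rw [PiLp.add_apply, hm]
      ring
    rw [h₃]
    linarith
  rw [Finset.sum_sub_distrib] at hle
  simp only [Finset.sum_const, Finset.card_univ, Fintype.card_fin, nsmul_eq_mul] at hle
  linarith

lemma sum_abs_sub_le_of_mem_homo {n : ℕ} {x y : Euc n} {r : ℝ} (hr : 0 ≤ r)
    (hy : y ∈ homo x r (crossPolyHalf n)) : ∑ i, |y i - x i| ≤ r / 2 := by
  obtain ⟨_, rfl, _, ⟨k, hk, rfl⟩, rfl⟩ := hy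
  have hsum := sum_abs_le_of_mem_crossPolyHalf hk
  calc ∑ i, |(_ + r • k) i - _| = r * ∑ i, |k i| := by
        rw [Finset.mul_sum]
        simp [abs_mul, abs_of_nonneg hr]
    _ ≤ r / 2 := by nlinarith

lemma sum_abs_sub_lt_of_mem_interior_homo {n : ℕ} {x y : Euc n} {r : ℝ} (hr : 0 < r)
    (hy : y ∈ interior (homo x r (crossPolyHalf n))) : ∑ i, |y i - x i| < r / 2 := by
  have hcont : Continuous fun s : ℝ => x + s • (y - x) := by fun_prop
  have hnhds : ∀ᶠ s in nhds (1 : ℝ), x + s • (y - x) ∈ interior (homo x r (crossPolyHalf n)) :=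
    hcont.continuousAt.eventually_mem (isOpen_interior.mem_nhds (by simpa using hy))
  obtain ⟨s, hs, hs1⟩ := ((hnhds.filter_mono nhdsWithin_le_nhds).and
    (self_mem_nhdsWithin : Set.Ioi (1 : ℝ) ∈ nhdsWithin 1 (Set.Ioi 1))).exists
  have hs1 : 1 < s := hs1
  have hle := sum_abs_sub_le_of_mem_homo hr.le (interior_subset hs)
  have heq : ∑ i, |(x + s • (y - x)) i - x i| = s * ∑ i, |y i - x i| := by
    rw [Finset.mul_sum]
    simp [abs_mul, abs_of_pos (zero_lt_one.trans hs1)]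
  rw [heq] at hle
  by_contra! hge
  nlinarith

/-- the integer lattice arrangement of the half cross-polytope is
non-separable, yet the copy of homothety ratio `d - 1` centered at
`(1/2, …, 1/2)` does not overlap it. -/
theorem stmt_3 (d : ℕ) (hd : 2 ≤ d) :
    (∀ H : Set (Euc d), IsHyperplane H →
      (H ∩ (intLattice d + crossPolyHalf d)).Nonempty) ∧
    interior (homo ((EuclideanSpace.equiv (Fin d) ℝ).symm fun _ => (1 / 2 : ℝ))
        ((d : ℝ) - 1) (crossPolyHalf d)) ∩ (intLattice d + crossPolyHalf d) = ∅ := by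
  refine ⟨?_, ?_⟩
  · rintro _ ⟨u, hu, c, rfl⟩
    obtain ⟨i, hi⟩ : ∃ i, u i ≠ 0 := by
      by_contra! h
      exact hu (by ext i; simpa using h i)
    refine ⟨EuclideanSpace.single i (c / u i), ?_, single_mem_intLattice_add_crossPolyHalf i _⟩
    simp [EuclideanSpace.inner_single_left, hi]
  · have hd' : (2 : ℝ) ≤ d := by exact_mod_cast hd
    refine Set.eq_empty_iff_forall_notMem.2 fun y ⟨hint, hmem⟩ => ?_
    have hlt := sum_abs_sub_lt_of_mem_interior_homo (by linarith) hint
    exact absurd (le_sum_abs_sub_half_of_mem hmem) (not_le.2 hlt)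

end
end

section
/- Let d ≥ 2 and n ≥ 2, let P₀ be an o-symmetric d-polytope in ℝ^d, and let 𝒫 = {xᵢ + τᵢP₀ : xᵢ ∈ ℝ^d, τᵢ > 0, i = 1, …, n} be a weakly non-separable family of positive homothets of P₀. Then, with x̄ = (Σᵢ₌₁ⁿ τᵢxᵢ)/(Σᵢ₌₁ⁿ τᵢ), the homothetic copy x̄ + (Σᵢ₌₁ⁿ τᵢ)P₀ contains ⋃𝒫. In particular, some translate of (Σᵢ₌₁ⁿ τᵢ)P₀ covers ⋃𝒫. -/
open Set Metric Pointwise MeasureTheory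

noncomputable section

variable {d : ℕ}

/-- If `(a i + ρ i, b]` is covered by the intervals of centers `a j` and radii `ρ j`, then its
length is at most the total length of those intervals whose right endpoint lies strictly beyond
that of the `i`-th one. -/
theorem sub_le_sum_of_Ioc_covered {ι : Type*} [Fintype ι] {a ρ : ι → ℝ} (hρ : ∀ i, 0 ≤ ρ i)
    {b : ℝ} (i : ι)
    (hcov : ∀ t ∈ Ioc (a i + ρ i) b, ∃ j, t ∈ Icc (a j - ρ j) (a j + ρ j)) :
    b - (a i + ρ i) ≤ ∑ j, if a i + ρ i < a j + ρ j then 2 * ρ j else 0 := by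
  classical
  rw [← Finset.sum_filter]
  set s := Finset.univ.filter fun j => a i + ρ i < a j + ρ j
  have hsub : Ioc (a i + ρ i) b ⊆ ⋃ j ∈ s, Icc (a j - ρ j) (a j + ρ j) := by
    intro t ht
    obtain ⟨j, hj⟩ := hcov t ht
    simp only [mem_iUnion]
    exact ⟨j, by simpa [s] using ht.1.trans_le hj.2, hj⟩
  have hvol : ENNReal.ofReal (b - (a i + ρ i)) ≤ ENNReal.ofReal (∑ j ∈ s, 2 * ρ j) := by
    rw [ENNReal.ofReal_sum_of_nonneg fun j _ => by have := hρ j; positivity, ← Real.volume_Ioc]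
    refine (measure_mono hsub).trans ((measure_biUnion_finset_le s _).trans_eq ?_)
    refine Finset.sum_congr rfl fun j _ => ?_
    rw [Real.volume_Icc]
    congr 1
    ring
  exact (ENNReal.ofReal_le_ofReal_iff
    (Finset.sum_nonneg fun j _ => by have := hρ j; positivity)).1 hvol

/-- The one-dimensional covering inequality: the weighted mean of the centers is within
the total radius of any point `b` up to which the intervals leave no gap. -/
theorem sum_mul_sub_le_of_Ioc_covered {ι : Type*} [Fintype ι] {a τ : ι → ℝ}
    (hτ : ∀ i, 0 ≤ τ i) {b c : ℝ} (hc : 0 ≤ c)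
    (hcov : ∀ i, ∀ t ∈ Ioc (a i + c * τ i) b, ∃ j, t ∈ Icc (a j - c * τ j) (a j + c * τ j)) :
    ∑ i, τ i * (b - a i) ≤ c * (∑ i, τ i) ^ 2 := by
  classical
  set r : ι → ℝ := fun i => a i + c * τ i with hr
  set g : ι → ι → ℝ := fun i j => (if i = j then 1 else 0) + (if r i < r j then 2 else 0) with hg
  have hgap : ∀ i, τ i * (b - a i) ≤ ∑ j, c * (τ i * τ j * g i j) := by
    intro i
    have h := sub_le_sum_of_Ioc_covered (a := a) (ρ := fun i => c * τ i)
      (fun i => mul_nonneg hc (hτ i)) i (hcov i)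
    have hsum : ∑ j, c * (τ i * τ j * g i j)
        = τ i * (c * τ i + ∑ j, if r i < r j then 2 * (c * τ j) else 0) := by
      rw [mul_add, Finset.mul_sum]
      have : τ i * (c * τ i) = ∑ j, if i = j then τ i * (c * τ j) else 0 := by simp
      rw [this, ← Finset.sum_add_distrib]
      refine Finset.sum_congr rfl fun j _ => ?_
      simp only [hg]
      split_ifs <;> ring
    rw [hsum]
    refine mul_le_mul_of_nonneg_left ?_ (hτ i)
    simp only [hr]
    linarith
  have hsymm : ∀ i j, g i j + g j i ≤ 2 := by
    intro i j
    simp only [hg]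
    rcases eq_or_ne i j with rfl | hij
    · norm_num
    · rw [if_neg hij, if_neg hij.symm]
      split_ifs <;> linarith
  have hswap : ∑ i, ∑ j, c * (τ i * τ j * g i j) = ∑ i, ∑ j, c * (τ i * τ j * g j i) := by
    rw [Finset.sum_comm]
    exact Finset.sum_congr rfl fun i _ => Finset.sum_congr rfl fun j _ => by ring
  have hdouble : ∑ i, ∑ j, c * (τ i * τ j * g i j) + ∑ i, ∑ j, c * (τ i * τ j * g j i)
      ≤ 2 * (c * (∑ i, τ i) ^ 2) := by
    rw [sq, Finset.sum_mul_sum, Finset.mul_sum, Finset.mul_sum, ← Finset.sum_add_distrib]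
    refine Finset.sum_le_sum fun i _ => ?_
    rw [Finset.mul_sum, Finset.mul_sum, ← Finset.sum_add_distrib]
    refine Finset.sum_le_sum fun j _ => ?_
    have := mul_le_mul_of_nonneg_left (hsymm i j)
      (mul_nonneg hc (mul_nonneg (hτ i) (hτ j)))
    linarith
  have := Finset.sum_le_sum fun i (_ : i ∈ Finset.univ) => hgap i
  linarith

/-- The polar of a set: all vectors `u` with `⟪s, u⟫ ≤ 1` on the set. -/
def polarBody (S : Set (Euc d)) : Set (Euc d) := {u | ∀ s ∈ S, inner ℝ s u ≤ 1}

theorem inner_le_of_mem_convexHull {S : Set (Euc d)} {u : Euc d} {c : ℝ}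
    (h : ∀ s ∈ S, inner ℝ s u ≤ c) {y : Euc d} (hy : y ∈ convexHull ℝ S) : inner ℝ y u ≤ c := by
  have hconv : Convex ℝ {y : Euc d | inner ℝ y u ≤ c} := by
    simp_rw [real_inner_comm u]
    exact convex_halfSpace_le (innerSL ℝ u).toLinearMap.isLinear c
  exact convexHull_min h hconv hy

theorem convex_polarBody (S : Set (Euc d)) : Convex ℝ (polarBody S) := by
  have : polarBody S = ⋂ s ∈ S, {u : Euc d | inner ℝ s u ≤ 1} := by
    ext; simp [polarBody]
  rw [this]
  exact convex_iInter₂ fun s _ => convex_halfSpace_le (innerSL ℝ s).toLinearMap.isLinear 1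

theorem isCompact_polarBody {S : Set (Euc d)} (h0 : 0 ∈ interior (convexHull ℝ S)) :
    IsCompact (polarBody S) := by
  have hclosed : IsClosed (polarBody S) := by
    have : polarBody S = ⋂ s ∈ S, {u : Euc d | inner ℝ s u ≤ 1} := by
      ext; simp [polarBody]
    rw [this]
    exact isClosed_biInter fun s _ => isClosed_le (by fun_prop) continuous_const
  obtain ⟨r, hr, hball⟩ := Metric.nhds_basis_closedBall.mem_iff.1 (mem_interior_iff_mem_nhds.1 h0)
  refine Metric.isCompact_of_isClosed_isBounded hclosed
    (Metric.isBounded_closedBall.subset (t := closedBall 0 (1 / r)) fun u hu => ?_)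
  rw [mem_closedBall_zero_iff]
  rcases eq_or_ne u 0 with rfl | hu0
  · simpa using hr.le
  have hnorm : 0 < ‖u‖ := norm_pos_iff.2 hu0
  have hmem : (r / ‖u‖) • u ∈ closedBall (0 : Euc d) r := by
    rw [mem_closedBall_zero_iff, norm_smul, Real.norm_of_nonneg (by positivity)]
    field_simp
    rfl
  have h := inner_le_of_mem_convexHull hu (hball hmem)
  rw [real_inner_smul_left, real_inner_self_eq_norm_sq] at h
  rw [le_div_iff₀ hr]
  calc ‖u‖ * r = r / ‖u‖ * ‖u‖ ^ 2 := by field_simp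
    _ ≤ 1 := h

/-- A point outside a polytope is cut off by a vertex of the polar. -/
theorem exists_extreme_polarBody_one_lt {S : Finset (Euc d)}
    (h0 : 0 ∈ interior (convexHull ℝ (S : Set (Euc d)))) {z : Euc d}
    (hz : z ∉ convexHull ℝ (S : Set (Euc d))) :
    ∃ u ∈ (polarBody (S : Set (Euc d))).extremePoints ℝ, 1 < inner ℝ z u := by
  obtain ⟨f, c, hf, hfz⟩ := geometric_hahn_banach_closed_point
    (convex_convexHull ℝ (S : Set (Euc d)))
    (S.finite_toSet.isClosed_convexHull (𝕜 := ℝ)) hz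
  have hc : 0 < c := by simpa using hf 0 (interior_subset h0)
  set w := (InnerProductSpace.toDual ℝ (Euc d)).symm f with hw
  have hfw : ∀ y, inner ℝ y w = f y := fun y => by
    rw [real_inner_comm, hw, InnerProductSpace.toDual_symm_apply]
  by_contra! hcon
  have hle : closure (convexHull ℝ ((polarBody (S : Set (Euc d))).extremePoints ℝ))
      ⊆ {u | inner ℝ z u ≤ 1} :=
    closure_minimal
      (convexHull_min hcon (convex_halfSpace_le (innerSL ℝ z).toLinearMap.isLinear 1))
      (isClosed_le (by fun_prop) continuous_const)
  rw [closure_convexHull_extremePoints (isCompact_polarBody h0) (convex_polarBody _)] at hle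
  have hmem : c⁻¹ • w ∈ polarBody (S : Set (Euc d)) := by
    intro s hs
    rw [real_inner_smul_right, hfw, inv_mul_le_iff₀ hc, mul_one]
    exact (hf s (subset_convexHull ℝ _ hs)).le
  have h := hle hmem
  rw [mem_ofPred_eq, real_inner_smul_right, hfw, inv_mul_le_iff₀ hc, mul_one] at h
  exact h.not_gt hfz

/-- The constraints active at a vertex of the polar span the whole space. -/
theorem span_active_eq_top_of_extreme_polarBody {S : Finset (Euc d)} {u : Euc d}
    (hu : u ∈ (polarBody (S : Set (Euc d))).extremePoints ℝ) :
    Submodule.span ℝ {s : Euc d | s ∈ S ∧ inner ℝ s u = 1} = ⊤ := by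
  set A : Set (Euc d) := {s : Euc d | s ∈ S ∧ inner ℝ s u = 1} with hA
  by_contra hne
  have hbot : (Submodule.span ℝ A)ᗮ ≠ ⊥ := fun h =>
    hne ((Submodule.orthogonal_eq_bot_iff).1 h)
  obtain ⟨w, hw, hw0⟩ := Submodule.exists_mem_ne_zero_of_ne_bot hbot
  have hAw : ∀ s ∈ A, inner ℝ s w = 0 := fun s hs =>
    (Submodule.mem_orthogonal _ _).1 hw s (Submodule.subset_span hs)
  have hev : ∀ᶠ ε : ℝ in nhds 0, ∀ s ∈ S, inner ℝ s (u + ε • w) ≤ 1 := by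
    rw [Filter.eventually_all_finset]
    intro s hs
    by_cases hsu : inner ℝ s u = 1
    · refine Filter.Eventually.of_forall fun ε => ?_
      rw [inner_add_right, real_inner_smul_right, hAw s ⟨hs, hsu⟩, hsu]
      simp
    · have hlt : inner ℝ s (u + (0 : ℝ) • w) < 1 := by
        simpa using lt_of_le_of_ne (hu.1 s hs) hsu
      have hcont : Continuous fun ε : ℝ => inner ℝ s (u + ε • w) := by fun_prop
      exact (hcont.continuousAt.eventually_lt continuousAt_const hlt).mono fun _ h => h.le
  obtain ⟨r, hr, hball⟩ := Metric.nhds_basis_closedBall.mem_iff.1 hev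
  have hplus : u + r • w ∈ polarBody (S : Set (Euc d)) := fun s hs =>
    hball (a := r) (by simp [abs_of_pos hr]) s hs
  have hminus : u + (-r) • w ∈ polarBody (S : Set (Euc d)) := fun s hs =>
    hball (a := -r) (by simp [abs_of_pos hr]) s hs
  have heq := hu.2 hplus hminus ⟨1 / 2, 1 / 2, by norm_num, by norm_num, by norm_num, by module⟩
  exact (smul_ne_zero hr.ne' hw0) (by simpa using heq)

/-- A point outside a polytope with the origin in its interior is cut off by a facet. -/
theorem exists_facetNormal_lt {P : Set (Euc d)} (hP : IsPolytope P) (h0 : 0 ∈ interior P)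
    {z : Euc d} (hz : z ∉ P) :
    ∃ (u : Euc d) (c : ℝ), IsFacetNormal P u ∧ 0 < c ∧ (∃ p ∈ P, inner ℝ p u = c) ∧
      (∀ y ∈ P, inner ℝ y u ≤ c) ∧ c < inner ℝ z u := by
  obtain ⟨S, rfl, -⟩ := hP
  obtain ⟨u, hu, hzu⟩ := exists_extreme_polarBody_one_lt h0 hz
  have hspan := span_active_eq_top_of_extreme_polarBody hu
  set A : Set (Euc d) := {s : Euc d | s ∈ S ∧ inner ℝ s u = 1} with hA
  have hu0 : u ≠ 0 := by
    rintro rfl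
    simp at hzu
    linarith
  have hnorm : 0 < ‖u‖ := norm_pos_iff.2 hu0
  obtain ⟨s₀, hs₀⟩ : A.Nonempty := by
    rw [nonempty_iff_ne_empty]
    intro h
    rw [h, Submodule.span_empty] at hspan
    exact hu0 ((Submodule.mem_bot ℝ).1 (hspan ▸ Submodule.mem_top))
  have hle : ∀ y ∈ convexHull ℝ (S : Set (Euc d)), inner ℝ y u ≤ 1 := fun y hy =>
    inner_le_of_mem_convexHull hu.1 hy
  have hAP : A ⊆ convexHull ℝ (S : Set (Euc d)) := fun s hs => subset_convexHull ℝ _ hs.1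
  have hpos : 0 < ‖u‖⁻¹ := inv_pos.2 hnorm
  refine ⟨‖u‖⁻¹ • u, ‖u‖⁻¹, ⟨?_, ?_⟩, hpos, ⟨s₀, hAP hs₀, ?_⟩, fun y hy => ?_, ?_⟩
  · rw [norm_smul, norm_inv, norm_norm, inv_mul_cancel₀ hnorm.ne']
  · set F := exposedFaceAt (convexHull ℝ (S : Set (Euc d))) (‖u‖⁻¹ • u) with hF
    have hAF : A ⊆ F := fun s hs => ⟨hAP hs, fun y hy => by
      rw [real_inner_smul_right, real_inner_smul_right, hs.2]
      exact mul_le_mul_of_nonneg_left (hle y hy) hpos.le⟩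
    have hF1 : ∀ y ∈ F, inner ℝ y u = 1 := fun y hy => by
      refine le_antisymm (hle y hy.1) ?_
      have h := hy.2 s₀ (hAP hs₀)
      rw [real_inner_smul_right, real_inner_smul_right, hs₀.2] at h
      exact le_of_mul_le_mul_left h hpos
    set D := (affineSpan ℝ F).direction with hD
    have hDle : D ≤ (Submodule.span ℝ {u})ᗮ := by
      rw [hD, direction_affineSpan, vectorSpan_def, Submodule.span_le]
      rintro _ ⟨p, hp, q, hq, rfl⟩
      rw [SetLike.mem_coe, Submodule.mem_orthogonal_singleton_iff_inner_left]
      simp [inner_sub_left, hF1 p hp, hF1 q hq]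
    have htop : (⊤ : Submodule ℝ (Euc d)) ≤ D ⊔ Submodule.span ℝ {s₀} := by
      rw [← hspan, Submodule.span_le]
      intro s hs
      have hmem : s - s₀ ∈ D := by
        rw [hD, direction_affineSpan]
        exact vsub_mem_vectorSpan ℝ (hAF hs) (hAF hs₀)
      have := Submodule.add_mem_sup hmem (Submodule.mem_span_singleton_self (R := ℝ) s₀)
      simpa using this
    have hrank := Submodule.finrank_mono htop
    have hsup := Submodule.finrank_add_le_finrank_add_finrank D (Submodule.span ℝ {s₀})
    have hs₀_ne : s₀ ≠ 0 := by
      rintro rfl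
      simpa using hs₀.2
    have hone := finrank_span_singleton (K := ℝ) hs₀_ne
    have hperp := Submodule.finrank_add_finrank_orthogonal (Submodule.span ℝ {u})
    have hmono := Submodule.finrank_mono hDle
    rw [finrank_span_singleton hu0] at hperp
    rw [finrank_top] at hrank
    rw [finrank_euclideanSpace_fin] at hrank hperp
    omega
  · rw [real_inner_smul_right, hs₀.2, mul_one]
  · rw [real_inner_smul_right]
    exact mul_le_of_le_one_right hpos.le (hle y hy)
  · rw [real_inner_smul_right]
    exact lt_mul_of_one_lt_right hpos hzu

theorem mem_homo_iff {P : Set (Euc d)} {c p : Euc d} {t : ℝ} :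
    p ∈ homo c t P ↔ ∃ y ∈ P, p = c + t • y := by
  simp [homo, mem_smul_set, eq_comm, eq_neg_add_iff_add_eq]

theorem zero_mem_interior_of_symmetric {P : Set (Euc d)} (hconv : Convex ℝ P)
    (hsymm : P = -P) (hne : (interior P).Nonempty) : 0 ∈ interior P := by
  obtain ⟨q, hq⟩ := hne
  have hneg : -q ∈ interior P := by
    have h : -q ∈ Homeomorph.neg (Euc d) ⁻¹' interior P := by simpa using hq
    rw [Homeomorph.preimage_interior] at h
    rwa [hsymm]
  have := hconv.interior.midpoint_mem hq hneg
  simpa using this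

/-- Every level between two values of `⟪·, u⟫` on a weakly non-separable family is attained
on the family when `u` is a facet normal. -/
theorem WNS.exists_inner_eq {P : Set (Euc d)} {n : ℕ} {x : Fin n → Euc d} {τ : Fin n → ℝ}
    (h : WNS P x τ) {u : Euc d} (hu : IsFacetNormal P u) {c : ℝ} (hmax : ∃ p ∈ P, inner ℝ p u = c)
    (hle : ∀ y ∈ P, inner ℝ y u ≤ c) {p q : Euc d} (hp : p ∈ ⋃ i, homo (x i) (τ i) P)
    (hq : q ∈ ⋃ i, homo (x i) (τ i) P) {t : ℝ} (ht : t ∈ Icc (inner ℝ q u) (inner ℝ p u)) :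
    ∃ i, ∃ y ∈ P, inner ℝ (x i) u + τ i * inner ℝ y u = t := by
  have hu1 : inner ℝ u u = (1 : ℝ) := by rw [real_inner_self_eq_norm_sq, hu.1, one_pow]
  have hconv := convex_convexHull ℝ (⋃ i, homo (x i) (τ i) P)
  obtain ⟨y, hy, hyt⟩ := hconv.isPreconnected.intermediate_value
    (subset_convexHull ℝ _ hq) (subset_convexHull ℝ _ hp)
    (f := fun y => (inner ℝ y u : ℝ)) (by fun_prop) ht
  obtain ⟨m, hm, hmc⟩ := hmax
  have hface : ∀ y ∈ exposedFaceAt P u, inner ℝ (y - (c - t) • u) u = t := fun y hy => by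
    have hyc : inner ℝ y u = c := le_antisymm (hle y hy.1) (hmc ▸ hy.2 m hm)
    rw [inner_sub_left, real_inner_smul_left, hyc, hu1]
    ring
  obtain ⟨i, w, hw, hwi⟩ := h {y | inner ℝ y u = t}
    ⟨u, by rintro rfl; simp at hu1, t, rfl⟩
    ⟨u, hu, (c - t) • u, fun y hy => ⟨y - (c - t) • u, hface y hy, by simp⟩⟩ ⟨y, hyt, hy⟩
  obtain ⟨v, hv, rfl⟩ := mem_homo_iff.1 hwi
  refine ⟨i, v, hv, ?_⟩
  rwa [mem_ofPred_eq, inner_add_left, real_inner_smul_left] at hw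

/-- minimal covering of a weakly non-separable family of positive
homothets of an o-symmetric d-polytope. -/
theorem stmt_4 (d n : ℕ) (hd : 2 ≤ d) (hn : 2 ≤ n)
    (P₀ : Set (Euc d)) (hP : IsPolytope P₀) (hsymm : P₀ = -P₀)
    (x : Fin n → Euc d) (τ : Fin n → ℝ) (hτ : ∀ i, 0 < τ i)
    (hWNS : WNS P₀ x τ) :
    (⋃ i, homo (x i) (τ i) P₀) ⊆
      homo ((∑ i, τ i)⁻¹ • ∑ i, τ i • x i) (∑ i, τ i) P₀ ∧
    ∃ c : Euc d, (⋃ i, homo (x i) (τ i) P₀) ⊆ homo c (∑ i, τ i) P₀ := by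
  suffices hcov : (⋃ i, homo (x i) (τ i) P₀) ⊆
      homo ((∑ i, τ i)⁻¹ • ∑ i, τ i • x i) (∑ i, τ i) P₀ from ⟨hcov, _, hcov⟩
  have hconv : Convex ℝ P₀ := by
    obtain ⟨S, rfl, -⟩ := hP
    exact convex_convexHull ℝ _
  have h0 : 0 ∈ interior P₀ := by
    obtain ⟨_, -, hne⟩ := hP
    exact zero_mem_interior_of_symmetric hconv hsymm hne
  set T := ∑ i, τ i with hTdef
  have hT : 0 < T := Finset.sum_pos (fun i _ => hτ i) ⟨⟨0, by omega⟩, Finset.mem_univ _⟩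
  intro p hp
  refine mem_homo_iff.2 ⟨T⁻¹ • (p - T⁻¹ • ∑ i, τ i • x i), ?_, ?_⟩
  swap
  · rw [smul_inv_smul₀ hT.ne', add_sub_cancel]
  by_contra hz
  obtain ⟨u, c, hu, hc, hmax, hle, hlt⟩ := exists_facetNormal_lt hP h0 hz
  have hge : ∀ y ∈ P₀, -c ≤ inner ℝ y u := fun y hy => by
    have := hle (-y) (by rw [hsymm]; simpa using hy)
    rw [inner_neg_left] at this
    linarith
  have hmean := sum_mul_sub_le_of_Ioc_covered (a := fun i => inner ℝ (x i) u)
    (fun i => (hτ i).le) (b := inner ℝ p u) hc.le fun i t ht => by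
      obtain ⟨m, hm, hmc⟩ := hmax
      have hmi : x i + τ i • m ∈ ⋃ i, homo (x i) (τ i) P₀ :=
        mem_iUnion.2 ⟨i, mem_homo_iff.2 ⟨m, hm, rfl⟩⟩
      obtain ⟨j, y, hy, rfl⟩ := hWNS.exists_inner_eq hu ⟨m, hm, hmc⟩ hle hp hmi (t := t)
        ⟨by rw [inner_add_left, real_inner_smul_left, hmc, mul_comm]; exact ht.1.le, ht.2⟩
      have hlow := mul_le_mul_of_nonneg_left (hge y hy) (hτ j).le
      have hupp := mul_le_mul_of_nonneg_left (hle y hy) (hτ j).le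
      exact ⟨j, by constructor <;> linarith⟩
  simp only [mul_sub, Finset.sum_sub_distrib, ← Finset.sum_mul, ← hTdef] at hmean
  rw [real_inner_smul_left, inner_sub_left, real_inner_smul_left, sum_inner] at hlt
  simp only [real_inner_smul_left] at hlt
  have hmul := mul_lt_mul_of_pos_left hlt (pow_pos hT 2)
  have hexp : T ^ 2 * (T⁻¹ * (inner ℝ p u - T⁻¹ * ∑ i, τ i * inner ℝ (x i) u))
      = T * inner ℝ p u - ∑ i, τ i * inner ℝ (x i) u := by
    field_simp
  linarith

end
end

section
/- Let ℱ = {[xᵢ − τᵢ, xᵢ + τᵢ] : τᵢ > 0, i = 1, …, n} be a finite family of closed intervals in ℝ such that ⋃ℱ is a single closed interval. Let x = (Σᵢ₌₁ⁿ τᵢxᵢ)/(Σᵢ₌₁ⁿ τᵢ). Then the closed interval [x − Σᵢ₌₁ⁿ τᵢ, x + Σᵢ₌₁ⁿ τᵢ] covers ⋃ℱ. -/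
open Set Metric Pointwise MeasureTheory

noncomputable section

variable {d : ℕ}

/-- If finitely many intervals `[x j - τ j, x j + τ j]` cover `(r, b]`, then the length `b - r` is
at most the total length of those intervals which reach beyond `r`. -/
theorem sub_le_sum_of_Ioc_subset_iUnion_Icc {ι : Type*} [Fintype ι] (x τ : ι → ℝ)
    (hτ : ∀ i, 0 ≤ τ i) {r b : ℝ} (hcov : Ioc r b ⊆ ⋃ i, Icc (x i - τ i) (x i + τ i)) :
    b - r ≤ ∑ j with r < x j + τ j, 2 * τ j := by
  have hsub : Ioc r b ⊆
      ⋃ j ∈ Finset.univ.filter (fun j => r < x j + τ j), Icc (x j - τ j) (x j + τ j) := by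
    intro t ht
    obtain ⟨j, hj⟩ := mem_iUnion.1 (hcov ht)
    exact mem_biUnion (by simpa using ht.1.trans_le hj.2) hj
  have hvol := (measure_mono (μ := volume) hsub).trans (measure_biUnion_finset_le _ _)
  have hlen : ∀ j, x j + τ j - (x j - τ j) = 2 * τ j := fun j => by ring
  simp only [Real.volume_Ioc, Real.volume_Icc, hlen] at hvol
  have hnonneg : ∀ j, 0 ≤ 2 * τ j := fun j => by linarith [hτ j]
  rw [← ENNReal.ofReal_sum_of_nonneg fun j _ => hnonneg j] at hvol
  exact (ENNReal.ofReal_le_ofReal_iff (Finset.sum_nonneg fun j _ => hnonneg j)).1 hvol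

/-- If finitely many intervals `[x i - τ i, x i + τ i]` leave no gap to the left of `b`, then `b`
lies within `∑ i, τ i` of their weighted center. -/
theorem sum_mul_sub_le_sq_sum {ι : Type*} [Fintype ι] (x τ : ι → ℝ) (hτ : ∀ i, 0 ≤ τ i) {b : ℝ}
    (hcov : ∀ i, Ioc (x i + τ i) b ⊆ ⋃ j, Icc (x j - τ j) (x j + τ j)) :
    ∑ i, τ i * (b - x i) ≤ (∑ i, τ i) ^ 2 := by
  classical
  let r : ι → ℝ := fun i => x i + τ i
  let f : ι → ι → ℝ := fun i j => if r i < r j then τ i * τ j else 0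
  have hterm : ∀ i, τ i * (b - x i) ≤
      ∑ j, ((if i = j then τ i * τ j else 0) + f i j + f i j) := by
    intro i
    have h := mul_le_mul_of_nonneg_left
      (sub_le_sum_of_Ioc_subset_iUnion_Icc x τ hτ (hcov i)) (hτ i)
    have hf : τ i * ∑ j with x i + τ i < x j + τ j, 2 * τ j = ∑ j, f i j + ∑ j, f i j := by
      rw [Finset.sum_filter, Finset.mul_sum, ← Finset.sum_add_distrib]
      refine Finset.sum_congr rfl fun j _ => ?_
      simp only [f, r]
      split_ifs <;> ring
    simp only [Finset.sum_add_distrib, Finset.sum_ite_eq, Finset.mem_univ, if_true]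
    linarith
  calc ∑ i, τ i * (b - x i)
      ≤ ∑ i, ∑ j, ((if i = j then τ i * τ j else 0) + f i j + f i j) :=
        Finset.sum_le_sum fun i _ => hterm i
    _ = ∑ i, ∑ j, ((if i = j then τ i * τ j else 0) + f i j + f j i) := by
        simp only [Finset.sum_add_distrib]
        rw [Finset.sum_comm (f := fun i j => f j i)]
    _ ≤ ∑ i, ∑ j, τ i * τ j := by
        refine Finset.sum_le_sum fun i _ => Finset.sum_le_sum fun j _ => ?_
        have hij := mul_nonneg (hτ i) (hτ j)
        rcases eq_or_ne i j with rfl | hne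
        · simp [f]
        · rcases lt_trichotomy (r i) (r j) with h | h | h
          · simp [f, hne, h, h.not_gt]
          · simp [f, hne, h, hij]
          · simp [f, hne, h, h.not_gt, mul_comm]
    _ = (∑ i, τ i) ^ 2 := by rw [sq, Finset.sum_mul_sum]

/-- the Goodman–Goodman lemma for intervals on the real line. -/
theorem stmt_5 (n : ℕ) (x τ : Fin n → ℝ) (hτ : ∀ i, 0 < τ i)
    (a b : ℝ) (hab : (⋃ i, Set.Icc (x i - τ i) (x i + τ i)) = Set.Icc a b) :
    (⋃ i, Set.Icc (x i - τ i) (x i + τ i)) ⊆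
      Set.Icc ((∑ i, τ i)⁻¹ * (∑ i, τ i * x i) - ∑ i, τ i)
              ((∑ i, τ i)⁻¹ * (∑ i, τ i * x i) + ∑ i, τ i) := by
  intro t ht
  obtain ⟨k, -⟩ := mem_iUnion.1 ht
  have hT : 0 < ∑ i, τ i := Finset.sum_pos (fun i _ => hτ i) ⟨k, Finset.mem_univ k⟩
  have hτ₀ : ∀ i, 0 ≤ τ i := fun i => (hτ i).le
  have hIcc : ∀ i, Icc (x i - τ i) (x i + τ i) ⊆ Icc a b := fun i =>
    hab ▸ subset_iUnion (fun i => Icc (x i - τ i) (x i + τ i)) i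
  have hright : ∑ i, τ i * (b - x i) ≤ (∑ i, τ i) ^ 2 := by
    refine sum_mul_sub_le_sq_sum x τ hτ₀ fun i s hs => ?_
    rw [hab]
    exact ⟨(hIcc i ⟨by linarith [hτ i], le_rfl⟩).1.trans hs.1.le, hs.2⟩
  have hleft : ∑ i, τ i * (-a - -x i) ≤ (∑ i, τ i) ^ 2 := by
    refine sum_mul_sub_le_sq_sum (fun i => -x i) τ hτ₀ fun i s hs => ?_
    have hi := (hIcc i ⟨le_rfl, by linarith [hτ i]⟩).2
    have hs' : -s ∈ ⋃ i, Icc (x i - τ i) (x i + τ i) := by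
      rw [hab]
      exact ⟨by linarith [hs.2], by linarith [hs.1]⟩
    obtain ⟨j, hj⟩ := mem_iUnion.1 hs'
    exact mem_iUnion.2 ⟨j, by linarith [hj.2], by linarith [hj.1]⟩
  simp only [mul_sub, Finset.sum_sub_distrib, ← Finset.sum_mul, mul_neg,
    Finset.sum_neg_distrib] at hright hleft
  rw [hab] at ht
  have hcenter : (∑ i, τ i) * ((∑ i, τ i)⁻¹ * ∑ i, τ i * x i) = ∑ i, τ i * x i :=
    mul_inv_cancel_left₀ hT.ne' _
  constructor
  · refine le_trans (le_of_mul_le_mul_left ?_ hT) ht.1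
    rw [mul_sub, hcenter]
    linarith
  · refine ht.2.trans (le_of_mul_le_mul_left ?_ hT)
    rw [mul_add, hcenter]
    linarith

end
end

section
/- Let P be a generic d-polytope in ℝ^d (d ≥ 2) with facets F₁, …, F_s, let u₁, …, u_s be the outer unit normal vectors of the facets, and let H₁⁺, …, H_s⁺ be the corresponding closed supporting halfspaces of P, so that P = ⋂ᵢ₌₁ˢ Hᵢ⁺. Let K be a convex body in ℝ^d. Suppose that for every choice of d+1 indices i₁ < i₂ < … < i_{d+1} in {1, …, s}, if the intersection H_{i₁}⁺ ∩ H_{i₂}⁺ ∩ … ∩ H_{i_{d+1}}⁺ is bounded (in which case it is a d-simplex containing P), then it contains a translate of K. Then P itself contains a translate of K. -/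
open Set Metric Pointwise MeasureTheory

noncomputable section

variable {d : ℕ}

/-- The support value of `P` in direction `u`. -/
def suppVal (P : Set (Euc d)) (u : Euc d) : ℝ :=
  sSup ((fun y => (inner ℝ y u : ℝ)) '' P)

/-- A nonempty bounded intersection of halfspaces has no nonzero recession direction. -/
theorem exists_pos_inner_of_isBounded {ι : Type*} {J : Set ι} {u : ι → Euc d} {h : ι → ℝ}
    (hne : (⋂ i ∈ J, {x : Euc d | (inner ℝ x (u i) : ℝ) ≤ h i}).Nonempty)
    (hb : Bornology.IsBounded (⋂ i ∈ J, {x : Euc d | (inner ℝ x (u i) : ℝ) ≤ h i}))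
    {w : Euc d} (hw : w ≠ 0) : ∃ i ∈ J, 0 < (inner ℝ w (u i) : ℝ) := by
  by_contra! hcon
  obtain ⟨p, hp⟩ := hne
  obtain ⟨R, hR⟩ := hb.exists_norm_le
  have hwpos : 0 < ‖w‖ := norm_pos_iff.mpr hw
  have hR0 : 0 ≤ R := (norm_nonneg p).trans (hR p hp)
  set t : ℝ := (R + ‖p‖ + 1) / ‖w‖ with ht
  have ht0 : 0 ≤ t := by positivity
  have hmem : p + t • w ∈ ⋂ i ∈ J, {x : Euc d | (inner ℝ x (u i) : ℝ) ≤ h i} := by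
    simp only [mem_iInter, mem_ofPred_eq] at hp ⊢
    intro i hi
    rw [inner_add_left, real_inner_smul_left]
    have := mul_nonpos_of_nonneg_of_nonpos ht0 (hcon i hi)
    linarith [hp i hi]
  have hle := hR _ hmem
  have hnorm : ‖t • w‖ = R + ‖p‖ + 1 := by
    rw [norm_smul, Real.norm_of_nonneg ht0, ht, div_mul_cancel₀ _ hwpos.ne']
  have htri : ‖t • w‖ ≤ ‖p + t • w‖ + ‖p‖ := by
    simpa using norm_sub_le (p + t • w) p
  linarith

/-- A finite intersection of halfspaces whose recession cone is trivial is bounded. -/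
theorem isBounded_iInter_halfspace {ι : Type*} {J : Finset ι} {u : ι → Euc d} (h : ι → ℝ)
    (hpos : ∀ w : Euc d, w ≠ 0 → ∃ i ∈ J, 0 < (inner ℝ w (u i) : ℝ)) :
    Bornology.IsBounded (⋂ i ∈ J, {x : Euc d | (inner ℝ x (u i) : ℝ) ≤ h i}) := by
  rcases subsingleton_or_nontrivial (Euc d) with hE | hE
  · exact (Set.toFinite _).isBounded
  obtain ⟨e, he⟩ := exists_ne (0 : Euc d)
  have hJ : J.Nonempty := (hpos e he).imp fun _ hi => hi.1
  have hcont : Continuous fun x : Euc d => J.sup' hJ fun i => (inner ℝ x (u i) : ℝ) :=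
    Continuous.finset_sup'_apply hJ fun i _ => by fun_prop
  obtain ⟨x₀, hx₀, hmin⟩ := (isCompact_sphere (0 : Euc d) 1).exists_isMinOn
    (NormedSpace.sphere_nonempty.mpr zero_le_one) hcont.continuousOn
  set m := J.sup' hJ fun i => (inner ℝ x₀ (u i) : ℝ) with hm
  have hm0 : 0 < m := by
    rw [hm, Finset.lt_sup'_iff]
    exact hpos x₀ (ne_zero_of_mem_unit_sphere ⟨x₀, hx₀⟩)
  refine isBounded_iff_forall_norm_le.mpr ⟨|J.sup' hJ h| / m, fun x hx => ?_⟩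
  rcases eq_or_ne x 0 with rfl | hx0
  · rw [norm_zero]; positivity
  have hxpos : 0 < ‖x‖ := norm_pos_iff.mpr hx0
  have hle : m ≤ J.sup' hJ fun i => (inner ℝ (‖x‖⁻¹ • x) (u i) : ℝ) :=
    hmin (a := ‖x‖⁻¹ • x) (by simp [norm_smul, hxpos.ne'])
  obtain ⟨i, hi, hsup⟩ := (Finset.le_sup'_iff hJ).mp hle
  rw [real_inner_smul_left, inv_mul_eq_div, le_div_iff₀ hxpos] at hsup
  simp only [mem_iInter, mem_ofPred_eq] at hx
  rw [le_div_iff₀ hm0]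
  have h1 := hx i hi
  have h2 := Finset.le_sup' h hi
  have h3 := le_abs_self (J.sup' hJ h)
  linarith

theorem eq_zero_of_inner_eq_zero {ι : Type*} {J : Finset ι} {u : ι → Euc d} (hJ : J.card = d)
    (hlin : LinearIndependent ℝ fun i : J => u i) {w : Euc d}
    (hw : ∀ i ∈ J, (inner ℝ w (u i) : ℝ) = 0) : w = 0 := by
  have hspan := hlin.span_eq_top_of_card_eq_finrank' (by simp [hJ])
  have hmem : w ∈ Submodule.span ℝ (range fun i : J => u i) := hspan ▸ Submodule.mem_top
  refine inner_self_eq_zero (𝕜 := ℝ).mp ?_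
  refine Submodule.span_induction (p := fun x _ => (inner ℝ w x : ℝ) = 0) ?_ ?_ ?_ ?_ hmem
  · rintro _ ⟨i, rfl⟩
    exact hw i i.2
  · simp
  · intro x y _ _ hx hy
    rw [inner_add_right, hx, hy, add_zero]
  · intro a x _ hx
    rw [real_inner_smul_right, hx, mul_zero]

theorem exists_inner_eq {ι : Type*} {J : Finset ι} {u : ι → Euc d} (hJ : J.card = d)
    (hlin : LinearIndependent ℝ fun i : J => u i) (c : ℝ) :
    ∃ z : Euc d, ∀ i ∈ J, (inner ℝ z (u i) : ℝ) = c := by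
  let A : Euc d →ₗ[ℝ] (J → ℝ) := LinearMap.pi fun i => innerₗ (Euc d) (u i)
  have hA : ∀ x i, A x i = (inner ℝ x (u i) : ℝ) := fun x i => by
    simp [A, real_inner_comm]
  have hinj : Function.Injective A := by
    refine (injective_iff_map_eq_zero A).mpr fun w hw => ?_
    refine eq_zero_of_inner_eq_zero hJ hlin fun i hi => ?_
    rw [← hA w ⟨i, hi⟩, hw, Pi.zero_apply]
  have hsurj := (LinearMap.injective_iff_surjective_of_finrank_eq_finrank
    (by simp [hJ])).mp hinj
  obtain ⟨z, hz⟩ := hsurj fun _ => c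
  exact ⟨z, fun i hi => by rw [← hA z ⟨i, hi⟩, hz]⟩

/-- For vectors in general position, a nonzero direction in the polar cone can be perturbed into
its interior. -/
theorem exists_inner_neg_of_inner_nonpos {ι : Type*} {J : Finset ι} {u : ι → Euc d}
    (hcard : d ≤ J.card)
    (hgen : ∀ I ⊆ J, I.card = d → LinearIndependent ℝ fun i : I => u i)
    {w : Euc d} (hw : w ≠ 0) (hneg : ∀ i ∈ J, (inner ℝ w (u i) : ℝ) ≤ 0) :
    ∃ w' : Euc d, ∀ i ∈ J, (inner ℝ w' (u i) : ℝ) < 0 := by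
  classical
  set Z := J.filter fun i => (inner ℝ w (u i) : ℝ) = 0 with hZ
  have hZJ : Z ⊆ J := Finset.filter_subset _ _
  have hZcard : Z.card ≤ d := by
    by_contra! hlt
    obtain ⟨I, hIZ, hI⟩ := Finset.exists_subset_card_eq hlt.le
    exact hw (eq_zero_of_inner_eq_zero hI (hgen I (hIZ.trans hZJ) hI) fun i hi =>
      (Finset.mem_filter.mp (hIZ hi)).2)
  obtain ⟨I, hZI, hIJ, hI⟩ := Finset.exists_subsuperset_card_eq hZJ hZcard hcard
  obtain ⟨z, hz⟩ := exists_inner_eq hI (hgen I hIJ hI) (-1)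
  have hev : ∀ i ∈ J, ∀ᶠ ε : ℝ in nhdsWithin 0 (Ioi 0),
      (inner ℝ (w + ε • z) (u i) : ℝ) < 0 := by
    intro i hi
    rcases (hneg i hi).lt_or_eq with hlt | heq
    · have hc : Continuous fun ε : ℝ => (inner ℝ (w + ε • z) (u i) : ℝ) := by fun_prop
      refine nhdsWithin_le_nhds ((hc.tendsto 0).eventually_lt_const ?_)
      simpa using hlt
    · filter_upwards [self_mem_nhdsWithin] with ε hε
      rw [inner_add_left, real_inner_smul_left, heq,
        hz i (hZI (Finset.mem_filter.mpr ⟨hi, heq⟩))]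
      linarith [mem_Ioi.mp hε]
  obtain ⟨ε, hε⟩ := ((Filter.eventually_all_finset J).mpr hev).exists
  exact ⟨w + ε • z, hε⟩

/-- If some direction points strictly into all the halfspaces, every bounded set can be translated
into their intersection. -/
theorem exists_translate_of_inner_neg {ι : Type*} {J : Finset ι} {u : ι → Euc d} (h : ι → ℝ)
    {K : Set (Euc d)} (hK : Bornology.IsBounded K) {w : Euc d}
    (hw : ∀ i ∈ J, (inner ℝ w (u i) : ℝ) < 0) :
    ∃ v : Euc d, ∀ i ∈ J, ∀ y ∈ K, (inner ℝ (v + y) (u i) : ℝ) ≤ h i := by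
  obtain ⟨R, hR⟩ := hK.exists_norm_le
  have hev : ∀ i ∈ J, ∀ᶠ t : ℝ in Filter.atTop,
      t * (inner ℝ w (u i) : ℝ) ≤ h i - R * ‖u i‖ := fun i hi =>
    (Filter.tendsto_id.atTop_mul_const_of_neg (hw i hi)).eventually_le_atBot _
  obtain ⟨t, ht⟩ := ((Filter.eventually_all_finset J).mpr hev).exists
  refine ⟨t • w, fun i hi y hy => ?_⟩
  rw [inner_add_left, real_inner_smul_left]
  have h1 := real_inner_le_norm y (u i)
  have h2 := mul_le_mul_of_nonneg_right (hR y hy) (norm_nonneg (u i))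
  linarith [ht i hi]

/-- Boundedness of a nonempty intersection of halfspaces with normals in general position needs
more than `d` halfspaces. -/
theorem lt_card_of_isBounded {s : ℕ} (hd : 0 < d) {u : Fin s → Euc d} {h : Fin s → ℝ}
    (hgen : ∀ J : Finset (Fin s), J.card = d → LinearIndependent ℝ fun i : J => u i)
    (hne : (⋂ i, {x : Euc d | (inner ℝ x (u i) : ℝ) ≤ h i}).Nonempty)
    (hb : Bornology.IsBounded (⋂ i, {x : Euc d | (inner ℝ x (u i) : ℝ) ≤ h i})) : d < s := by
  by_contra! hs
  rw [← biInter_univ] at hne hb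
  have hpos : ∀ w : Euc d, w ≠ 0 → ∃ i, 0 < (inner ℝ w (u i) : ℝ) := fun w hw =>
    (exists_pos_inner_of_isBounded hne hb hw).imp fun _ hi => hi.2
  rcases hs.lt_or_eq with hlt | rfl
  · let A : Euc d →ₗ[ℝ] (Fin s → ℝ) := LinearMap.pi fun i => innerₗ (Euc d) (u i)
    obtain ⟨w, hw, hw0⟩ := (Submodule.ne_bot_iff _).mp
      (A.ker_ne_bot_of_finrank_lt (by simpa using hlt))
    obtain ⟨i, hi⟩ := hpos w hw0
    have hAi : A w i = 0 := by rw [LinearMap.mem_ker.mp hw, Pi.zero_apply]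
    have : (inner ℝ w (u i) : ℝ) = 0 := by simpa [A, real_inner_comm] using hAi
    linarith
  · obtain ⟨z, hz⟩ := exists_inner_eq (Finset.card_fin s)
      (hgen Finset.univ (Finset.card_fin s)) (-1)
    have hz0 : z ≠ 0 := by
      rintro rfl
      simpa using hz ⟨0, hd⟩ (Finset.mem_univ _)
    obtain ⟨i, hi⟩ := hpos z hz0
    linarith [hz i (Finset.mem_univ i)]

/-- a Lutwak-type containment theorem for generic polytopes. -/
theorem stmt_6 (d : ℕ) (hd : 2 ≤ d) (s : ℕ)
    (P : Set (Euc d)) (hP : IsPolytope P)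
    (u : Fin s → Euc d) (hu : ∀ i, IsFacetNormal P (u i))
    (huinj : Function.Injective u)
    (hall : ∀ w : Euc d, IsFacetNormal P w → ∃ i, w = u i)
    (hgen : ∀ J : Finset (Fin s), J.card = d →
      LinearIndependent ℝ (fun i : J => u (i : Fin s)))
    (hinter : P = ⋂ i, {x : Euc d | (inner ℝ x (u i) : ℝ) ≤ suppVal P (u i)})
    (K : Set (Euc d)) (hK : IsConvexBody K)
    (hsimplex : ∀ J : Finset (Fin s), J.card = d + 1 →
      Bornology.IsBounded (⋂ i ∈ J, {x : Euc d | (inner ℝ x (u i) : ℝ) ≤ suppVal P (u i)}) →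
      ∃ v : Euc d, ({v} + K) ⊆ ⋂ i ∈ J, {x : Euc d | (inner ℝ x (u i) : ℝ) ≤ suppVal P (u i)}) :
    ∃ v : Euc d, ({v} + K) ⊆ P := by
  have hKb : Bornology.IsBounded K := hK.1.isBounded
  obtain ⟨S, hS, hint⟩ := hP
  have hPb : Bornology.IsBounded P := hS ▸ isBounded_convexHull.mpr S.finite_toSet.isBounded
  have hPne : P.Nonempty := hint.mono interior_subset
  have hs : d < s := lt_card_of_isBounded (by omega) hgen (hinter ▸ hPne) (hinter ▸ hPb)
  let F : Fin s → Set (Euc d) := fun i =>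
    {v | ∀ y ∈ K, (inner ℝ (v + y) (u i) : ℝ) ≤ suppVal P (u i)}
  have hconv : ∀ i ∈ (Finset.univ : Finset (Fin s)), Convex ℝ (F i) := by
    intro i _ v hv v' hv' a b ha hb hab y hy
    have h1 := mul_le_mul_of_nonneg_left (hv y hy) ha
    have h2 := mul_le_mul_of_nonneg_left (hv' y hy) hb
    simp only [inner_add_left, real_inner_smul_left] at h1 h2 ⊢
    obtain rfl : b = 1 - a := by linarith
    linarith
  have hmeet : ∀ J ⊆ (Finset.univ : Finset (Fin s)),
      J.card = Module.finrank ℝ (Euc d) + 1 → (⋂ i ∈ J, F i).Nonempty := by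
    intro J _ hJ
    rw [finrank_euclideanSpace_fin] at hJ
    by_cases hrec : ∀ w : Euc d, w ≠ 0 → ∃ i ∈ J, 0 < (inner ℝ w (u i) : ℝ)
    · obtain ⟨v, hv⟩ := hsimplex J hJ (isBounded_iInter_halfspace _ hrec)
      refine ⟨v, mem_iInter₂.mpr fun i hi y hy => ?_⟩
      exact mem_iInter₂.mp (hv (add_mem_add (mem_singleton v) hy)) i hi
    · push Not at hrec
      obtain ⟨w, hw, hneg⟩ := hrec
      obtain ⟨w', hw'⟩ := exists_inner_neg_of_inner_nonpos (by omega)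
        (fun I _ hI => hgen I hI) hw hneg
      obtain ⟨v, hv⟩ := exists_translate_of_inner_neg (fun i => suppVal P (u i)) hKb hw'
      exact ⟨v, mem_iInter₂.mpr hv⟩
  obtain ⟨v, hv⟩ := Convex.helly_theorem (by simpa using hs) hconv hmeet
  refine ⟨v, ?_⟩
  rw [hinter, singleton_add]
  rintro _ ⟨y, hy, rfl⟩
  exact mem_iInter.mpr fun i => mem_iInter₂.mp hv i (Finset.mem_univ i) y hy

end
end
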